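/- (Goldman–Kamishima: the Auslander conjecture for flat Lorentz manifolds.) Let n ≥ 1 and let Γ be a subgroup of the group of affine transformations of ℝ^{n+1} whose linear parts all preserve the Lorentzian bilinear form B(x,y) = x₁y₁ + ⋯ + xₙyₙ − x_{n+1}y_{n+1} (i.e. Γ acts by isometries of flat Lorentzian space). If the action of Γ on ℝ^{n+1} is properly discontinuous with compact quotient, then Γ is virtually polycyclic. -/

import Mathlib

/-- A group is virtually polycyclic if it has a finite-index subgroup which is
solvable and all of whose subgroups are finitely generated. -/
def IsVirtuallyPolycyclic (G : Type*) [Group G] : Prop :=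
  ∃ H : Subgroup G, H.index ≠ 0 ∧ IsSolvable H ∧ ∀ K : Subgroup H, K.FG

/-- The Lorentzian bilinear form
`B(x, y) = x₁y₁ + ⋯ + xₙyₙ − x₍ₙ₊₁₎y₍ₙ₊₁₎` on `ℝ^{n+1}`. -/
def lorentzForm (n : ℕ) (x y : Fin (n + 1) → ℝ) : ℝ :=
  (∑ i : Fin n, x i.castSucc * y i.castSucc) - x (Fin.last n) * y (Fin.last n)

/-- The orbit equivalence relation of a subgroup `Γ` of the group of affine
self-equivalences of `ℝ^{n+1}`; its quotient is the orbit space `Γ \ ℝ^{n+1}`. -/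
def affineOrbitSetoid (n : ℕ)
    (Γ : Subgroup ((Fin (n + 1) → ℝ) ≃ᵃ[ℝ] (Fin (n + 1) → ℝ))) :
    Setoid (Fin (n + 1) → ℝ) where
  r x y := ∃ γ ∈ Γ, γ x = y
  iseqv := by
    constructor
    · exact fun x => ⟨1, Γ.one_mem, rfl⟩
    · rintro x y ⟨γ, hγ, rfl⟩
      exact ⟨γ⁻¹, Γ.inv_mem hγ, γ.symm_apply_apply x⟩
    · rintro x y z ⟨γ, hγ, rfl⟩ ⟨δ, hδ, rfl⟩
      exact ⟨δ * γ, Γ.mul_mem hδ hγ, rfl⟩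



namespace GK
open scoped commutatorElement

/-- Iterated left commutator sets. -/
def commSet {G : Type*} [Group G] (S : Set G) : ℕ → Set G
  | 0 => S
  | k + 1 => {g | ∃ a ∈ S, ∃ b ∈ commSet S k, g = ⁅a, b⁆}

lemma inv_norm_le {G M : Type*} [Group G] [NormedRing M] [NormOneClass M] (ρ : G →* M) (a : G)
    (ha : ‖ρ a - 1‖ < 1 / 8) : ‖ρ a⁻¹‖ ≤ 8 / 7 := by
  have h1 : ρ a⁻¹ = 1 - ρ a⁻¹ * (ρ a - 1) := by
    have : ρ a⁻¹ * ρ a = 1 := by rw [← map_mul]; simp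
    rw [mul_sub, this]; simp
  have h2 : ‖ρ a⁻¹‖ ≤ 1 + ‖ρ a⁻¹‖ * ‖ρ a - 1‖ := by
    calc ‖ρ a⁻¹‖ = ‖1 - ρ a⁻¹ * (ρ a - 1)‖ := by rw [← h1]
      _ ≤ ‖(1 : M)‖ + ‖ρ a⁻¹ * (ρ a - 1)‖ := norm_sub_le _ _
      _ ≤ 1 + ‖ρ a⁻¹‖ * ‖ρ a - 1‖ := by
        rw [norm_one]; gcongr; exact norm_mul_le _ _
  nlinarith [norm_nonneg (ρ a⁻¹)]

lemma comm_formula {G M : Type*} [Group G] [Ring M] (ρ : G →* M) (a b : G) :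
    ρ ⁅a, b⁆ - 1 = ((ρ a - 1) * (ρ b - 1) - (ρ b - 1) * (ρ a - 1)) * (ρ a⁻¹ * ρ b⁻¹) := by
  have h : (ρ a - 1) * (ρ b - 1) - (ρ b - 1) * (ρ a - 1) = ρ (a * b) - ρ (b * a) := by
    rw [map_mul, map_mul]; noncomm_ring
  rw [h, ← map_mul, sub_mul, ← map_mul, ← map_mul]
  rw [show b * a * (a⁻¹ * b⁻¹) = 1 by group, map_one]
  congr 2
  simp [commutatorElement_def, mul_assoc]

lemma comm_norm_le {G M : Type*} [Group G] [NormedRing M] [NormOneClass M] (ρ : G →* M) (a b : G)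
    (ha : ‖ρ a - 1‖ < 1 / 8) (hb : ‖ρ b - 1‖ < 1 / 8) :
    ‖ρ ⁅a, b⁆ - 1‖ ≤ 1 / 2 * ‖ρ b - 1‖ := by
  have h1 := inv_norm_le ρ a ha
  have h2 := inv_norm_le ρ b hb
  rw [comm_formula]
  have h3 : ‖(ρ a - 1) * (ρ b - 1) - (ρ b - 1) * (ρ a - 1)‖ ≤ 2 * (1/8) * ‖ρ b - 1‖ := by
    have i1 : ‖(ρ a - 1) * (ρ b - 1)‖ ≤ 1/8 * ‖ρ b - 1‖ :=
      (norm_mul_le _ _).trans (by gcongr)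
    have i2 : ‖(ρ b - 1) * (ρ a - 1)‖ ≤ ‖ρ b - 1‖ * (1/8) :=
      (norm_mul_le _ _).trans (by gcongr)
    have := norm_sub_le ((ρ a - 1) * (ρ b - 1)) ((ρ b - 1) * (ρ a - 1))
    linarith
  have h4 : ‖ρ a⁻¹ * ρ b⁻¹‖ ≤ 8/7 * (8/7) := (norm_mul_le _ _).trans (by gcongr)
  calc _ ≤ (2 * (1/8) * ‖ρ b - 1‖) * (8/7 * (8/7)) := (norm_mul_le _ _).trans (by gcongr)
    _ ≤ _ := by nlinarith [norm_nonneg (ρ b - 1)]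

/-- Zassenhaus lemma. -/
lemma zassenhaus0 {G M : Type*} [Group G] [NormedRing M] [NormOneClass M] (ρ : G →* M)
    (hfin : ∀ R : ℝ, (ρ '' {g | ‖ρ g‖ ≤ R}).Finite) (S : Set G)
    (hS : ∀ s ∈ S, ‖ρ s - 1‖ < 1 / 8) :
    ∃ k, ∀ j, k ≤ j → ∀ g ∈ commSet S j, ρ g = 1 := by
  have hb : ∀ k, ∀ g ∈ commSet S k, ‖ρ g - 1‖ < 1 / 8 ∧ ‖ρ g - 1‖ ≤ (1/2) ^ k := by
    intro k
    induction k with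
    | zero =>
      intro g hg
      have := hS g hg
      exact ⟨this, by rw [pow_zero]; linarith⟩
    | succ k ih =>
      rintro g ⟨a, ha, b, hb, rfl⟩
      have h1 := ih b hb
      have h2 := comm_norm_le ρ a b (hS a ha) h1.1
      refine ⟨by linarith [norm_nonneg (ρ b - 1)], ?_⟩
      rw [pow_succ]; linarith [h1.2]
  set F := (ρ '' {g | ‖ρ g‖ ≤ 2}) with hF
  have hFf : F.Finite := hfin 2
  have : ∃ δ > 0, ∀ x ∈ F, x ≠ 1 → δ ≤ ‖x - 1‖ := by
    by_cases hne : (F \ {1}).Nonempty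
    · obtain ⟨x, hx, hmin⟩ := (hFf.subset (Set.sdiff_subset (t := {1}))).exists_minimalFor
        (fun x => ‖x - 1‖) _ hne
      refine ⟨‖x - 1‖, norm_pos_iff.2 (sub_ne_zero.2 hx.2), fun y hy hy1 => ?_⟩
      by_contra hlt
      push Not at hlt
      have := hmin ⟨hy, hy1⟩ hlt.le
      exact absurd this (not_le.2 hlt)
    · refine ⟨1, one_pos, fun x hx h1 => absurd ⟨x, hx, h1⟩ hne⟩
  obtain ⟨δ, hδ, hmin⟩ := this
  obtain ⟨k, hk⟩ := exists_pow_lt_of_lt_one hδ (by norm_num : (1/2 : ℝ) < 1)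
  refine ⟨k, fun j hj g hg => ?_⟩
  by_contra hne
  have h1 := hb j g hg
  have h2 : ‖ρ g‖ ≤ 2 := by
    have := norm_add_le (ρ g - 1) 1
    rw [sub_add_cancel, norm_one] at this
    linarith
  have h3 := hmin (ρ g) ⟨g, h2, rfl⟩ hne
  have h4 : (1/2 : ℝ) ^ j ≤ (1/2) ^ k := pow_le_pow_of_le_one (by norm_num) (by norm_num) hj
  linarith [h1.2]

/-- Conjugated version. -/
lemma zassenhaus {G M : Type*} [Group G] [NormedRing M] [NormOneClass M] (ρ : G →* M)
    (hfin : ∀ R : ℝ, (ρ '' {g | ‖ρ g‖ ≤ R}).Finite) (S : Set G) (D D' : M)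
    (hD : D * D' = 1) (hD' : D' * D = 1)
    (hS : ∀ s ∈ S, ‖D * ρ s * D' - 1‖ < 1 / 8) :
    ∃ k, ∀ j, k ≤ j → ∀ g ∈ commSet S j, ρ g = 1 := by
  let ρ' : G →* M :=
    { toFun := fun g => D * ρ g * D'
      map_one' := by simp [hD]
      map_mul' := fun g h => by
        rw [map_mul]
        calc D * (ρ g * ρ h) * D' = D * ρ g * 1 * ρ h * D' := by noncomm_ring
          _ = D * ρ g * (D' * D) * ρ h * D' := by rw [hD']
          _ = _ := by noncomm_ring }
  have hρ' : ∀ g, ρ' g = D * ρ g * D' := fun _ => rfl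
  have hback : ∀ g, ρ g = D' * ρ' g * D := fun g => by
    rw [hρ']
    calc ρ g = 1 * ρ g * 1 := by simp
      _ = (D' * D) * ρ g * (D' * D) := by rw [hD']
      _ = _ := by noncomm_ring
  have hfin' : ∀ R : ℝ, ((fun g => ρ' g) '' {g | ‖ρ' g‖ ≤ R}).Finite := by
    intro R
    refine ((hfin (‖D'‖ * R * ‖D‖)).image (fun x => D * x * D')).subset ?_
    rintro _ ⟨g, hg, rfl⟩
    refine ⟨ρ g, ⟨g, ?_, rfl⟩, rfl⟩
    change ‖ρ g‖ ≤ _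
    rw [hback]
    calc _ ≤ ‖D' * ρ' g‖ * ‖D‖ := norm_mul_le _ _
      _ ≤ (‖D'‖ * ‖ρ' g‖) * ‖D‖ := by gcongr; exact norm_mul_le _ _
      _ ≤ _ := by gcongr; exact hg
  obtain ⟨k, hk⟩ := zassenhaus0 ρ' hfin' S hS
  refine ⟨k, fun j hj g hg => ?_⟩
  rw [hback, hk j hj g hg, mul_one, hD']

/-- Finite index from a finite-valued separating map. -/
lemma index_ne_zero_of_fin {G α : Type*} [Group G] [Finite α] (H : Subgroup G) (f : G → α)
    (h : ∀ a b, f a = f b → a⁻¹ * b ∈ H) : H.index ≠ 0 := by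
  have : Finite (G ⧸ H) := by
    refine Finite.of_injective (fun q : G ⧸ H => f q.out) ?_
    intro p q hpq
    have := h _ _ hpq
    have h2 := (QuotientGroup.eq (s := H)).2 this
    simpa using h2
  exact Subgroup.index_ne_zero_of_finite

lemma exists_finite_cover {E : Type*} [NormedAddCommGroup E] [ProperSpace E] (R ε : ℝ)
    (hε : 0 < ε) : ∃ (α : Type) (_ : Finite α) (c : E → α), ∀ x y, ‖x‖ ≤ R → ‖y‖ ≤ R → c x = c y →
      ‖x - y‖ < ε := by
  have hc : IsCompact (Metric.closedBall (0 : E) R) := isCompact_closedBall _ _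
  obtain ⟨t, ht, hcov⟩ := Metric.totallyBounded_iff.1 hc.totallyBounded (ε/2) (by positivity)
  classical
  have hch : ∀ x : E, ‖x‖ ≤ R → ∃ y ∈ t, dist x y < ε/2 := fun x hx => by
    have := hcov (show x ∈ Metric.closedBall (0 : E) R by simpa using hx)
    simpa using this
  obtain ⟨n, ⟨e⟩⟩ := Finite.exists_equiv_fin (↥t) (h := ht.to_subtype)
  refine ⟨Option (Fin n), inferInstance, fun x => if h : ‖x‖ ≤ R then
    some (e ⟨(hch x h).choose, (hch x h).choose_spec.1⟩) else none, ?_⟩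
  intro x y hx hy hxy
  simp only [hx, hy, dif_pos, Option.some.injEq, EmbeddingLike.apply_eq_iff_eq,
    Subtype.mk.injEq] at hxy
  have h1 := (hch x hx).choose_spec.2
  have h2 := (hch y hy).choose_spec.2
  rw [← hxy] at h2
  rw [← dist_eq_norm]
  have h2' := h2
  rw [dist_comm] at h2'
  linarith [dist_triangle x (hch x hx).choose y]

/-- Elements with small rotation part generate a finite index subgroup. -/
lemma index_of_small {G E : Type*} [Group G] [NormedAddCommGroup E] [InnerProductSpace ℝ E]
    [FiniteDimensional ℝ E] (σ : G →* (E →L[ℝ] E)) (hσ : ∀ g x, ‖σ g x‖ = ‖x‖) (ε : ℝ)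
    (hε : 0 < ε) (H : Subgroup G) (hH : ∀ g, ‖σ g - 1‖ < ε → g ∈ H) : H.index ≠ 0 := by
  have hle : ∀ g, ‖σ g‖ ≤ 1 := fun g =>
    ContinuousLinearMap.opNorm_le_bound _ zero_le_one (fun x => by rw [hσ, one_mul])
  have : ProperSpace (E →L[ℝ] E) := FiniteDimensional.proper_real _
  obtain ⟨α, hα, c, hc⟩ := exists_finite_cover (E := E →L[ℝ] E) 1 ε hε
  refine index_ne_zero_of_fin H (fun g => c (σ g)) (fun a b hab => hH _ ?_)
  have h1 := hc _ _ (hle b) (hle a) hab.symm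
  have : σ (a⁻¹ * b) - 1 = σ a⁻¹ * (σ b - σ a) := by
    rw [mul_sub, ← map_mul, ← map_mul]; simp
  rw [this]
  calc _ ≤ ‖σ a⁻¹‖ * ‖σ b - σ a‖ := norm_mul_le _ _
    _ ≤ 1 * ‖σ b - σ a‖ := by gcongr; exact hle _
    _ < ε := by rwa [one_mul]

lemma iso_conj_norm {G E : Type*} [Group G] [NormedAddCommGroup E] [InnerProductSpace ℝ E]
    (σ : G →* (E →L[ℝ] E)) (hσ : ∀ g x, ‖σ g x‖ = ‖x‖) (g h : G) :
    ‖σ (g * h * g⁻¹) - 1‖ ≤ ‖σ h - 1‖ := by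
  have hle : ∀ g, ‖σ g‖ ≤ 1 := fun g =>
    ContinuousLinearMap.opNorm_le_bound _ zero_le_one (fun x => by rw [hσ, one_mul])
  have : σ (g * h * g⁻¹) - 1 = σ g * (σ h - 1) * σ g⁻¹ := by
    rw [mul_sub, sub_mul, ← map_mul, ← map_mul, mul_one, ← map_mul]; simp
  rw [this]
  calc _ ≤ ‖σ g * (σ h - 1)‖ * ‖σ g⁻¹‖ := norm_mul_le _ _
    _ ≤ (‖σ g‖ * ‖σ h - 1‖) * 1 := by gcongr; exact norm_mul_le _ _; exact hle _
    _ ≤ (1 * ‖σ h - 1‖) * 1 := by gcongr; exact hle _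
    _ = _ := by ring

lemma iso_comm_norm {G E : Type*} [Group G] [NormedAddCommGroup E] [InnerProductSpace ℝ E]
    (σ : G →* (E →L[ℝ] E)) (hσ : ∀ g x, ‖σ g x‖ = ‖x‖) (g h : G) :
    ‖σ ⁅g, h⁆ - 1‖ ≤ 2 * ‖σ g - 1‖ * ‖σ h - 1‖ := by
  have hle : ∀ g, ‖σ g‖ ≤ 1 := fun g =>
    ContinuousLinearMap.opNorm_le_bound _ zero_le_one (fun x => by rw [hσ, one_mul])
  rw [comm_formula, ← map_mul]
  calc _ ≤ ‖(σ g - 1) * (σ h - 1) - (σ h - 1) * (σ g - 1)‖ * ‖σ (g⁻¹ * h⁻¹)‖ := norm_mul_le _ _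
    _ ≤ ‖(σ g - 1) * (σ h - 1) - (σ h - 1) * (σ g - 1)‖ * 1 := by gcongr; exact hle _
    _ ≤ ‖(σ g - 1) * (σ h - 1)‖ + ‖(σ h - 1) * (σ g - 1)‖ := by rw [mul_one]; exact norm_sub_le _ _
    _ ≤ ‖σ g - 1‖ * ‖σ h - 1‖ + ‖σ h - 1‖ * ‖σ g - 1‖ := by
      gcongr <;> exact norm_mul_le _ _
    _ = _ := by ring

/-- Frobenius type lemma. -/
lemma frob {G E : Type*} [Group G] [NormedAddCommGroup E] [InnerProductSpace ℝ E]
    [FiniteDimensional ℝ E] (σ : G →* (E →L[ℝ] E)) (hσ : ∀ g x, ‖σ g x‖ = ‖x‖) (a b : G)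
    (hb : ‖σ b - 1‖ < 1) (hc : σ ⁅a, b * a * b⁻¹⁆ = 1) : σ ⁅b, a⁆ = 1 := by
  have hle : ∀ g, ‖σ g‖ ≤ 1 := fun g =>
    ContinuousLinearMap.opNorm_le_bound _ zero_le_one (fun x => by rw [hσ, one_mul])
  -- commuting criterion
  have hcomm : ∀ g h : G, σ ⁅g, h⁆ = 1 → Commute (σ g) (σ h) := by
    intro g h hgh
    have : g * h = ⁅g, h⁆ * (h * g) := by simp [commutatorElement_def, mul_assoc]
    rw [commute_iff_eq, ← map_mul, this, map_mul, hgh, one_mul, map_mul]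
  set x := ⁅b, a⁆ with hx
  have hxa : b * a * b⁻¹ = x * a := by simp [hx, commutatorElement_def]
  have h1 : Commute (σ a) (σ (x * a)) := by rw [← hxa]; exact hcomm _ _ hc
  have h2 : Commute (σ a) (σ x) := by
    have e : σ x = σ (x * a) * σ a⁻¹ := by rw [← map_mul]; simp
    rw [e]
    refine h1.mul_right ?_
    rw [commute_iff_eq, ← map_mul, ← map_mul]; simp
  have hinv : Commute (σ a⁻¹) (σ x) := by
    rw [commute_iff_eq]
    calc σ a⁻¹ * σ x = σ a⁻¹ * σ x * (σ a * σ a⁻¹) := by rw [← map_mul σ a]; simp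
      _ = σ a⁻¹ * (σ x * σ a) * σ a⁻¹ := by simp only [mul_assoc]
      _ = σ a⁻¹ * (σ a * σ x) * σ a⁻¹ := by rw [h2.eq]
      _ = (σ a⁻¹ * σ a) * σ x * σ a⁻¹ := by simp only [mul_assoc]
      _ = _ := by rw [← map_mul σ a⁻¹]; simp
  have key : ∀ j : ℕ, σ ((a⁻¹) ^ j * b * ((a⁻¹)^j)⁻¹) = (σ x) ^ j * σ b := by
    intro j
    have e1 : b * a ^ j = (x * a) ^ j * b := by
      rw [← hxa, conj_pow]; simp
    have e2 : σ ((x * a) ^ j) = σ x ^ j * σ a ^ j := by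
      rw [map_pow, map_mul, h2.symm.mul_pow]
    rw [mul_assoc, inv_pow, inv_inv, e1, map_mul, map_mul, e2, ← inv_pow, map_pow]
    have e3 : σ a⁻¹ ^ j * σ x ^ j = σ x ^ j * σ a⁻¹ ^ j := (hinv.pow_pow j j).eq
    have e4 : σ a⁻¹ ^ j * σ a ^ j = 1 := by rw [← map_pow, ← map_pow, ← map_mul]; simp
    calc _ = (σ a⁻¹ ^ j * σ x ^ j) * σ a ^ j * σ b := by simp only [mul_assoc]
      _ = σ x ^ j * (σ a⁻¹ ^ j * σ a ^ j) * σ b := by rw [e3]; simp only [mul_assoc]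
      _ = _ := by rw [e4, mul_one]
  set c := ‖σ b - 1‖ with hcdef
  have hbd : ∀ (j : ℕ) (w : E), ‖(σ x ^ j) w - σ b⁻¹ w‖ ≤ c * ‖w‖ := by
    intro j w
    have h3 := iso_conj_norm σ hσ ((a⁻¹) ^ j) b
    rw [key] at h3
    have h4 := (σ x ^ j * σ b - 1).le_opNorm (σ b⁻¹ w)
    rw [hσ] at h4
    have h5 : (σ x ^ j * σ b - 1) (σ b⁻¹ w) = (σ x ^ j) w - σ b⁻¹ w := by
      have : σ b (σ b⁻¹ w) = w := by
        change (σ b * σ b⁻¹) w = w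
        rw [← map_mul]; simp
      simp [this]
    rw [h5] at h4
    exact h4.trans (by gcongr)
  set F := (σ x).eqLocus (1 : E →L[ℝ] E) with hF
  have hFbot : Fᗮ = ⊥ := by
    rw [Submodule.eq_bot_iff]
    intro w hw
    have ht := ContinuousLinearMap.tendsto_birkhoffAverage_orthogonalProjection (σ x) (hle x) w
    have hp : F.orthogonalProjectionOnto w = 0 := by
      exact Submodule.orthogonalProjectionOnto_apply_of_mem_orthogonal hw
    change Filter.Tendsto _ Filter.atTop (nhds ((F.orthogonalProjectionOnto w : F) : E)) at ht
    rw [hp] at ht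
    have ht2 := (ht.sub_const (σ b⁻¹ w)).norm
    have hle2 : ∀ᶠ N : ℕ in Filter.atTop,
        ‖birkhoffAverage ℝ (σ x) _root_.id N w - σ b⁻¹ w‖ ≤ c * ‖w‖ := by
      filter_upwards [Filter.eventually_gt_atTop 0] with N hN
      have hN' : (N : ℝ) ≠ 0 := by positivity
      have e : birkhoffAverage ℝ (σ x) _root_.id N w - σ b⁻¹ w
          = (N : ℝ)⁻¹ • ∑ j ∈ Finset.range N, ((σ x ^ j) w - σ b⁻¹ w) := by
        rw [Finset.sum_sub_distrib, smul_sub, birkhoffAverage, birkhoffSum]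
        congr 1
        · simp
        · simp [← Nat.cast_smul_eq_nsmul ℝ, smul_smul, hN']
      rw [e, norm_smul]
      calc _ ≤ ‖(N : ℝ)⁻¹‖ * ∑ j ∈ Finset.range N, (c * ‖w‖) := by
            gcongr
            exact norm_sum_le_of_le _ (fun j _ => hbd j w)
        _ = c * ‖w‖ := by
            simp; field_simp
    have := le_of_tendsto ht2 hle2
    rw [ZeroMemClass.coe_zero, zero_sub, norm_neg, hσ] at this
    have : ‖w‖ ≤ 0 := by nlinarith [norm_nonneg w]
    simpa using this
  have hFtop : F = ⊤ := by
    rw [← Submodule.orthogonal_orthogonal F, hFbot, Submodule.bot_orthogonal_eq_top]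
  ext w
  have : w ∈ F := by rw [hFtop]; trivial
  exact this

lemma frob2 {G E : Type*} [Group G] [NormedAddCommGroup E] [InnerProductSpace ℝ E]
    [FiniteDimensional ℝ E] (σ : G →* (E →L[ℝ] E)) (hσ : ∀ g x, ‖σ g x‖ = ‖x‖) (a t : G)
    (ht : ‖σ t - 1‖ < 1) (h : σ ⁅a, ⁅a, t⁆⁆ = 1) : σ ⁅a, t⁆ = 1 := by
  have h1 : σ ⁅a, t * a * t⁻¹⁆ = 1 := by
    have e : ⁅a, t * a * t⁻¹⁆ = ⁅a, t⁆⁻¹ * ⁅a, ⁅a, t⁆⁆⁻¹ * ⁅a, t⁆ := by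
      simp only [commutatorElement_def]; group
    have hinv : σ (⁅a, ⁅a, t⁆⁆⁻¹) = 1 := by
      have : σ (⁅a, ⁅a, t⁆⁆⁻¹) * σ ⁅a, ⁅a, t⁆⁆ = 1 := by
        rw [← map_mul, inv_mul_cancel, map_one]
      rwa [h, mul_one] at this
    rw [e, map_mul, map_mul, hinv, mul_one, ← map_mul, inv_mul_cancel, map_one]
  have h2 := frob σ hσ a t ht h1
  have h3 : σ ⁅a, t⁆ * σ ⁅t, a⁆ = 1 := by
    rw [← map_mul, ← commutatorElement_inv a t, mul_inv_cancel, map_one]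
  rwa [h2, mul_one] at h3

/-- If `a, b` have small rotations and the iterated commutators die, the rotations commute. -/
lemma comm_of_iter {G E : Type*} [Group G] [NormedAddCommGroup E] [InnerProductSpace ℝ E]
    [FiniteDimensional ℝ E] (σ : G →* (E →L[ℝ] E)) (hσ : ∀ g x, ‖σ g x‖ = ‖x‖) (a b : G)
    (ha : ‖σ a - 1‖ < 1 / 2) (hb : ‖σ b - 1‖ < 1 / 2)
    (hk : ∃ k, ∀ j, k ≤ j → ∀ g ∈ commSet {a, b} j, σ g = 1) : σ ⁅a, b⁆ = 1 := by
  let s : ℕ → G := fun k => Nat.rec b (fun _ x => ⁅a, x⁆) k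
  have s0 : s 0 = b := rfl
  have ss : ∀ k, s (k + 1) = ⁅a, s k⁆ := fun _ => rfl
  have hmem : ∀ k, s k ∈ commSet {a, b} k := by
    intro k
    induction k with
    | zero => exact Or.inr rfl
    | succ k ih => exact ⟨a, Or.inl rfl, s k, ih, rfl⟩
  have hsm : ∀ k, ‖σ (s k) - 1‖ < 1 / 2 := by
    intro k
    induction k with
    | zero => exact hb
    | succ k ih =>
      rw [ss]
      have := iso_comm_norm σ hσ a (s k)
      nlinarith [norm_nonneg (σ a - 1), norm_nonneg (σ (s k) - 1)]
  obtain ⟨k, hk⟩ := hk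
  have hend : σ (s (k + 1)) = 1 := hk (k+1) (by omega) _ (hmem _)
  have hdesc : ∀ k, σ (s (k + 1)) = 1 → σ (s 1) = 1 := by
    intro k
    induction k with
    | zero => exact id
    | succ k ih =>
      intro h
      apply ih
      rw [ss (k + 1), ss k] at h
      rw [ss k]
      exact frob2 σ hσ a (s k) (by linarith [hsm k]) h
  exact hdesc k hend

end GK


namespace GK
open scoped commutatorElement

/-- All subgroups of `H` are finitely generated. -/
def Noe {G : Type*} [Group G] (H : Subgroup G) : Prop := ∀ K : Subgroup G, K ≤ H → K.FG

lemma fg_of_map_ker {G A : Type*} [Group G] [Group A] (f : G →* A) (K : Subgroup G)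
    (h1 : (K.map f).FG) (h2 : (K ⊓ f.ker).FG) : K.FG := by
  rw [Subgroup.fg_iff] at h1 h2 ⊢
  obtain ⟨T, hT, hTf⟩ := h1
  obtain ⟨S, hS, hSf⟩ := h2
  have hTK : T ⊆ f '' (K : Set G) := by
    have : (T : Set A) ⊆ (Subgroup.closure T : Subgroup A) := Subgroup.subset_closure
    rw [hT] at this
    simpa using this
  obtain ⟨T', hT'K, hT'f, hT'⟩ : ∃ T' : Set G, T' ⊆ K ∧ T'.Finite ∧ f '' T' = T := by
    obtain ⟨T', h, h'⟩ := Set.exists_subset_bijOn (K : Set G) f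
    choose! g hg hg' using hTK
    refine ⟨g '' T, ?_, hTf.image g, ?_⟩
    · rintro _ ⟨t, ht, rfl⟩; exact hg ht
    · rw [Set.image_image]
      ext x; constructor
      · rintro ⟨t, ht, rfl⟩; simpa [hg' ht] using ht
      · intro hx; exact ⟨x, hx, hg' hx⟩
  refine ⟨S ∪ T', ?_, hSf.union hT'f⟩
  apply le_antisymm
  · rw [Subgroup.closure_le]
    rintro x (hx | hx)
    · have : x ∈ Subgroup.closure S := Subgroup.subset_closure hx
      rw [hS] at this
      exact this.1
    · exact hT'K hx
  · intro k hk
    have : f k ∈ (Subgroup.closure T').map f := by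
      rw [MonoidHom.map_closure, hT', hT]
      exact ⟨k, hk, rfl⟩
    obtain ⟨k1, hk1, hk2⟩ := this
    have hk1K : k1 ∈ K := (Subgroup.closure_le K).2 hT'K hk1
    have h3 : k * k1⁻¹ ∈ Subgroup.closure S := by
      rw [hS]
      refine ⟨K.mul_mem hk (K.inv_mem hk1K), ?_⟩
      change f _ = 1
      rw [map_mul, map_inv, hk2, mul_inv_cancel]
    have : k = (k * k1⁻¹) * k1 := by group
    rw [this]
    exact Subgroup.mul_mem _ (Subgroup.closure_mono Set.subset_union_left h3)
      (Subgroup.closure_mono Set.subset_union_right hk1)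

lemma fg_subgroupOf {G : Type*} [Group G] {K L : Subgroup G} (h : L ≤ K) :
    (L.subgroupOf K).FG ↔ L.FG := by
  rw [← Group.fg_iff_subgroup_fg, ← Group.fg_iff_subgroup_fg]
  have e := Subgroup.subgroupOfEquivOfLe h
  exact ⟨fun _ => Group.fg_of_surjective (f := e.toMonoidHom) e.surjective,
    fun _ => Group.fg_of_surjective (f := e.symm.toMonoidHom) e.symm.surjective⟩

lemma noe_of_hom {G A : Type*} [Group G] [Group A] (K : Subgroup G) (φ : K →* A)
    (h1 : ∀ L : Subgroup A, L ≤ φ.range → L.FG)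
    (h2 : ∀ K' ≤ K, (∀ k (hk : k ∈ K), k ∈ K' → φ ⟨k, hk⟩ = 1) → K'.FG) : Noe K := by
  intro K' hK'
  rw [← fg_subgroupOf hK']
  refine fg_of_map_ker φ _ (h1 _ ?_) ?_
  · rintro _ ⟨x, _, rfl⟩; exact ⟨x, rfl⟩
  · have := h2 (((K'.subgroupOf K) ⊓ φ.ker).map K.subtype) ?_ ?_
    · rw [← fg_subgroupOf (K := K)] at this
      · convert this
        exact (Subgroup.comap_map_eq_self_of_injective K.subtype_injective _).symm
      · rintro _ ⟨x, _, rfl⟩; exact x.2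
    · rintro _ ⟨x, _, rfl⟩; exact x.2
    · rintro k hk ⟨x, hx, rfl⟩
      exact hx.2

lemma noe_le {G : Type*} [Group G] {H K : Subgroup G} (h : H ≤ K) (hK : Noe K) : Noe H :=
  fun L hL => hK L (hL.trans h)

lemma fg_of_comm {A : Type*} [CommGroup A] [Group.FG A] (K : Subgroup A) : K.FG := by
  have : Module.Finite ℤ (Additive A) := Module.Finite.iff_addGroup_fg.2 inferInstance
  have hn : IsNoetherian ℤ (Additive A) := isNoetherian_of_isNoetherianRing_of_finite ℤ _
  rw [Subgroup.fg_iff_add_fg]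
  have := hn.noetherian (AddSubgroup.toIntSubmodule (Subgroup.toAddSubgroup K))
  rw [Submodule.fg_iff_addSubgroup_fg] at this
  simpa using this

/-- Lemma C, one step. -/
lemma noe_step {G : Type*} [Group G] (K Z : Subgroup G) (h : G) (hZ : Noe Z)
    (hc : ∀ g ∈ K, ⁅h, g⁆ ∈ Z) (hz : ∀ z ∈ Z, ∀ g ∈ K, g * z = z * g)
    (hK : ∀ K' ≤ K, (∀ k ∈ K', ⁅h, k⁆ = 1) → K'.FG) : Noe K := by
  let φ : K →* G :=
    { toFun := fun g => ⁅h, (g : G)⁆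
      map_one' := by simp
      map_mul' := fun g g' => by
        have h1 := hz _ (hc g' g'.2) g g.2
        have : ⁅h, ((g * g' : K) : G)⁆ = ⁅h, (g : G)⁆ * (g * ⁅h, (g' : G)⁆ * (g : G)⁻¹) := by
          simp only [commutatorElement_def, Subgroup.coe_mul]; group
        rw [this, h1]; simp }
  refine noe_of_hom K φ (fun L hL => hZ _ (hL.trans ?_)) (fun K' hK' hk => hK K' hK' ?_)
  · rintro _ ⟨x, rfl⟩; exact hc x x.2
  · intro k hkk; exact hk k (hK' hkk) hkk

lemma noe_steps {G : Type*} [Group G] (K Z : Subgroup G) (t : Finset G) (hZ : Noe Z)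
    (hc : ∀ h ∈ t, ∀ g ∈ K, ⁅h, g⁆ ∈ Z) (hz : ∀ z ∈ Z, ∀ g ∈ K, g * z = z * g)
    (hK : ∀ K' ≤ K, (∀ h ∈ t, ∀ k ∈ K', ⁅h, k⁆ = 1) → K'.FG) : Noe K := by
  classical
  induction t using Finset.induction_on generalizing K with
  | empty => intro K' hK'; exact hK K' hK' (by simp)
  | insert a s ha ih =>
    refine noe_step K Z a hZ (hc a (by simp)) hz (fun K' hK' hk => ?_)
    refine ih K' (fun h hh g hg => hc h (by simp [hh]) g (hK' hg))
      (fun z hz' g hg => hz z hz' g (hK' hg)) (fun K'' hK'' hk'' => hK K'' (hK''.trans hK') ?_) K' le_rfl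
    intro h hh k hkk
    rcases Finset.mem_insert.1 hh with rfl | hh
    · exact hk k (hK'' hkk)
    · exact hk'' h hh k hkk

/-- Lemma C with finite dimensional spans. -/
lemma noe_central {G M : Type*} [Group G] [Ring M] [Algebra ℝ M] [FiniteDimensional ℝ M]
    (ρ : G →* M) (hρ : Function.Injective ρ) (K Z : Subgroup G) (S : Set G) (hZ : Noe Z)
    (hc : ∀ h ∈ S, ∀ g ∈ K, ⁅h, g⁆ ∈ Z) (hz : ∀ z ∈ Z, ∀ g ∈ K, g * z = z * g)
    (hK : ∀ K' ≤ K, (∀ h ∈ S, ∀ k ∈ K', h * k = k * h) → K'.FG) : Noe K := by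
  classical
  have hfg : (Submodule.span ℝ (ρ '' S)).FG := IsNoetherian.noetherian _
  obtain ⟨t, htS, ht⟩ := (Submodule.fg_span_iff_fg_span_finset_subset _).1 hfg
  obtain ⟨t', ht'S, rfl⟩ := Finset.subset_set_image_iff.1 htS
  refine noe_steps K Z t' hZ (fun h hh => hc h (ht'S hh)) hz (fun K' hK' hk => hK K' hK' ?_)
  intro h hh k hkk
  apply hρ
  have : ρ h ∈ Submodule.span ℝ ((t'.image ρ : Finset M) : Set M) := by
    rw [← ht]; exact Submodule.subset_span ⟨h, hh, rfl⟩
  rw [map_mul, map_mul]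
  generalize ρ h = y0 at this
  induction this using Submodule.span_induction with
  | mem x hx =>
    simp only [Finset.coe_image, Set.mem_image] at hx
    obtain ⟨y, hy, rfl⟩ := hx
    have := hk y hy k hkk
    rw [commutatorElement_eq_one_iff_mul_comm] at this
    rw [← map_mul, this, map_mul]
  | zero => simp
  | add x y _ _ hx hy => rw [add_mul, mul_add, hx, hy]
  | smul a x _ hx => rw [smul_mul_assoc, mul_smul_comm, hx]

end GK


namespace GK
open scoped commutatorElement IsMulCommutative

/-- Block upper triangular filtration. -/
def blk {M : Type*} [Ring M] (P : Fin 4 → M) (k : ℕ) : Set M :=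
  {x | ∀ i j : Fin 4, (j : ℕ) < i + k → P i * x * P j = 0}

lemma blk_mul {M : Type*} [Ring M] {P : Fin 4 → M} (h1 : ∑ i, P i = 1)
    (h2 : ∀ i, P i * P i = P i) {k l : ℕ} {x y : M} (hx : x ∈ blk P k) (hy : y ∈ blk P l) :
    x * y ∈ blk P (k + l) := by
  intro i j hij
  have e : P i * (x * y) * P j = ∑ m, (P i * x * P m) * (P m * y * P j) := by
    have h3 : (∑ m, P m * P m) = 1 := by simp_rw [h2]; exact h1
    calc P i * (x * y) * P j = P i * x * (∑ m, P m * P m) * y * P j := by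
          rw [h3]; noncomm_ring
      _ = _ := by
        rw [Finset.mul_sum, Finset.sum_mul, Finset.sum_mul]
        refine Finset.sum_congr rfl fun m _ => by noncomm_ring
  rw [e]
  refine Finset.sum_eq_zero fun m _ => ?_
  by_cases hm : (m : ℕ) < i + k
  · rw [hx i m hm, zero_mul]
  · rw [hy m j (by omega), mul_zero]

lemma blk_mono {M : Type*} [Ring M] {P : Fin 4 → M} {k l : ℕ} (hkl : k ≤ l) {x : M}
    (hx : x ∈ blk P l) : x ∈ blk P k := fun i j hij => hx i j (by omega)

lemma blk_add {M : Type*} [Ring M] {P : Fin 4 → M} {k : ℕ} {x y : M}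
    (hx : x ∈ blk P k) (hy : y ∈ blk P k) : x + y ∈ blk P k := fun i j hij => by
  rw [mul_add, add_mul, hx i j hij, hy i j hij, add_zero]

lemma blk_sub {M : Type*} [Ring M] {P : Fin 4 → M} {k : ℕ} {x y : M}
    (hx : x ∈ blk P k) (hy : y ∈ blk P k) : x - y ∈ blk P k := fun i j hij => by
  rw [mul_sub, sub_mul, hx i j hij, hy i j hij, sub_zero]

lemma blk_four {M : Type*} [Ring M] {P : Fin 4 → M} (h1 : ∑ i, P i = 1) {x : M}
    (hx : x ∈ blk P 4) : x = 0 := by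
  calc x = (∑ i, P i) * x * (∑ j, P j) := by rw [h1]; simp
    _ = 0 := by
      rw [Finset.sum_mul, Finset.sum_mul]
      refine Finset.sum_eq_zero fun i _ => ?_
      rw [Finset.mul_sum]
      refine Finset.sum_eq_zero fun j _ => hx i j (by omega)

/-- Six times the truncated logarithm. -/
def lg {M : Type*} [Ring M] (x : M) : M := 6 * x - 3 * x ^ 2 + 2 * x ^ 3

lemma lg_map {R M : Type*} [Ring R] [Ring M] (f : R →+* M) (x : R) : f (lg x) = lg (f x) := by
  simp only [lg, map_add, map_sub, map_mul, map_pow, map_ofNat f 6, map_ofNat f 3, map_ofNat f 2]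

lemma lg_add_comm {M : Type*} [CommRing M] {x y : M} (h22 : x ^ 2 * y ^ 2 = 0)
    (h31 : x ^ 3 * y = 0) (h13 : x * y ^ 3 = 0) : lg (x + y + x * y) = lg x + lg y := by
  unfold lg
  linear_combination (9 + 6 * x + 6 * y + 2 * x * y) * h22 + 6 * h31 + 6 * h13

lemma lg_inv_comm {M : Type*} [CommRing M] {x : M} (h4 : x ^ 4 = 0) :
    216 * lg x + 18 * lg x ^ 2 + lg x ^ 3 = 1296 * x := by
  unfold lg
  linear_combination (270 + 162 * x - 171 * x ^ 2 + 126 * x ^ 3 - 36 * x ^ 4 + 8 * x ^ 5) * h4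

lemma lg_add {M : Type*} [Ring M] {x y : M} (hc : x * y = y * x) (h22 : x ^ 2 * y ^ 2 = 0)
    (h31 : x ^ 3 * y = 0) (h13 : x * y ^ 3 = 0) : lg (x + y + x * y) = lg x + lg y := by
  have hR : IsMulCommutative (Subring.closure ({x, y} : Set M)) := by
    refine Subring.isMulCommutative_closure ?_
    rintro a (rfl | rfl) b (rfl | rfl) <;> simp [hc]
  have key := @lg_add_comm (Subring.closure ({x, y} : Set M)) _
    ⟨x, Subring.subset_closure (by simp)⟩ ⟨y, Subring.subset_closure (by simp)⟩
    (Subtype.ext (by simpa using h22)) (Subtype.ext (by simpa using h31))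
    (Subtype.ext (by simpa using h13))
  have := congrArg (Subring.subtype _) key
  rw [map_add, lg_map, lg_map, lg_map] at this
  simpa using this

lemma lg_inv {M : Type*} [Ring M] {x : M} (h4 : x ^ 4 = 0) :
    216 * lg x + 18 * lg x ^ 2 + lg x ^ 3 = 1296 * x := by
  have hR : IsMulCommutative (Subring.closure ({x} : Set M)) := by
    refine Subring.isMulCommutative_closure ?_
    rintro a rfl b rfl; rfl
  have key := @lg_inv_comm (Subring.closure ({x} : Set M)) _
    ⟨x, Subring.subset_closure (by simp)⟩ (Subtype.ext (by simpa using h4))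
  have := congrArg (Subring.subtype _) key
  rw [map_add, map_add, map_mul, map_mul, map_mul, map_pow, map_pow, lg_map, map_ofNat, map_ofNat,
    map_ofNat] at this
  simpa using this

lemma fg_of_finite_bounded {E : Type*} [NormedAddCommGroup E] [NormedSpace ℝ E]
    [FiniteDimensional ℝ E] (L : AddSubgroup E)
    (h : ∀ R : ℝ, {x | x ∈ L ∧ ‖x‖ ≤ R}.Finite) : ∀ K ≤ L, K.FG := by
  let L' := AddSubgroup.toIntSubmodule L
  have hd : DiscreteTopology L' := by
    change DiscreteTopology (L' : Set E)
    rw [discreteTopology_subtype_iff']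
    intro y hy
    have hfin := (h (‖y‖ + 1)).sdiff (t := {y})
    refine ⟨Metric.ball y 1 \ ({x | x ∈ L ∧ ‖x‖ ≤ ‖y‖ + 1} \ {y}), ?_, ?_⟩
    · exact Metric.isOpen_ball.sdiff hfin.isClosed
    · ext x
      simp only [Set.mem_inter_iff, Set.mem_sdiff, Metric.mem_ball, Set.mem_ofPred_eq,
        Set.mem_singleton_iff, SetLike.mem_coe]
      constructor
      · rintro ⟨⟨h1, h2⟩, h3⟩
        by_contra hne
        refine h2 ⟨⟨h3, ?_⟩, hne⟩
        rw [dist_eq_norm] at h1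
        have := norm_add_le (x - y) y
        rw [sub_add_cancel] at this
        linarith
      · rintro rfl
        exact ⟨⟨by simp, by simp⟩, hy⟩
  have hfin : Module.Finite ℤ L' := inferInstance
  intro K hK
  have hn : IsNoetherian ℤ L' := isNoetherian_of_isNoetherianRing_of_finite ℤ _
  have hn' := isNoetherian_submodule.1 hn
  have := hn' (AddSubgroup.toIntSubmodule K) (by simpa [L'] using hK)
  rw [Submodule.fg_iff_addSubgroup_fg] at this
  simpa using this

lemma noe_abelian {G M : Type*} [Group G] [NormedRing M] [NormedAlgebra ℝ M] [NormOneClass M]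
    [FiniteDimensional ℝ M]
    (ρ : G →* M) (hρ : Function.Injective ρ) (hfin : ∀ R : ℝ, {g | ‖ρ g‖ ≤ R}.Finite)
    (P : Fin 4 → M) (h1 : ∑ i, P i = 1) (h2 : ∀ i, P i * P i = P i) (A : Subgroup G)
    (hA : ∀ g ∈ A, ρ g - 1 ∈ blk P 1) (hc : ∀ g ∈ A, ∀ h ∈ A, g * h = h * g) : Noe A := by
  have hm : ∀ x y z w : M, x ∈ blk P 1 → y ∈ blk P 1 → z ∈ blk P 1 → w ∈ blk P 1 →
      (x * y) * (z * w) = 0 := fun x y z w hx hy hz hw =>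
    blk_four h1 (blk_mul h1 h2 (blk_mul h1 h2 hx hy) (blk_mul h1 h2 hz hw))
  let φ : A →* Multiplicative M :=
    { toFun := fun g => Multiplicative.ofAdd (lg (ρ g - 1))
      map_one' := by simp [lg]
      map_mul' := fun g h => by
        rw [← ofAdd_add]
        congr 1
        have e : ρ ((g * h : A) : G) - 1 = (ρ g - 1) + (ρ h - 1) + (ρ g - 1) * (ρ h - 1) := by
          rw [Subgroup.coe_mul, map_mul]; noncomm_ring
        rw [e]
        have gx := hA g g.2
        have gy := hA h h.2
        apply lg_add
        · have := congrArg ρ (hc g g.2 h h.2)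
          rw [map_mul, map_mul] at this
          simp only [sub_mul, mul_sub, this, mul_one, one_mul]; abel
        · rw [pow_two, pow_two]; exact hm _ _ _ _ gx gx gy gy
        · rw [pow_succ, pow_two, mul_assoc]; exact hm _ _ _ _ gx gx gx gy
        · rw [pow_succ', pow_two, ← mul_assoc]; exact hm _ _ _ _ gx gy gy gy }
  have hφ : ∀ g : A, Multiplicative.toAdd (φ g) = lg (ρ g - 1) := fun _ => rfl
  have hrec : ∀ g : A, 216 * lg (ρ g - 1) + 18 * lg (ρ g - 1) ^ 2 + lg (ρ g - 1) ^ 3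
      = 1296 * (ρ g - 1) := fun g => lg_inv (by
    have gx := hA g g.2
    have := hm _ _ _ _ gx gx gx gx
    rw [← mul_assoc] at this
    rw [pow_succ, pow_succ, pow_two]; exact this)
  have h1296 : ∀ x : M, (1296 : M) * x = (1296 : ℝ) • x := fun x => by
    rw [Algebra.smul_def, map_ofNat]
  refine noe_of_hom A φ ?_ ?_
  · intro L hL
    have := fg_of_finite_bounded (Subgroup.toAddSubgroup' φ.range) ?_ (Subgroup.toAddSubgroup' L) ?_
    · rw [AddSubgroup.fg_iff_mul_fg] at this
      simpa using this
    · intro R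
      refine ((hfin (1 + (216 * R + 18 * R ^ 2 + R ^ 3) / 1296)).image
        (fun g => lg (ρ g - 1))).subset ?_
      rintro x ⟨⟨g, hg⟩, hxR⟩
      have hx : lg (ρ g - 1) = x := hg
      refine ⟨g, ?_, hx⟩
      have h3 := hrec g
      have h2o : ∀ (m : ℕ) (y : M), ‖(m : M) * y‖ = m * ‖y‖ := fun m y => by
        rw [← nsmul_eq_mul, ← Nat.cast_smul_eq_nsmul ℝ, norm_smul]; simp
      rw [hx] at h3
      have h4 : ‖(1296 : M) * (ρ g - 1)‖ ≤ 216 * R + 18 * R ^ 2 + R ^ 3 := by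
        rw [← h3]
        have a1 : ‖(216 : M) * x‖ = 216 * ‖x‖ := by simpa using h2o 216 x
        have a2 : ‖(18 : M) * x ^ 2‖ = 18 * ‖x ^ 2‖ := by simpa using h2o 18 (x ^ (2:ℕ))
        calc _ ≤ ‖(216 : M) * x‖ + ‖(18 : M) * x ^ 2‖ + ‖x ^ 3‖ := norm_add₃_le
          _ ≤ 216 * ‖x‖ + 18 * ‖x‖ ^ 2 + ‖x‖ ^ 3 := by
            rw [a1, a2]; gcongr <;> exact norm_pow_le _ _
          _ ≤ _ := by gcongr
      rw [h1296, norm_smul] at h4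
      have h5 := norm_add_le (ρ (g : G) - 1) 1
      rw [sub_add_cancel, norm_one] at h5
      have : ‖(1296:ℝ)‖ = 1296 := by norm_num
      rw [this] at h4
      change ‖ρ (g : G)‖ ≤ _
      linarith
    · simpa using hL
  · intro K' hK' hk
    have : K' = ⊥ := by
      rw [Subgroup.eq_bot_iff_forall]
      intro x hx
      have h3 := hrec ⟨x, hK' hx⟩
      have h4 : lg (ρ x - 1) = 0 := hk x (hK' hx) hx
      apply hρ
      rw [map_one, ← sub_eq_zero]
      simp only [h4] at h3
      rw [h1296] at h3
      have h5 : (0:M) = (1296:ℝ) • (ρ x - 1) := by rw [← h3]; simp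
      exact (smul_eq_zero.1 h5.symm).resolve_left (by norm_num)
    rw [this]; exact Subgroup.FG.bot

end GK


namespace GK
open scoped commutatorElement

lemma blk_neg {M : Type*} [Ring M] {P : Fin 4 → M} {k : ℕ} {x : M}
    (hx : x ∈ blk P k) : -x ∈ blk P k := fun i j hij => by
  rw [mul_neg, neg_mul, hx i j hij, neg_zero]

/-- Subgroups from the filtration. -/
def Uk {G M : Type*} [Group G] [Ring M] (ρ : G →* M) (P : Fin 4 → M) (h1 : ∑ i, P i = 1)
    (h2 : ∀ i, P i * P i = P i) (hup : ∀ g, ρ g ∈ blk P 0) (k : ℕ) : Subgroup G where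
  carrier := {g | ρ g - 1 ∈ blk P k}
  one_mem' := by
    change ρ 1 - 1 ∈ blk P k
    intro i j _; simp
  mul_mem' := by
    intro a b ha hb
    change ρ (a * b) - 1 ∈ blk P k
    have : ρ (a * b) - 1 = (ρ a - 1) * ρ b + (ρ b - 1) := by rw [map_mul]; noncomm_ring
    rw [this]
    exact blk_add (blk_mul h1 h2 ha (hup b)) hb
  inv_mem' := by
    intro a ha
    change ρ a⁻¹ - 1 ∈ blk P k
    have h3 : ρ a⁻¹ * ρ a = 1 := by rw [← map_mul]; simp
    have : ρ a⁻¹ - 1 = -(ρ a⁻¹ * (ρ a - 1)) := by rw [mul_sub, h3]; simp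
    rw [this]
    have := blk_mul h1 h2 (hup a⁻¹) ha
    rw [zero_add] at this
    exact blk_neg this

lemma noe_unip {G M : Type*} [Group G] [NormedRing M] [NormedAlgebra ℝ M] [NormOneClass M]
    [FiniteDimensional ℝ M]
    (ρ : G →* M) (hρ : Function.Injective ρ) (hfin : ∀ R : ℝ, {g | ‖ρ g‖ ≤ R}.Finite)
    (P : Fin 4 → M) (h1 : ∑ i, P i = 1) (h2 : ∀ i, P i * P i = P i) (hup : ∀ g, ρ g ∈ blk P 0) :
    Noe (Uk ρ P h1 h2 hup 1) ∧
    (∀ a ∈ Uk ρ P h1 h2 hup 1, ∀ b ∈ Uk ρ P h1 h2 hup 1, ⁅a, b⁆ ∈ Uk ρ P h1 h2 hup 2) ∧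
    (∀ a ∈ Uk ρ P h1 h2 hup 2, ∀ b ∈ Uk ρ P h1 h2 hup 2, ⁅a, b⁆ = 1) := by
  set U := Uk ρ P h1 h2 hup with hU
  have hmem : ∀ k g, g ∈ U k ↔ ρ g - 1 ∈ blk P k := fun _ _ => Iff.rfl
  have hcomm : ∀ k l g h, g ∈ U k → h ∈ U l → ⁅g, h⁆ ∈ U (k + l) := by
    intro k l g h hg hh
    rw [hmem] at *
    rw [comm_formula]
    have e1 := blk_mul h1 h2 hg hh
    have e2 := blk_mul h1 h2 hh hg
    rw [add_comm] at e2
    have := blk_mul h1 h2 (blk_sub e1 e2) (blk_mul h1 h2 (hup g⁻¹) (hup h⁻¹))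
    simpa using this
  have hone : ∀ k l g h, 4 ≤ k + l → g ∈ U k → h ∈ U l → ⁅g, h⁆ = 1 := by
    intro k l g h hkl hg hh
    have := hcomm k l g h hg hh
    rw [hmem] at this
    have := blk_four h1 (blk_mono hkl this)
    apply hρ
    rw [map_one, ← sub_eq_zero, this]
  have hc' : ∀ k l g h, 4 ≤ k + l → g ∈ U k → h ∈ U l → g * h = h * g := fun k l g h hkl hg hh =>
    commutatorElement_eq_one_iff_mul_comm.1 (hone k l g h hkl hg hh)
  have ab : ∀ k, 2 ≤ k → Noe (U k) := fun k hk =>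
    noe_abelian ρ hρ hfin P h1 h2 (U k) (fun g hg => blk_mono (by omega) hg)
      (fun g hg h hh => hc' k k g h (by omega) hg hh)
  refine ⟨?_, fun a ha b hb => hcomm 1 1 a b ha hb, fun a ha b hb => hone 2 2 a b (by omega) ha hb⟩
  refine noe_central ρ hρ (U 1) (U 3) (U 2) (ab 3 (by omega))
    (fun h hh g hg => hcomm 2 1 h g hh hg) (fun z hz g hg => hc' 1 3 g z (by omega) hg hz) ?_
  intro K' hK' hk
  refine noe_central ρ hρ K' (U 2) K' (ab 2 (by omega))
    (fun h hh g hg => hcomm 1 1 h g (hK' hh) (hK' hg)) (fun z hz g hg => (hk z hz g hg).symm) ?_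
    K' le_rfl
  intro K'' hK'' hk'
  exact noe_abelian ρ hρ hfin P h1 h2 K'' (fun g hg => hK' (hK'' hg))
    (fun g hg h hh => hk' g (hK'' hg) h hh) K'' le_rfl

/-- Conjugation by a contracting diagonal element. -/
lemma contract {M : Type*} [NormedRing M] [NormedAlgebra ℝ M] [NormOneClass M]
    (P : Fin 4 → M) (h1 : ∑ i, P i = 1) (h2 : ∀ i, P i * P i = P i)
    (h3 : ∀ i j, i ≠ j → P i * P j = 0) (S : Set M) (hS : S.Finite)
    (hup : ∀ s ∈ S, s ∈ blk P 0) (hd : ∀ s ∈ S, ‖∑ i, P i * s * P i - 1‖ < 1 / 8) :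
    ∃ D D' : M, D * D' = 1 ∧ D' * D = 1 ∧ ∀ s ∈ S, ‖D * s * D' - 1‖ < 1 / 8 := by
  have hcont : ∀ s ∈ S, ∀ᶠ t : ℝ in nhdsWithin 0 (Set.Ioi 0),
      ‖(∑ i : Fin 4, ∑ j : Fin 4, (t ^ ((j : ℕ) - (i : ℕ))) • (P i * s * P j)) - 1‖ < 1 / 8 := by
    intro s hs
    have hc : Continuous (fun t : ℝ =>
      ‖(∑ i : Fin 4, ∑ j : Fin 4, (t ^ ((j : ℕ) - (i : ℕ))) • (P i * s * P j)) - 1‖) := by fun_prop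
    have h0 : ‖(∑ i : Fin 4, ∑ j : Fin 4, ((0:ℝ) ^ ((j : ℕ) - (i : ℕ))) • (P i * s * P j)) - 1‖
        < 1 / 8 := by
      have : (∑ i : Fin 4, ∑ j : Fin 4, ((0:ℝ) ^ ((j : ℕ) - (i : ℕ))) • (P i * s * P j))
          = ∑ i, P i * s * P i := by
        refine Finset.sum_congr rfl fun i _ => ?_
        rw [Finset.sum_eq_single i]
        · simp
        · intro j _ hji
          rcases lt_or_gt_of_ne hji with h | h
          · rw [hup s hs i j (by rw [Fin.lt_def] at h; omega), smul_zero]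
          · rw [zero_pow (by rw [Fin.lt_def] at h; omega), zero_smul]
        · simp
      rw [this]; exact hd s hs
    exact (hc.tendsto 0).eventually_lt_const h0 |>.filter_mono nhdsWithin_le_nhds
  have hall := (Filter.eventually_all_finite hS).2 hcont
  obtain ⟨t, ht, htpos⟩ := (hall.and self_mem_nhdsWithin).exists
  have htpos : 0 < t := htpos
  have hprod : ∀ (a b : Fin 4 → ℝ) (s : M), (∑ i, a i • P i) * s * (∑ j, b j • P j)
      = ∑ i, ∑ j, (a i * b j) • (P i * s * P j) := by
    intro a b s
    rw [Finset.sum_mul, Finset.sum_mul]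
    refine Finset.sum_congr rfl fun i _ => ?_
    rw [Finset.mul_sum]
    refine Finset.sum_congr rfl fun j _ => ?_
    rw [smul_mul_assoc, smul_mul_assoc, mul_smul_comm, smul_smul]
  have hprod1 : ∀ (a b : Fin 4 → ℝ), (∀ i, a i * b i = 1) →
      (∑ i, a i • P i) * (∑ j, b j • P j) = 1 := by
    intro a b hab
    have := hprod a b 1
    rw [mul_one] at this
    rw [this, ← h1]
    refine Finset.sum_congr rfl fun i _ => ?_
    rw [h1, Finset.sum_eq_single i]
    · rw [hab, one_smul, mul_one, h2]
    · intro j _ hji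
      rw [mul_one, h3 i j hji.symm, smul_zero]
    · simp
  refine ⟨∑ i : Fin 4, (t ^ (3 - (i : ℕ))) • P i, ∑ i : Fin 4, (t ^ (3 - (i : ℕ)))⁻¹ • P i,
    hprod1 _ _ fun i => ?_, hprod1 _ _ fun i => ?_, fun s hs => ?_⟩
  · exact mul_inv_cancel₀ (by positivity)
  · exact inv_mul_cancel₀ (by positivity)
  · rw [hprod]
    convert ht s hs using 5 with i _ j _
    by_cases hij : (j : ℕ) < i
    · rw [hup s hs i j (by omega), smul_zero, smul_zero]
    · congr 1
      have e : 3 - (i : ℕ) = (j - i) + (3 - j) := by omega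
      rw [e, pow_add, mul_assoc, mul_inv_cancel₀ (by positivity), mul_one]

lemma commute_closure {G N : Type*} [Group G] [Monoid N] (σ : G →* N) (S : Set G)
    (h : ∀ a ∈ S, ∀ b ∈ S, σ ⁅a, b⁆ = 1) :
    ∀ a ∈ Subgroup.closure S, ∀ b ∈ Subgroup.closure S, σ ⁅a, b⁆ = 1 := by
  have hq : ∀ a b : G, σ ⁅a, b⁆ = 1 ↔ Commute (σ.toHomUnits a) (σ.toHomUnits b) := by
    intro a b
    rw [← commutatorElement_eq_one_iff_commute, ← map_commutatorElement, ← Units.val_inj]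
    rfl
  have step : ∀ a : G, ∀ T : Set G, (∀ b ∈ T, σ ⁅a, b⁆ = 1) →
      ∀ b ∈ Subgroup.closure T, σ ⁅a, b⁆ = 1 := by
    intro a T hT b hb
    induction hb using Subgroup.closure_induction with
    | mem x hx => exact hT x hx
    | one => simp
    | mul x y _ _ hx hy => rw [hq] at *; rw [map_mul]; exact hx.mul_right hy
    | inv x _ hx => rw [hq] at *; rw [map_inv]; exact hx.inv_right
  have sw : ∀ a b, σ ⁅a, b⁆ = 1 → σ ⁅b, a⁆ = 1 := fun a b => by
    rw [hq, hq]; exact Commute.symm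
  intro a ha b hb
  refine step a S (fun b hb => ?_) b hb
  exact sw _ _ (step b S (fun a ha => h b hb a ha) a ha)

/-- Theorem E. -/
theorem thmE {G M E : Type*} [Group G] [Group.FG G] [NormedRing M] [NormedAlgebra ℝ M]
    [NormOneClass M] [FiniteDimensional ℝ M] [NormedAddCommGroup E] [InnerProductSpace ℝ E]
    [FiniteDimensional ℝ E]
    (ρ : G →* M) (hρ : Function.Injective ρ) (hfin : ∀ R : ℝ, {g | ‖ρ g‖ ≤ R}.Finite)
    (P : Fin 4 → M) (h1 : ∑ i, P i = 1) (h2 : ∀ i, P i * P i = P i)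
    (h3 : ∀ i j, i ≠ j → P i * P j = 0) (hup : ∀ g, ρ g ∈ blk P 0)
    (σ : G →* (E →L[ℝ] E)) (hσ : ∀ g x, ‖σ g x‖ = ‖x‖) (lam : G →* ℝ) (C : ℝ)
    (hC : ∀ g, lam g = 1 → ‖∑ i, P i * ρ g * P i - 1‖ ≤ C * ‖σ g - 1‖) :
    IsVirtuallyPolycyclic G := by
  obtain ⟨hN, hU12, hU2⟩ := noe_unip ρ hρ hfin P h1 h2 hup
  set U := Uk ρ P h1 h2 hup with hU
  obtain ⟨ε, hε, hε2, hεC⟩ : ∃ ε > 0, ε ≤ 1 / 2 ∧ (|C| + 1) * ε < 1 / 8 := by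
    refine ⟨min (1/2) (1 / (16 * (|C| + 1))), by positivity, min_le_left _ _, ?_⟩
    calc (|C| + 1) * min (1/2) (1 / (16 * (|C| + 1))) ≤ (|C| + 1) * (1 / (16 * (|C| + 1))) := by
          gcongr; exact min_le_right _ _
      _ = 1 / 16 := by field_simp
      _ < _ := by norm_num
  have hlamc : ∀ a b, lam ⁅a, b⁆ = 1 := fun a b => by
    rw [commutatorElement_def, mul_assoc, map_mul, map_mul, map_mul]
    have ha : lam a * lam a⁻¹ = 1 := by rw [← map_mul]; simp
    have hb : lam b * lam b⁻¹ = 1 := by rw [← map_mul]; simp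
    linear_combination (lam b * lam b⁻¹) * ha + hb
  have hlamconj : ∀ a b, lam (a * b * a⁻¹) = lam b := fun a b => by
    rw [map_mul, map_mul]
    have ha : lam a * lam a⁻¹ = 1 := by rw [← map_mul]; simp
    linear_combination lam b * ha
  have hfin' : ∀ R : ℝ, (ρ '' {g | ‖ρ g‖ ≤ R}).Finite := fun R => (hfin R).image _
  have X1 : ∀ a b, lam a = 1 → lam b = 1 → ‖σ a - 1‖ < ε → ‖σ b - 1‖ < ε → σ ⁅a, b⁆ = 1 := by
    intro a b la lb ha hb
    refine comm_of_iter σ hσ a b (by linarith) (by linarith) ?_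
    have hdd : ∀ g, lam g = 1 → ‖σ g - 1‖ < ε → ‖∑ i, P i * ρ g * P i - 1‖ < 1 / 8 := by
      intro g lg hg
      calc _ ≤ C * ‖σ g - 1‖ := hC g lg
        _ ≤ (|C| + 1) * ε := by
          gcongr; linarith [le_abs_self C]
        _ < _ := hεC
    obtain ⟨D, D', hD, hD', hs⟩ := contract P h1 h2 h3 {ρ a, ρ b} (by simp)
      (by rintro s (rfl | rfl) <;> exact hup _)
      (by rintro s (rfl | rfl); exacts [hdd a la ha, hdd b lb hb])
    obtain ⟨k, hk⟩ := zassenhaus ρ hfin' {a, b} D D' hD hD'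
      (by rintro s (rfl | rfl) <;> exact hs _ (by simp))
    refine ⟨k, fun j hj g hg => ?_⟩
    have := hρ ((hk j hj g hg).trans (map_one ρ).symm)
    rw [this, map_one]
  have X2 : ∀ q a, ‖σ q - 1‖ < 1 → lam a = 1 → ‖σ a - 1‖ < ε → σ ⁅q, a⁆ = 1 := by
    intro q a hq la ha
    refine frob σ hσ a q hq (X1 _ _ la (by rw [hlamconj, la]) ha ?_)
    exact (iso_conj_norm σ hσ q a).trans_lt ha
  have X3 : ∀ q r, ‖σ q - 1‖ < ε → ‖σ r - 1‖ < ε → σ ⁅q, r⁆ = 1 := by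
    intro q r hq hr
    refine frob2 σ hσ q r (by linarith) (X2 _ _ (by linarith) (hlamc _ _) ?_)
    have := iso_comm_norm σ hσ q r
    nlinarith [norm_nonneg (σ q - 1), norm_nonneg (σ r - 1)]
  let H := Subgroup.closure {q | ‖σ q - 1‖ < ε}
  have hHi : H.index ≠ 0 := index_of_small σ hσ ε hε H (fun g hg => Subgroup.subset_closure hg)
  have hHc : ∀ a ∈ H, ∀ b ∈ H, ⁅a, b⁆ ∈ U 1 := by
    intro a ha b hb
    have hs : σ ⁅a, b⁆ = 1 := commute_closure σ _ (fun a ha b hb => X3 a b ha hb) a ha b hb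
    have hl := hlamc a b
    have h4 := hC _ hl
    rw [hs, sub_self, norm_zero, mul_zero] at h4
    have h5 := sub_eq_zero.1 (norm_le_zero_iff.1 h4)
    change ρ ⁅a, b⁆ - 1 ∈ blk P 1
    set g := ⁅a, b⁆
    intro i j hij
    by_cases hlt : (j : ℕ) < i
    · have hne : i ≠ j := by rintro rfl; omega
      rw [mul_sub, sub_mul, hup g i j (by omega), mul_one, h3 i j hne, sub_zero]
    · have : i = j := Fin.ext (by omega)
      subst this
      have h6 : P i * (∑ m, P m * ρ g * P m) * P i = P i * ρ g * P i := by
        rw [Finset.mul_sum, Finset.sum_mul, Finset.sum_eq_single i]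
        · rw [mul_assoc (P i) (ρ g), ← mul_assoc (P i) (P i), h2, mul_assoc, mul_assoc, h2]
        · intro m _ hm
          rw [mul_assoc (P m), ← mul_assoc (P i) (P m), h3 i m hm.symm, zero_mul, zero_mul]
        · simp
      rw [h5, mul_one] at h6
      rw [mul_sub, sub_mul, ← h6, mul_one, sub_self]
  have hder1 : ∀ x ∈ derivedSeries H 1, (x : G) ∈ U 1 := by
    have : derivedSeries H 1 ≤ (U 1).comap H.subtype := by
      rw [derivedSeries_succ, Subgroup.commutator_le]
      intro a _ b _
      exact hHc a a.2 b b.2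
    exact this
  have hder2 : ∀ x ∈ derivedSeries H 2, (x : G) ∈ U 2 := by
    have : derivedSeries H 2 ≤ (U 2).comap H.subtype := by
      rw [derivedSeries_succ, Subgroup.commutator_le]
      intro a ha b hb
      exact hU12 a (hder1 a ha) b (hder1 b hb)
    exact this
  refine ⟨H, hHi, ?_, ?_⟩
  · refine (Group.isSolvable_def H).2 ⟨3, ?_⟩
    rw [eq_bot_iff, derivedSeries_succ, Subgroup.commutator_le]
    intro a ha b hb
    rw [Subgroup.mem_bot]
    apply Subtype.ext
    exact hU2 a (hder2 a ha) b (hder2 b hb)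
  · have : H.FiniteIndex := ⟨hHi⟩
    have hfg : Group.FG H := Subgroup.fg_of_index_ne_zero H
    intro K
    refine fg_of_map_ker (Abelianization.of (G := H)) K ?_ ?_
    · have : Group.FG (Abelianization H) :=
        Group.fg_of_surjective (f := Abelianization.of) (QuotientGroup.mk_surjective)
      exact fg_of_comm _
    · rw [Abelianization.ker_of]
      have hle : (K ⊓ commutator H).map H.subtype ≤ U 1 := by
        rintro _ ⟨x, hx, rfl⟩
        exact hder1 x (by rw [derivedSeries_one]; exact hx.2)
      have := hN _ hle
      rw [← fg_subgroupOf (K := H)] at this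
      · convert this
        exact (Subgroup.comap_map_eq_self_of_injective H.subtype_injective _).symm
      · rintro _ ⟨x, _, rfl⟩; exact x.2

end GK


namespace GK
open scoped commutatorElement

/-- The ambient space. -/
abbrev V (n : ℕ) := Fin (n + 1) → ℝ

/-- The Lorentz form as a bilinear map. -/
def B (n : ℕ) : V n →ₗ[ℝ] V n →ₗ[ℝ] ℝ :=
  LinearMap.mk₂ ℝ (lorentzForm n)
    (fun x y z => by simp only [lorentzForm, Pi.add_apply, add_mul, Finset.sum_add_distrib]; ring)
    (fun c x z => by
      simp only [lorentzForm, Pi.smul_apply, smul_eq_mul, mul_sub, Finset.mul_sum, mul_assoc])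
    (fun x y z => by simp only [lorentzForm, Pi.add_apply, mul_add, Finset.sum_add_distrib]; ring)
    (fun c x z => by
      simp only [lorentzForm, Pi.smul_apply, smul_eq_mul, mul_sub, Finset.mul_sum, mul_left_comm])

lemma B_apply (n : ℕ) (x y : V n) : B n x y = lorentzForm n x y := rfl

lemma B_comm {n : ℕ} (x y : V n) : B n x y = B n y x := by
  simp only [B_apply, lorentzForm, mul_comm]

/-- The time coordinate. -/
def T (n : ℕ) : V n →L[ℝ] ℝ := ContinuousLinearMap.proj (Fin.last n)

lemma T_apply {n : ℕ} (x : V n) : T n x = x (Fin.last n) := rfl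

lemma B_def {n : ℕ} (x y : V n) :
    B n x y = (∑ i : Fin n, x i.castSucc * y i.castSucc) - T n x * T n y := rfl

/-- The forward cone. -/
def cone (n : ℕ) : Set (V n) := {x | B n x x ≤ 0 ∧ 0 ≤ T n x}

lemma B_cont {n : ℕ} : Continuous (fun p : V n × V n => B n p.1 p.2) := by
  simp only [B_def]
  fun_prop

lemma B_cont' {n : ℕ} {X : Type*} [TopologicalSpace X] {f g : X → V n} (hf : Continuous f)
    (hg : Continuous g) : Continuous (fun x => B n (f x) (g x)) :=
  B_cont.comp (hf.prodMk hg)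

lemma cone_closed (n : ℕ) : IsClosed (cone n) := by
  refine IsClosed.inter ?_ ?_
  · exact isClosed_le (B_cont' continuous_id continuous_id) continuous_const
  · exact isClosed_le continuous_const (T n).continuous

lemma sp_abs_le {n : ℕ} (x : V n) (hx : B n x x ≤ 0) (i : Fin n) : |x i.castSucc| ≤ |T n x| := by
  rw [← sq_le_sq]
  rw [B_def] at hx
  have : x i.castSucc * x i.castSucc ≤ ∑ i : Fin n, x i.castSucc * x i.castSucc :=
    Finset.single_le_sum (f := fun i : Fin n => x i.castSucc * x i.castSucc)
      (fun j _ => mul_self_nonneg _) (Finset.mem_univ i)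
  nlinarith

lemma norm_of_caus {n : ℕ} (x : V n) (hx : B n x x ≤ 0) : ‖x‖ = |T n x| := by
  refine le_antisymm ?_ ?_
  · refine (pi_norm_le_iff_of_nonneg (abs_nonneg _)).2 (fun i => ?_)
    refine Fin.lastCases ?_ (fun j => ?_) i
    · exact le_rfl
    · exact sp_abs_le x hx j
  · exact norm_le_pi_norm x (Fin.last n)

lemma norm_of_cone {n : ℕ} {x : V n} (hx : x ∈ cone n) : ‖x‖ = T n x := by
  rw [norm_of_caus x hx.1, abs_of_nonneg hx.2]

lemma eq_zero_of_T {n : ℕ} {x : V n} (hx : B n x x ≤ 0) (hT : T n x = 0) : x = 0 := by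
  rw [← norm_eq_zero, norm_of_caus x hx, hT, abs_zero]

lemma T_pos {n : ℕ} {x : V n} (hx : x ∈ cone n) (h0 : x ≠ 0) : 0 < T n x := by
  rw [← norm_of_cone hx]; exact norm_pos_iff.2 h0

lemma cone_B {n : ℕ} {x y : V n} (hx : x ∈ cone n) (hy : y ∈ cone n) : B n x y ≤ 0 := by
  have h1 := hx.1
  have h2 := hy.1
  rw [B_def] at h1 h2 ⊢
  have cs := Finset.sum_mul_sq_le_sq_mul_sq Finset.univ (fun i : Fin n => x i.castSucc)
    (fun i : Fin n => y i.castSucc)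
  have e1 : ∑ i : Fin n, x i.castSucc ^ 2 ≤ T n x ^ 2 := by
    simp only [pow_two]; linarith
  have e2 : ∑ i : Fin n, y i.castSucc ^ 2 ≤ T n y ^ 2 := by
    simp only [pow_two]; linarith
  have h3 : (∑ i : Fin n, x i.castSucc * y i.castSucc) ^ 2 ≤ (T n x * T n y) ^ 2 := by
    rw [mul_pow]
    refine cs.trans (mul_le_mul e1 e2 (Finset.sum_nonneg (fun _ _ => sq_nonneg _)) (sq_nonneg _))
  have h4 := abs_le_of_sq_le_sq h3 (mul_nonneg hx.2 hy.2)
  linarith [le_abs_self (∑ i : Fin n, x i.castSucc * y i.castSucc), h4]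

lemma cone_add {n : ℕ} {x y : V n} (hx : x ∈ cone n) (hy : y ∈ cone n) : x + y ∈ cone n := by
  refine ⟨?_, ?_⟩
  · have := cone_B hx hy
    have h1 := hx.1
    have h2 := hy.1
    simp only [map_add, LinearMap.add_apply, B_comm y x]; linarith
  · rw [map_add]; exact add_nonneg hx.2 hy.2

lemma cone_smul {n : ℕ} {x : V n} (hx : x ∈ cone n) {c : ℝ} (hc : 0 ≤ c) : c • x ∈ cone n := by
  refine ⟨?_, ?_⟩
  · have h1 := hx.1
    simp only [map_smul, LinearMap.smul_apply, smul_eq_mul]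
    nlinarith [mul_nonneg hc hc]
  · rw [map_smul]; exact mul_nonneg hc hx.2

lemma zero_cone (n : ℕ) : (0 : V n) ∈ cone n := by simp [cone]

lemma cone_sum {n : ℕ} {ι : Type*} (s : Finset ι) (f : ι → V n) (h : ∀ i ∈ s, f i ∈ cone n) :
    ∑ i ∈ s, f i ∈ cone n := by
  classical
  induction s using Finset.induction_on with
  | empty => simpa using zero_cone n
  | insert a s ha ih =>
    rw [Finset.sum_insert ha]
    exact cone_add (h a (by simp)) (ih (fun i hi => h i (by simp [hi])))

/-- Orthogonal causal vectors are parallel. -/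
lemma F5 {n : ℕ} {x y : V n} (hx : B n x x ≤ 0) (hy : B n y y ≤ 0) (hxy : B n x y = 0) :
    T n y • x = T n x • y := by
  rw [← sub_eq_zero]
  refine eq_zero_of_T ?_ ?_
  · simp only [map_sub, map_smul, LinearMap.sub_apply, LinearMap.smul_apply, smul_eq_mul,
      B_comm y x, hxy]
    nlinarith [mul_self_nonneg (T n y), mul_self_nonneg (T n x)]
  · simp only [map_sub, map_smul, smul_eq_mul]; ring

lemma F4 {n : ℕ} {v x : V n} (hv : B n v v < 0) (hx : B n v x = 0) (h0 : x ≠ 0) :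
    0 < B n x x := by
  by_contra h
  push Not at h
  have h1 := F5 hv.le h hx
  have hTv : T n v ≠ 0 := fun h => by
    rw [eq_zero_of_T hv.le h] at hv; simp at hv
  have hTx : T n x ≠ 0 := fun h' => h0 (eq_zero_of_T h h')
  have h2 := congrArg (B n v) h1
  simp only [map_smul, hx, smul_eq_mul, mul_zero] at h2
  rcases mul_eq_zero.1 h2 with h3 | h3
  · exact hTx h3
  · exact hv.ne h3

/-- timelike forward vectors. -/
def tl (n : ℕ) : Set (V n) := {x | B n x x < 0 ∧ 0 < T n x}

lemma tl_open (n : ℕ) : IsOpen (tl n) := by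
  refine IsOpen.inter ?_ ?_
  · exact isOpen_lt (B_cont' continuous_id continuous_id) continuous_const
  · exact isOpen_lt continuous_const (T n).continuous

lemma tl_cone {n : ℕ} {x : V n} (h : x ∈ tl n) : x ∈ cone n := ⟨h.1.le, h.2.le⟩

lemma tl_of_cone {n : ℕ} {x : V n} (h : x ∈ cone n) (h1 : B n x x < 0) : x ∈ tl n :=
  ⟨h1, T_pos h (by rintro rfl; simp at h1)⟩

lemma tl_ne {n : ℕ} {x : V n} (h : x ∈ tl n) : x ≠ 0 := by
  rintro rfl
  have := h.1
  simp at this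

lemma tl_of_B {n : ℕ} {x : V n} (h1 : B n x x < 0) : x ∈ tl n ∨ -x ∈ tl n := by
  rcases lt_trichotomy (T n x) 0 with h | h | h
  · right; exact ⟨by simpa using h1, by simpa using h⟩
  · rw [eq_zero_of_T h1.le h] at h1; simp at h1
  · left; exact ⟨h1, h⟩

lemma tl_B {n : ℕ} {x y : V n} (hx : x ∈ tl n) (hy : y ∈ cone n) (h0 : y ≠ 0) : B n x y < 0 := by
  refine lt_of_le_of_ne (cone_B (tl_cone hx) hy) (fun h => ?_)
  have := F4 hx.1 h h0
  linarith [hy.1]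

lemma tl_add {n : ℕ} {x y : V n} (hx : x ∈ tl n) (hy : y ∈ cone n) : x + y ∈ tl n := by
  refine tl_of_cone (cone_add (tl_cone hx) hy) ?_
  have := cone_B (tl_cone hx) hy
  have h1 := hx.1
  have h2 := hy.1
  simp only [map_add, LinearMap.add_apply, B_comm y x]; linarith

lemma tl_smul {n : ℕ} {x : V n} (hx : x ∈ tl n) {c : ℝ} (hc : 0 < c) : c • x ∈ tl n := by
  refine ⟨?_, ?_⟩
  · simp only [map_smul, LinearMap.smul_apply, smul_eq_mul]
    have := hx.1
    have := mul_pos hc hc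
    nlinarith
  · rw [map_smul]; exact mul_pos hc hx.2

lemma tl_convex (n : ℕ) : Convex ℝ (tl n) := by
  intro x hx y hy a b ha hb hab
  rcases ha.eq_or_lt with rfl | ha
  · have : b = 1 := by linarith
    subst this; simpa using hy
  · exact tl_add (tl_smul hx ha) (cone_smul (tl_cone hy) hb)

/-- e_T is timelike -/
lemma exists_tl (n : ℕ) : ∃ v, v ∈ tl n := by
  refine ⟨Pi.single (Fin.last n) 1, ?_, ?_⟩
  · rw [B_def]
    simp [T_apply, Fin.castSucc_ne_last]
  · simp [T_apply]

/-- Nondegeneracy of the form. -/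
lemma B_nondeg {n : ℕ} {x : V n} (h : ∀ y, B n x y = 0) : x = 0 := by
  by_contra h0
  obtain ⟨v, hv⟩ := exists_tl n
  have := F4 hv.1 (by rw [B_comm]; exact h v) h0
  rw [h x] at this
  exact lt_irrefl _ this

/-- Forward Lorentz representation. -/
structure Fwd {n : ℕ} {G : Type*} [Group G] (L : G →* (V n →L[ℝ] V n)) : Prop where
  hB : ∀ g x y, B n (L g x) (L g y) = B n x y
  hC : ∀ g x, x ∈ cone n → L g x ∈ cone n

section
lemma inv_mul_app {n : ℕ} {G : Type*} [Group G] (L : G →* (V n →L[ℝ] V n)) (g : G) (x : V n) :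
    L g⁻¹ (L g x) = x := by
  change (L g⁻¹ * L g) x = x
  rw [← map_mul]; simp

lemma mul_inv_app {n : ℕ} {G : Type*} [Group G] (L : G →* (V n →L[ℝ] V n)) (g : G) (x : V n) :
    L g (L g⁻¹ x) = x := by
  change (L g * L g⁻¹) x = x
  rw [← map_mul]; simp

lemma mul_app {n : ℕ} {G : Type*} [Group G] (L : G →* (V n →L[ℝ] V n)) (g h : G) (x : V n) :
    L (g * h) x = L g (L h x) := by
  rw [map_mul]; rfl

lemma one_app {n : ℕ} {G : Type*} [Group G] (L : G →* (V n →L[ℝ] V n)) (x : V n) :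
    L 1 x = x := by
  rw [map_one]; rfl

lemma L_inj {n : ℕ} {G : Type*} [Group G] (L : G →* (V n →L[ℝ] V n)) (g : G) :
    Function.Injective (L g) := fun x y h => by
  rw [← inv_mul_app L g x, h, inv_mul_app]
end

lemma Fwd.tl {n : ℕ} {G : Type*} [Group G] {L : G →* (V n →L[ℝ] V n)} (F : Fwd L) (g : G) {x : V n}
    (hx : x ∈ tl n) : L g x ∈ GK.tl n :=
  tl_of_cone (F.hC g x (tl_cone hx)) (by rw [F.hB]; exact hx.1)

lemma Fwd.eig_one {n : ℕ} {G : Type*} [Group G] {L : G →* (V n →L[ℝ] V n)} (F : Fwd L) (g : G)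
    {x : V n} (hx : x ∈ GK.tl n) {μ : ℝ} (h : L g x = μ • x) : L g x = x := by
  have h1 := F.hB g x x
  have h2 := (F.tl g hx).2
  rw [h] at h1 h2
  simp only [map_smul, LinearMap.smul_apply, smul_eq_mul] at h1 h2
  have hμ : 0 < μ := by
    by_contra hc
    push Not at hc
    nlinarith [hx.2]
  have h3 : (μ * μ - 1) * B n x x = 0 := by linarith
  rcases mul_eq_zero.1 h3 with h4 | h4
  · have : μ = 1 := by nlinarith
    rw [h, this, one_smul]
  · exact absurd h4 hx.1.ne

/-- eigenvector in the cone -/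
lemma exists_eig {n : ℕ} {G : Type*} [Group G] {L : G →* (V n →L[ℝ] V n)} (F : Fwd L) (z : G)
    (W : Submodule ℝ (V n)) (hW : ∀ w ∈ W, L z w ∈ W) {v : V n} (hv : v ∈ GK.tl n) (hvW : v ∈ W) :
    ∃ w ∈ W, w ∈ cone n ∧ w ≠ 0 ∧ ∃ μ : ℝ, L z w = μ • w := by
  have hWc : IsClosed (W : Set (V n)) := W.closed_of_finiteDimensional
  let u : ℕ → V n := fun k => L (z ^ k) v
  have us : ∀ k, L z (u k) = u (k + 1) := fun k => by
    change _ = L (z ^ (k+1)) v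
    rw [pow_succ', mul_app]
  have uW : ∀ k, u k ∈ W := fun k => by
    induction k with
    | zero => simpa [u] using hvW
    | succ k ih => rw [← us]; exact hW _ ih
  have utl : ∀ k, u k ∈ GK.tl n := fun k => F.tl _ hv
  have uB : ∀ k, B n (u k) (u (k + 1)) = B n v (L z v) := fun k => by
    change B n (L (z ^ k) v) (L (z ^ (k+1)) v) = _
    rw [pow_succ, mul_app, F.hB]
  have uBB : ∀ k, B n (u k) (u k) = B n v v := fun k => F.hB _ _ _
  -- normalized cone slice
  have hK : IsCompact {x : V n | x ∈ cone n ∧ ‖x‖ = 1} := by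
    have : {x : V n | x ∈ cone n ∧ ‖x‖ = 1} = Metric.sphere 0 1 ∩ cone n := by
      ext x; simp [and_comm]
    rw [this]
    exact (isCompact_sphere _ _).inter_right (cone_closed n)
  -- general tool: normalized sequence has convergent subsequence
  have key : ∀ y : ℕ → V n, (∀ k, y k ∈ W) → (∀ k, y k ∈ cone n) → (∀ k, y k ≠ 0) →
      ∃ w ∈ W, w ∈ cone n ∧ w ≠ 0 ∧ ∃ φ : ℕ → ℕ, StrictMono φ ∧
        Filter.Tendsto (fun k => (T n (y (φ k)))⁻¹ • y (φ k)) Filter.atTop (nhds w) := by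
    intro y hyW hyc hy0
    have hpos : ∀ k, 0 < T n (y k) := fun k => T_pos (hyc k) (hy0 k)
    obtain ⟨w, hw, φ, hφ, hlim⟩ := hK.tendsto_subseq (x := fun k => (T n (y k))⁻¹ • y k)
      (fun k => ⟨cone_smul (hyc k) (inv_nonneg.2 (hpos k).le), by
        rw [norm_smul, norm_of_cone (hyc k), norm_inv, Real.norm_of_nonneg (hpos k).le,
          inv_mul_cancel₀ (hpos k).ne']⟩)
    refine ⟨w, ?_, hw.1, ?_, φ, hφ, hlim⟩
    · exact hWc.mem_of_tendsto hlim (Filter.Eventually.of_forall (fun k => W.smul_mem _ (hyW _)))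
    · rintro rfl
      simpa using hw.2
  by_cases hbd : ∃ C, ∀ k, T n (u k) ≤ C
  · obtain ⟨C, hC⟩ := hbd
    let y : ℕ → V n := fun N => ∑ k ∈ Finset.range (N + 1), u k
    have hyc : ∀ N, y N ∈ cone n := fun N => cone_sum _ _ (fun k _ => tl_cone (utl k))
    -- lower bound for T
    have hlow : ∃ c > 0, ∀ k, c ≤ T n (u k) := by
      refine ⟨Real.sqrt (-(B n v v)), Real.sqrt_pos.2 (by linarith [hv.1]), fun k => ?_⟩
      rw [Real.sqrt_le_left (utl k).2.le, ← uBB k, B_def]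
      have : 0 ≤ ∑ i : Fin n, u k i.castSucc * u k i.castSucc :=
        Finset.sum_nonneg (fun _ _ => mul_self_nonneg _)
      nlinarith
    obtain ⟨c, hc, hlow⟩ := hlow
    have hyT : ∀ N : ℕ, c * (N + 1) ≤ T n (y N) := fun N => by
      rw [map_sum]
      calc c * (N + 1) = ∑ k ∈ Finset.range (N + 1), c := by simp; ring
        _ ≤ _ := Finset.sum_le_sum (fun k _ => hlow k)
    have hy0 : ∀ N, y N ≠ 0 := fun N h => by
      have h1 := hyT N
      rw [h, map_zero] at h1
      have : 0 < c * (N + 1) := by positivity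
      linarith
    obtain ⟨w, hwW, hwc, hw0, φ, hφ, hlim⟩ := key y
      (fun N => W.sum_mem (fun k _ => uW k)) hyc hy0
    refine ⟨w, hwW, hwc, hw0, 1, ?_⟩
    rw [one_smul]
    have hzy : ∀ N, L z (y N) = y N + (u (N + 1) - u 0) := fun N => by
      change L z (∑ k ∈ Finset.range (N+1), u k) = ∑ k ∈ Finset.range (N+1), u k + _
      rw [map_sum, ← Finset.sum_range_sub, ← Finset.sum_add_distrib]
      exact Finset.sum_congr rfl (fun k _ => by rw [us]; abel)
    have hl1 := ((L z).continuous.tendsto w).comp hlim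
    have hl2 : Filter.Tendsto (fun k => (T n (y (φ k)))⁻¹ • (u (φ k + 1) - u 0)) Filter.atTop
        (nhds 0) := by
      have hz : Filter.Tendsto (fun N : ℕ => (2 * C / c) * (1 / ((N : ℝ) + 1))) Filter.atTop (nhds 0) := by
        simpa using (tendsto_one_div_add_atTop_nhds_zero_nat (𝕜 := ℝ)).const_mul (2 * C / c)
      refine squeeze_zero_norm (fun k => ?_) (hz.comp hφ.tendsto_atTop)
      rw [norm_smul, norm_inv, Real.norm_of_nonneg (hyc _).2]
      have h1 : ‖u (φ k + 1) - u 0‖ ≤ 2 * C := by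
        refine (norm_sub_le _ _).trans ?_
        rw [norm_of_cone (tl_cone (utl _)), norm_of_cone (tl_cone (utl _))]
        linarith [hC (φ k + 1), hC 0]
      have h2 : (T n (y (φ k)))⁻¹ ≤ (c * (φ k + 1))⁻¹ :=
        inv_anti₀ (by positivity) (hyT _)
      calc _ ≤ (c * (φ k + 1))⁻¹ * (2 * C) := by
            refine mul_le_mul h2 h1 (norm_nonneg _) (by positivity)
        _ = _ := by simp only [Function.comp]; field_simp
    have hl3 := hlim.add hl2
    rw [add_zero] at hl3
    refine tendsto_nhds_unique hl1 (hl3.congr (fun k => ?_))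
    simp only [Function.comp]
    rw [map_smul, hzy, smul_add]
  · push Not at hbd
    choose ψ hψ using fun k : ℕ => hbd k
    obtain ⟨w, hwW, hwc, hw0, φ, hφ, hlim⟩ := key (fun k => u (ψ k)) (fun k => uW _)
      (fun k => tl_cone (utl _)) (fun k => tl_ne (utl _))
    have hinv : Filter.Tendsto (fun k => (T n (u (ψ (φ k))))⁻¹) Filter.atTop (nhds 0) := by
      refine Filter.Tendsto.inv_tendsto_atTop ?_
      refine Filter.tendsto_atTop_mono (fun k => (hψ (φ k)).le) ?_
      exact tendsto_natCast_atTop_atTop.comp hφ.tendsto_atTop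
    have hBz : B n w (L z w) = 0 := by
      have h1 : Filter.Tendsto (fun k => B n ((T n (u (ψ (φ k))))⁻¹ • u (ψ (φ k)))
          (L z ((T n (u (ψ (φ k))))⁻¹ • u (ψ (φ k))))) Filter.atTop (nhds (B n w (L z w))) :=
        ((B_cont' continuous_id (L z).continuous).tendsto w).comp hlim
      have h2 : Filter.Tendsto (fun k => (T n (u (ψ (φ k))))⁻¹ * ((T n (u (ψ (φ k))))⁻¹ *
          B n v (L z v))) Filter.atTop (nhds 0) := by
        simpa using hinv.mul (hinv.mul_const (B n v (L z v)))
      refine tendsto_nhds_unique h1 (h2.congr (fun k => ?_))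
      rw [map_smul, map_smul, map_smul, LinearMap.smul_apply, us, uB, smul_eq_mul, smul_eq_mul]
    have h5 := F5 hwc.1 (F.hC z w hwc).1 hBz
    have hT : T n w ≠ 0 := (T_pos hwc hw0).ne'
    refine ⟨w, hwW, hwc, hw0, T n (L z w) / T n w, ?_⟩
    rw [div_eq_inv_mul, mul_smul, h5, smul_smul, inv_mul_cancel₀ hT, one_smul]

end GK


namespace GK
open scoped commutatorElement

lemma inv_closure {n : ℕ} {G : Type*} [Group G] (L : G →* (V n →L[ℝ] V n)) (S : Set G)
    (W : Submodule ℝ (V n)) (h : ∀ s ∈ S, ∀ w ∈ W, L s w ∈ W) :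
    ∀ g ∈ Subgroup.closure S, ∀ w ∈ W, L g w ∈ W := by
  intro g hg
  induction hg using Subgroup.closure_induction with
  | mem x hx => exact h x hx
  | one => intro w hw; rwa [one_app]
  | mul x y _ _ hx hy => intro w hw; rw [mul_app]; exact hx _ (hy _ hw)
  | inv x _ hx =>
    have hle : W.map (L x : V n →ₗ[ℝ] V n) ≤ W := by
      rintro _ ⟨w, hw, rfl⟩; exact hx w hw
    have heq : W.map (L x : V n →ₗ[ℝ] V n) = W := by
      refine Submodule.eq_of_le_of_finrank_eq hle ?_
      exact (Submodule.equivMapOfInjective (L x : V n →ₗ[ℝ] V n) (L_inj L x) W).finrank_eq.symm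
    intro w hw
    rw [← heq] at hw
    obtain ⟨u, hu, rfl⟩ := hw
    change L x⁻¹ (L x u) ∈ W
    rwa [inv_mul_app]

lemma commSet_closure {G : Type*} [Group G] (S : Set G) (k : ℕ) :
    commSet S k ⊆ Subgroup.closure S := by
  induction k with
  | zero => exact Subgroup.subset_closure
  | succ k ih =>
    rintro _ ⟨a, ha, b, hb, rfl⟩
    have h1 := Subgroup.subset_closure (k := S) ha
    have h2 := ih hb
    exact mul_mem (mul_mem (mul_mem h1 h2) (inv_mem h1)) (inv_mem h2)

lemma lemN {n : ℕ} {G : Type*} [Group G] {L : G →* (V n →L[ℝ] V n)} (F : Fwd L) (S : Set G)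
    (d : ℕ) (W : Submodule ℝ (V n)) (hd : Module.finrank ℝ W = d)
    (hW : ∀ s ∈ S, ∀ w ∈ W, L s w ∈ W) (hv : ∃ v ∈ W, v ∈ tl n)
    (hk : ∃ k, ∀ j, k ≤ j → ∀ g ∈ commSet S j, ∀ w ∈ W, L g w = w) :
    ∃ v ∈ W, v ∈ cone n ∧ v ≠ 0 ∧ ∀ s ∈ S, ∃ μ : ℝ, L s v = μ • v := by
  classical
  induction d using Nat.strong_induction_on generalizing W with
  | _ d ih =>
  have hWc := inv_closure L S W hW
  rcases h0 : Nat.find hk with _ | m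
  · obtain ⟨v, hvW, hv⟩ := hv
    have h1 := Nat.find_spec hk
    rw [h0] at h1
    exact ⟨v, hvW, tl_cone hv, tl_ne hv, fun s hs => ⟨1, by
      rw [one_smul]; exact h1 0 le_rfl s hs v hvW⟩⟩
  · have h1 := Nat.find_spec hk
    rw [h0] at h1
    have h2 : ¬ ∀ g ∈ commSet S m, ∀ w ∈ W, L g w = w := by
      intro h
      refine Nat.find_min hk (m := m) (by omega) (fun j hj => ?_)
      rcases hj.eq_or_lt with rfl | hj
      · exact h
      · exact h1 j hj
    push Not at h2
    obtain ⟨z, hz, w0, hw0, hzw⟩ := h2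
    have hzW : ∀ w ∈ W, L z w ∈ W := hWc z (commSet_closure S m hz)
    have hcomm : ∀ s ∈ S, ∀ w ∈ W, L s (L z w) = L z (L s w) := by
      intro s hs w hw
      have h3 := h1 (m+1) le_rfl ⁅s, z⁆ ⟨s, hs, z, hz, rfl⟩ (L z (L s w)) (hzW _ (hW s hs w hw))
      rw [commutatorElement_def, mul_app, mul_app, mul_app, inv_mul_app, inv_mul_app] at h3
      exact h3
    by_cases hu : ∃ u ∈ W, u ∈ tl n ∧ L z u = u
    · obtain ⟨u, huW, hut, hzu⟩ := hu
      let W' : Submodule ℝ (V n) := W ⊓ LinearMap.ker ((L z : V n →ₗ[ℝ] V n) - LinearMap.id)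
      have memW' : ∀ w, w ∈ W' ↔ w ∈ W ∧ L z w = w := fun w => by
        simp [W', sub_eq_zero]
      have hlt : W' < W := by
        refine lt_of_le_of_ne inf_le_left (fun h => hzw ?_)
        exact ((memW' w0).1 (h ▸ hw0)).2
      obtain ⟨v, hvW, hv⟩ := ih (Module.finrank ℝ W') (hd ▸ Submodule.finrank_lt_finrank_of_lt hlt)
        W' rfl (fun s hs w hw => by
          rw [memW'] at hw ⊢
          exact ⟨hW s hs w hw.1, by rw [← hcomm s hs w hw.1, hw.2]⟩)
        ⟨u, (memW' u).2 ⟨huW, hzu⟩, hut⟩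
        ⟨m+1, fun j hj g hg w hw => h1 j hj g hg w ((memW' w).1 hw).1⟩
      exact ⟨v, ((memW' v).1 hvW).1, hv⟩
    · push Not at hu
      obtain ⟨v, hvW, hvt⟩ := hv
      obtain ⟨w, hwW, hwc, hwne, μ, hμ⟩ := exists_eig F z W hzW hvt hvW
      have hnt : ∀ x ∈ W, x ∈ cone n → L z x = μ • x → B n x x = 0 := by
        intro x hxW hxc hx
        by_contra hne
        have hxt := tl_of_cone hxc (lt_of_le_of_ne hxc.1 hne)
        exact hu x hxW hxt (F.eig_one z hxt hx)
      refine ⟨w, hwW, hwc, hwne, fun s hs => ?_⟩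
      have e1 := hnt w hwW hwc hμ
      have e2 : L z (L s w) = μ • L s w := by rw [← hcomm s hs w hwW, hμ, map_smul]
      have e3 := hnt (w + L s w) (W.add_mem hwW (hW s hs w hwW)) (cone_add hwc (F.hC s w hwc))
        (by rw [map_add, hμ, e2, smul_add])
      simp only [map_add, LinearMap.add_apply, F.hB, e1, B_comm (L s w) w] at e3
      have e4 := F5 hwc.1 (F.hC s w hwc).1 (by linarith)
      have hT : T n w ≠ 0 := (T_pos hwc hwne).ne'
      refine ⟨T n (L s w) / T n w, ?_⟩
      rw [div_eq_inv_mul, mul_smul, e4, smul_smul, inv_mul_cancel₀ hT, one_smul]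

lemma lemNF {n : ℕ} {G : Type*} [Group G] {L : G →* (V n →L[ℝ] V n)} (F : Fwd L) (X : Set G)
    (W : Submodule ℝ (V n)) (hW : ∀ s ∈ X, ∀ w ∈ W, L s w ∈ W) (hv : ∃ v ∈ W, v ∈ tl n)
    (hk : ∀ S : Finset G, (S : Set G) ⊆ X →
      ∃ k, ∀ j, k ≤ j → ∀ g ∈ commSet (S : Set G) j, ∀ w ∈ W, L g w = w) :
    ∃ v ∈ W, v ∈ cone n ∧ v ≠ 0 ∧ ∀ s ∈ X, ∃ μ : ℝ, L s v = μ • v := by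
  classical
  have hWcl : IsClosed (W : Set (V n)) := W.closed_of_finiteDimensional
  have hK : IsCompact (Metric.sphere (0 : V n) 1 ∩ (cone n ∩ W)) :=
    (isCompact_sphere _ _).inter_right ((cone_closed n).inter hWcl)
  let t : X → Set (V n) := fun s => {v | L s v = T n (L s v) • v}
  have ht : ∀ s, IsClosed (t s) := fun s => by
    refine isClosed_eq (L s).continuous ?_
    exact ((T n).continuous.comp (L s).continuous).smul continuous_id
  obtain ⟨v, hv1, hv2⟩ := hK.inter_iInter_nonempty t ht (by
    intro u
    obtain ⟨v, hvW, hvc, hv0, hvs⟩ := lemN F ((u.image Subtype.val : Finset G) : Set G) _ W rfl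
      (fun s hs => by
        simp only [Finset.coe_image, Set.mem_image] at hs
        obtain ⟨x, _, rfl⟩ := hs
        exact hW x x.2) hv (hk _ (by
          intro s hs
          simp only [Finset.coe_image, Set.mem_image] at hs
          obtain ⟨x, _, rfl⟩ := hs
          exact x.2))
    have hp := T_pos hvc hv0
    refine ⟨(T n v)⁻¹ • v, ⟨?_, cone_smul hvc (inv_nonneg.2 hp.le), W.smul_mem _ hvW⟩, ?_⟩
    · simp only [mem_sphere_iff_norm, sub_zero]
      rw [norm_smul, norm_of_cone hvc, norm_inv, Real.norm_of_nonneg hp.le,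
          inv_mul_cancel₀ hp.ne']
    · simp only [Set.mem_iInter]
      intro s hs
      obtain ⟨μ, hμ⟩ := hvs s (by simpa using hs)
      change L s ((T n v)⁻¹ • v) = T n (L s ((T n v)⁻¹ • v)) • ((T n v)⁻¹ • v)
      rw [map_smul, hμ]
      simp only [map_smul, smul_smul, smul_eq_mul]
      congr 1
      field_simp)
  refine ⟨v, hv1.2.2, hv1.2.1, ?_, fun s hs => ⟨_, Set.mem_iInter.1 hv2 ⟨s, hs⟩⟩⟩
  rintro rfl
  simpa using hv1.1

end GK


namespace GK
open scoped commutatorElement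

lemma Bsl {n : ℕ} (x y z : V n) : B n (x - y) z = B n x z - B n y z := by
  rw [map_sub, LinearMap.sub_apply]

lemma Bml {n : ℕ} (c : ℝ) (x z : V n) : B n (c • x) z = c * B n x z := by
  rw [map_smul, LinearMap.smul_apply, smul_eq_mul]

/-- Euclidean coordinates on a positive definite subspace. -/
structure PDat {n : ℕ} (P : Submodule ℝ (V n)) where
  m : ℕ
  j : EuclideanSpace ℝ (Fin m) →L[ℝ] V n
  p : V n →L[ℝ] EuclideanSpace ℝ (Fin m)
  jmem : ∀ x, j x ∈ P
  jp : ∀ x ∈ P, j (p x) = x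
  pj : ∀ x, p (j x) = x
  inn : ∀ x y, B n x (j y) = inner ℝ (p x) y

lemma PDat.p_zero {n : ℕ} {P : Submodule ℝ (V n)} (D : PDat P) {x : V n}
    (h : ∀ y ∈ P, B n x y = 0) : D.p x = 0 := by
  have := D.inn x (D.p x)
  rw [h _ (D.jmem _)] at this
  exact inner_self_eq_zero.1 this.symm

lemma PDat.perp {n : ℕ} {P : Submodule ℝ (V n)} (D : PDat P) (x : V n) :
    ∀ y ∈ P, B n (x - D.j (D.p x)) y = 0 := by
  intro y hy
  rw [← D.jp y hy, D.inn, map_sub, D.pj, sub_self, inner_zero_left]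

lemma PDat.Bj {n : ℕ} {P : Submodule ℝ (V n)} (D : PDat P) (x) :
    B n (D.j x) (D.j x) = ‖x‖ ^ 2 := by
  rw [D.inn, D.pj, real_inner_self_eq_norm_sq]

lemma exists_PDat {n : ℕ} (P : Submodule ℝ (V n)) (hP : ∀ x ∈ P, x ≠ 0 → 0 < B n x x) :
    Nonempty (PDat P) := by
  classical
  let B2 : LinearMap.BilinForm ℝ P := LinearMap.BilinForm.restrict (B n) P
  have hsym : LinearMap.IsSymm B2 := ⟨fun x y => B_comm _ _⟩
  obtain ⟨v, hv⟩ := LinearMap.BilinForm.exists_orthogonal_basis hsym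
  have hpos : ∀ i, 0 < B n (v i : V n) (v i) := fun i => hP _ (v i).2 (by
    simpa using v.ne_zero i)
  let c : Fin (Module.finrank ℝ P) → ℝ := fun i => (Real.sqrt (B n (v i : V n) (v i)))⁻¹
  let e : Fin (Module.finrank ℝ P) → V n := fun i => c i • (v i : V n)
  have hc : ∀ i, c i ≠ 0 := fun i => inv_ne_zero (Real.sqrt_pos.2 (hpos i)).ne'
  have hcc : ∀ i, c i * c i * B n (v i : V n) (v i) = 1 := fun i => by
    have h1 := Real.mul_self_sqrt (hpos i).le
    have h2 := (Real.sqrt_pos.2 (hpos i)).ne'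
    simp only [c]
    rw [← h1]
    field_simp
    simp
  have he : ∀ i k, B n (e i) (e k) = if i = k then 1 else 0 := by
    intro i k
    simp only [e, map_smul, LinearMap.smul_apply, smul_eq_mul]
    split_ifs with h
    · subst h; rw [← mul_assoc]; exact hcc i
    · have : B n (v i : V n) (v k) = 0 := hv h
      rw [this]; simp
  have hspan : ∀ x ∈ P, x = ∑ i, B n x (e i) • e i := by
    intro x hx
    have h1 : x = ∑ i, (v.repr ⟨x, hx⟩ i * (c i)⁻¹) • e i := by
      have h2 := congrArg Subtype.val (v.sum_repr ⟨x, hx⟩)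
      rw [Submodule.coe_sum] at h2
      conv_lhs => rw [show x = ((⟨x, hx⟩ : P) : V n) from rfl, ← h2]
      refine Finset.sum_congr rfl (fun i _ => ?_)
      simp only [e, Submodule.coe_smul, smul_smul]
      rw [mul_assoc, inv_mul_cancel₀ (hc i), mul_one]
    have h3 : ∀ k, B n x (e k) = v.repr ⟨x, hx⟩ k * (c k)⁻¹ := by
      intro k
      conv_lhs => rw [h1]
      simp [map_sum, LinearMap.sum_apply, he]
    simp_rw [h3]
    exact h1
  let jl : EuclideanSpace ℝ (Fin (Module.finrank ℝ P)) →ₗ[ℝ] V n :=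
    { toFun := fun x => ∑ i, x i • e i
      map_add' := fun x y => by simp [add_smul, Finset.sum_add_distrib]
      map_smul' := fun a x => by simp [mul_smul, Finset.smul_sum] }
  let pl : V n →ₗ[ℝ] EuclideanSpace ℝ (Fin (Module.finrank ℝ P)) :=
    { toFun := fun x => WithLp.toLp 2 (fun i => B n x (e i))
      map_add' := fun x y => by ext i; simp
      map_smul' := fun a x => by ext i; simp }
  refine ⟨⟨Module.finrank ℝ P, LinearMap.toContinuousLinearMap jl,
    LinearMap.toContinuousLinearMap pl, ?_, ?_, ?_, ?_⟩⟩
  · intro x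
    change ∑ i, x i • e i ∈ P
    exact P.sum_mem (fun i _ => P.smul_mem _ (P.smul_mem _ (v i).2))
  · intro x hx
    exact (hspan x hx).symm
  · intro x
    ext k
    change B n (∑ i, x i • e i) (e k) = x k
    simp [map_sum, LinearMap.sum_apply, he]
  · intro x y
    change B n x (∑ i, y i • e i) = inner ℝ (WithLp.toLp 2 (fun i => B n x (e i))) y
    simp [map_sum, PiLp.inner_apply]

/-- The orthogonal representation. -/
def PDat.rep {n : ℕ} {P : Submodule ℝ (V n)} (D : PDat P) {G : Type*} [Group G]
    (L : G →* (V n →L[ℝ] V n)) (hinv : ∀ g, ∀ x ∈ P, L g x ∈ P) :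
    G →* (EuclideanSpace ℝ (Fin D.m) →L[ℝ] EuclideanSpace ℝ (Fin D.m)) where
  toFun g := D.p.comp ((L g).comp D.j)
  map_one' := by
    ext1 x
    change D.p (L 1 (D.j x)) = x
    rw [one_app, D.pj]
  map_mul' g h := by
    ext1 x
    change D.p (L (g * h) (D.j x)) = D.p (L g (D.j (D.p (L h (D.j x)))))
    rw [D.jp _ (hinv h _ (D.jmem x)), mul_app]

lemma PDat.rep_apply {n : ℕ} {P : Submodule ℝ (V n)} (D : PDat P) {G : Type*} [Group G]
    (L : G →* (V n →L[ℝ] V n)) (hinv : ∀ g, ∀ x ∈ P, L g x ∈ P) (g : G) (x) :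
    D.rep L hinv g x = D.p (L g (D.j x)) := rfl

lemma PDat.j_rep {n : ℕ} {P : Submodule ℝ (V n)} (D : PDat P) {G : Type*} [Group G]
    (L : G →* (V n →L[ℝ] V n)) (hinv : ∀ g, ∀ x ∈ P, L g x ∈ P) (g : G) (x) :
    D.j (D.rep L hinv g x) = L g (D.j x) := by
  rw [D.rep_apply, D.jp _ (hinv g _ (D.jmem x))]

lemma PDat.rep_norm {n : ℕ} {P : Submodule ℝ (V n)} (D : PDat P) {G : Type*} [Group G]
    (L : G →* (V n →L[ℝ] V n)) (hB : ∀ g x y, B n (L g x) (L g y) = B n x y)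
    (hinv : ∀ g, ∀ x ∈ P, L g x ∈ P) (g : G) (x) :
    ‖D.rep L hinv g x‖ = ‖x‖ := by
  have h1 := D.Bj (D.rep L hinv g x)
  rw [D.j_rep, hB, D.Bj] at h1
  exact ((sq_eq_sq₀ (norm_nonneg _) (norm_nonneg _)).1 h1).symm

lemma PDat.p_L {n : ℕ} {P : Submodule ℝ (V n)} (D : PDat P) {G : Type*} [Group G]
    (L : G →* (V n →L[ℝ] V n)) (hB : ∀ g x y, B n (L g x) (L g y) = B n x y)
    (hinv : ∀ g, ∀ x ∈ P, L g x ∈ P) (g : G) (x) :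
    D.p (L g x) = D.rep L hinv g (D.p x) := by
  have h1 : D.p (L g (x - D.j (D.p x))) = 0 := by
    refine D.p_zero (fun y hy => ?_)
    rw [← mul_inv_app L g y, hB]
    exact D.perp x _ (hinv _ _ hy)
  rw [map_sub, map_sub, sub_eq_zero] at h1
  rw [h1, D.rep_apply]

/-- Orthogonal complement. -/
def orth {n : ℕ} (W : Submodule ℝ (V n)) : Submodule ℝ (V n) where
  carrier := {x | ∀ y ∈ W, B n x y = 0}
  add_mem' := fun {a b} ha hb y hy => by simp [ha y hy, hb y hy]
  zero_mem' := fun y _ => by simp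
  smul_mem' := fun c x hx y hy => by simp [hx y hy]

lemma mem_orth {n : ℕ} {W : Submodule ℝ (V n)} {x : V n} : x ∈ orth W ↔ ∀ y ∈ W, B n x y = 0 :=
  Iff.rfl

lemma orth_inv {n : ℕ} {G : Type*} [Group G] (L : G →* (V n →L[ℝ] V n))
    (hB : ∀ g x y, B n (L g x) (L g y) = B n x y) {W : Submodule ℝ (V n)}
    (hinv : ∀ g, ∀ x ∈ W, L g x ∈ W) : ∀ g, ∀ x ∈ orth W, L g x ∈ orth W := by
  intro g x hx y hy
  rw [← mul_inv_app L g y, hB]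
  exact hx _ (hinv _ _ hy)

lemma orth_pos {n : ℕ} {W : Submodule ℝ (V n)} (hW : ∃ v ∈ W, B n v v < 0) :
    ∀ x ∈ orth W, x ≠ 0 → 0 < B n x x := by
  obtain ⟨v, hv, hvt⟩ := hW
  intro x hx h0
  exact F4 hvt (by rw [B_comm]; exact hx v hv) h0

/-- Decomposition along a Lorentz subspace. -/
lemma orth_decomp {n : ℕ} {W : Submodule ℝ (V n)} (hW : ∃ v ∈ W, B n v v < 0) (x : V n) :
    ∃ w ∈ W, x - w ∈ orth W := by
  obtain ⟨v, hv, hvt⟩ := hW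
  obtain ⟨D⟩ := exists_PDat (W ⊓ orth (Submodule.span ℝ {v})) (fun x hx h0 =>
    orth_pos ⟨v, Submodule.mem_span_singleton_self v, hvt⟩ x hx.2 h0)
  have hvB : ∀ x, x ∈ orth (Submodule.span ℝ {v}) ↔ B n x v = 0 := by
    intro x
    constructor
    · intro h; exact h v (Submodule.mem_span_singleton_self v)
    · intro h y hy
      obtain ⟨c, rfl⟩ := Submodule.mem_span_singleton.1 hy
      simp [h]
  have hjv : ∀ y, B n (D.j y) v = 0 := fun y => (hvB _).1 (D.jmem y).2
  refine ⟨(B n x v / B n v v) • v + D.j (D.p x), W.add_mem (W.smul_mem _ hv) (D.jmem _).1, ?_⟩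
  have hxv : B n (x - ((B n x v / B n v v) • v + D.j (D.p x))) v = 0 := by
    simp only [map_sub, map_add, map_smul, LinearMap.sub_apply, LinearMap.add_apply,
      LinearMap.smul_apply, smul_eq_mul, hjv]
    field_simp [hvt.ne]
    ring
  intro y hy
  set q := y - (B n y v / B n v v) • v with hq
  have hqm : q ∈ W ⊓ orth (Submodule.span ℝ {v}) := by
    refine ⟨W.sub_mem hy (W.smul_mem _ hv), (hvB _).2 ?_⟩
    simp only [hq, map_sub, map_smul, LinearMap.sub_apply, LinearMap.smul_apply, smul_eq_mul]
    field_simp [hvt.ne]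
    ring
  have hy2 : y = q + (B n y v / B n v v) • v := by rw [hq]; abel
  have h1 : B n (x - ((B n x v / B n v v) • v + D.j (D.p x))) q = 0 := by
    rw [sub_add_eq_sub_sub, sub_right_comm, Bsl, D.perp x q hqm, Bml, B_comm v q,
      (hvB q).1 hqm.2, mul_zero, sub_zero]
  rw [hy2, map_add, map_smul, hxv, h1, smul_zero, add_zero]

lemma orth_orth {n : ℕ} {W : Submodule ℝ (V n)} (hW : ∃ v ∈ W, B n v v < 0) {x : V n}
    (hx : ∀ y ∈ orth W, B n x y = 0) : x ∈ W := by
  obtain ⟨w, hw, hxw⟩ := orth_decomp hW x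
  by_contra hne
  have h0 : x - w ≠ 0 := fun h => hne (by rw [sub_eq_zero.1 h]; exact hw)
  have := orth_pos hW _ hxw h0
  rw [Bsl, hx _ hxw, B_comm, hxw w hw] at this
  simp at this

end GK


namespace GK
open scoped commutatorElement

/-- The linear representation attached to an affine action. -/
def affRep {G E : Type*} [Group G] [NormedAddCommGroup E] [NormedSpace ℝ E]
    (σ : G →* (E →L[ℝ] E)) (c : G → E) (hc : ∀ g h, c (g * h) = σ g (c h) + c g) :
    G →* (E × ℝ →L[ℝ] E × ℝ) where
  toFun g := ((σ g).comp (ContinuousLinearMap.fst ℝ E ℝ) +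
    (ContinuousLinearMap.snd ℝ E ℝ).smulRight (c g)).prod (ContinuousLinearMap.snd ℝ E ℝ)
  map_one' := by
    have h1 : c 1 = 0 := by
      have := hc 1 1
      rw [map_one] at this
      simpa using this
    rw [map_one, h1]
    refine ContinuousLinearMap.ext (fun x => ?_)
    change (x.1 + x.2 • (0 : E), x.2) = x
    rw [smul_zero, add_zero]
  map_mul' g h := by
    refine ContinuousLinearMap.ext (fun x => ?_)
    change (σ (g * h) x.1 + x.2 • c (g * h), x.2) =
      (σ g (σ h x.1 + x.2 • c h) + x.2 • c g, x.2)
    rw [map_mul, hc, map_add, map_smul, smul_add, add_assoc]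
    rfl

lemma affRep_apply {G E : Type*} [Group G] [NormedAddCommGroup E] [NormedSpace ℝ E]
    (σ : G →* (E →L[ℝ] E)) (c : G → E) (hc : ∀ g h, c (g * h) = σ g (c h) + c g) (g : G)
    (x : E × ℝ) : affRep σ c hc g x = (σ g x.1 + x.2 • c g, x.2) := rfl

lemma affRep_one {G E : Type*} [Group G] [NormedAddCommGroup E] [NormedSpace ℝ E]
    (σ : G →* (E →L[ℝ] E)) (c : G → E) (hc : ∀ g h, c (g * h) = σ g (c h) + c g) (g : G) :
    affRep σ c hc g = 1 ↔ σ g = 1 ∧ c g = 0 := by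
  constructor
  · intro h
    constructor
    · ext1 x
      have := congrArg Prod.fst (DFunLike.congr_fun h (x, (0:ℝ)))
      rw [affRep_apply] at this
      simpa using this
    · have := congrArg Prod.fst (DFunLike.congr_fun h ((0 : E), (1:ℝ)))
      rw [affRep_apply] at this
      simpa using this
  · rintro ⟨h1, h2⟩
    refine ContinuousLinearMap.ext (fun x => ?_)
    rw [affRep_apply, h1, h2]
    simp

lemma affRep_norm {G E : Type*} [Group G] [NormedAddCommGroup E] [NormedSpace ℝ E]
    (σ : G →* (E →L[ℝ] E)) (c : G → E) (hc : ∀ g h, c (g * h) = σ g (c h) + c g) (g : G) :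
    ‖c g‖ ≤ ‖affRep σ c hc g‖ := by
  have h1 := (affRep σ c hc g).le_opNorm ((0 : E), (1:ℝ))
  rw [affRep_apply] at h1
  have h2 : ‖((0 : E), (1:ℝ))‖ = 1 := by simp [Prod.norm_def]
  rw [h2, mul_one] at h1
  refine le_trans ?_ h1
  refine le_trans ?_ (norm_fst_le _)
  simp

/-- scaling -/
def scal (E : Type*) [NormedAddCommGroup E] [NormedSpace ℝ E] (t : ℝ) : E × ℝ →L[ℝ] E × ℝ :=
  (t • ContinuousLinearMap.fst ℝ E ℝ).prod (ContinuousLinearMap.snd ℝ E ℝ)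

lemma zass_small {G E : Type*} [Group G] [NormedAddCommGroup E] [NormedSpace ℝ E]
    (σ : G →* (E →L[ℝ] E)) (c : G → E) (hc : ∀ g h, c (g * h) = σ g (c h) + c g)
    (hfin : ∀ R : ℝ, (affRep σ c hc '' {g | ‖affRep σ c hc g‖ ≤ R}).Finite) (S : Set G)
    (hSf : S.Finite) (hS : ∀ s ∈ S, ‖σ s - 1‖ < 1 / 16) :
    ∃ k, ∀ j, k ≤ j → ∀ g ∈ commSet S j, σ g = 1 ∧ c g = 0 := by
  obtain ⟨C, hC⟩ : ∃ C, ∀ s ∈ S, ‖c s‖ ≤ C := by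
    obtain ⟨C, hC⟩ := (hSf.image (fun s => ‖c s‖)).bddAbove
    exact ⟨C, fun s hs => hC ⟨s, hs, rfl⟩⟩
  set t : ℝ := 1 / (16 * (|C| + 1)) with ht
  have ht0 : 0 < t := by positivity
  have htC : t * |C| ≤ 1 / 16 := by
    rw [ht, div_mul_eq_mul_div, div_le_div_iff₀ (by positivity) (by positivity)]
    nlinarith [abs_nonneg C]
  obtain ⟨k, hk⟩ := zassenhaus (affRep σ c hc) hfin S (scal E t) (scal E t⁻¹)
    (by
      refine ContinuousLinearMap.ext (fun x => ?_)
      change (t • t⁻¹ • x.1, x.2) = x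
      rw [smul_smul, mul_inv_cancel₀ ht0.ne', one_smul])
    (by
      refine ContinuousLinearMap.ext (fun x => ?_)
      change (t⁻¹ • t • x.1, x.2) = x
      rw [smul_smul, inv_mul_cancel₀ ht0.ne', one_smul])
    (by
      intro s hs
      refine lt_of_le_of_lt (ContinuousLinearMap.opNorm_le_bound _
        (M := ‖σ s - 1‖ + 1 / 16) (by positivity) (fun x => ?_)) (by linarith [hS s hs])
      have e : (scal E t * affRep σ c hc s * scal E t⁻¹ - 1) x =
          ((σ s - 1) x.1 + (t * x.2) • c s, 0) := by
        change (t • (σ s (t⁻¹ • x.1) + x.2 • c s), x.2) - x = _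
        ext1
        · change t • (σ s (t⁻¹ • x.1) + x.2 • c s) - x.1 = σ s x.1 - x.1 + (t * x.2) • c s
          rw [map_smul, smul_add, smul_smul, mul_inv_cancel₀ ht0.ne', one_smul, smul_smul]
          abel
        · change x.2 - x.2 = 0
          simp
      rw [e]
      have h1 : ‖(σ s - 1) x.1‖ ≤ ‖σ s - 1‖ * ‖x‖ :=
        ((σ s - 1).le_opNorm _).trans (by gcongr; exact norm_fst_le x)
      have h2 : ‖(t * x.2) • c s‖ ≤ 1/16 * ‖x‖ := by
        rw [norm_smul, norm_mul, Real.norm_of_nonneg ht0.le]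
        calc t * ‖x.2‖ * ‖c s‖ ≤ t * ‖x‖ * |C| := by
              gcongr
              · exact norm_snd_le x
              · exact (hC s hs).trans (le_abs_self C)
          _ = t * |C| * ‖x‖ := by ring
          _ ≤ _ := by gcongr
      calc ‖((σ s - 1) x.1 + (t * x.2) • c s, (0:ℝ))‖ = ‖(σ s - 1) x.1 + (t * x.2) • c s‖ := by
            simp [Prod.norm_def]
        _ ≤ _ := norm_add_le _ _
        _ ≤ _ := by linarith)
  exact ⟨k, fun j hj g hg => (affRep_one σ c hc g).1 (hk j hj g hg)⟩

/-- Affine data. -/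
structure Aff {n : ℕ} {G : Type*} [Group G] (L : G →* (V n →L[ℝ] V n)) (b : G → V n) : Prop where
  fwd : Fwd L
  coc : ∀ g h, b (g * h) = L g (b h) + b g
  faith : ∀ g, L g = 1 → b g = 0 → g = 1
  proper : ∀ R : ℝ, {g | ∃ x, ‖x‖ ≤ R ∧ ‖L g x + b g‖ ≤ R}.Finite
  cocpt : ∃ R : ℝ, ∀ x, ∃ g, ‖L g x + b g‖ ≤ R

lemma Aff.fin {n : ℕ} {G : Type*} [Group G] {L : G →* (V n →L[ℝ] V n)} {b : G → V n}
    (A : Aff L b) (R : ℝ) : {g | ‖b g‖ ≤ R}.Finite := by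
  refine (A.proper (max R 0)).subset (fun g hg => ⟨0, ?_, ?_⟩)
  · simp
  · rw [map_zero, zero_add]; exact le_max_of_le_left hg

lemma Aff.fin2 {n : ℕ} {G : Type*} [Group G] {L : G →* (V n →L[ℝ] V n)} {b : G → V n}
    (A : Aff L b) (R : ℝ) : {g | ‖affRep L b A.coc g‖ ≤ R}.Finite :=
  (A.fin R).subset (fun g hg => (affRep_norm L b A.coc g).trans hg)

/-- The stabilizer of a line. -/
def stab {n : ℕ} {G : Type*} [Group G] (L : G →* (V n →L[ℝ] V n)) (v : V n) (hv : v ≠ 0) :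
    Subgroup G where
  carrier := {g | ∃ μ : ℝ, L g v = μ • v}
  one_mem' := ⟨1, by rw [one_app, one_smul]⟩
  mul_mem' := by
    rintro a b ⟨μ, h⟩ ⟨ν, h'⟩
    exact ⟨ν * μ, by rw [mul_app, h', map_smul, h, smul_smul]⟩
  inv_mem' := by
    rintro a ⟨μ, h⟩
    have hμ : μ ≠ 0 := by
      rintro rfl
      rw [zero_smul] at h
      exact hv (L_inj L a (by rw [h, map_zero]))
    refine ⟨μ⁻¹, ?_⟩
    have := congrArg (L a⁻¹) h
    rw [inv_mul_app, map_smul] at this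
    rw [this, smul_smul, inv_mul_cancel₀ hμ, one_smul, ← this]

/-- Elementary groups. -/
def Elem {n : ℕ} {G : Type*} [Group G] (L : G →* (V n →L[ℝ] V n)) : Prop :=
  ∃ v, ∃ hv : v ≠ 0, v ∈ cone n ∧ (stab L v hv).index ≠ 0

lemma Fwd.eig_pos {n : ℕ} {G : Type*} [Group G] {L : G →* (V n →L[ℝ] V n)} (F : Fwd L) (g : G)
    {x : V n} (hx : x ∈ cone n) (h0 : x ≠ 0) {μ : ℝ} (h : L g x = μ • x) : 0 < μ := by
  have h1 := T_pos (F.hC g x hx) (fun h' => h0 (L_inj L g (by rw [h', map_zero])))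
  rw [h, map_smul, smul_eq_mul] at h1
  by_contra hc
  push Not at hc
  nlinarith [T_pos hx h0]

lemma conj_small {n : ℕ} {G : Type*} [Group G] (L : G →* (V n →L[ℝ] V n)) (a : G) {ε : ℝ}
    (hε : 0 < ε) : ∃ δ > 0, ∀ g, ‖L g - 1‖ < δ → ‖L (a⁻¹ * g * a) - 1‖ < ε := by
  refine ⟨ε / (‖L a⁻¹‖ * ‖L a‖ + 1), by positivity, fun g hg => ?_⟩
  have e : L (a⁻¹ * g * a) - 1 = L a⁻¹ * (L g - 1) * L a := by
    rw [mul_sub, sub_mul, ← map_mul, ← map_mul, mul_one, ← map_mul, inv_mul_cancel, map_one]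
  rw [e]
  rw [lt_div_iff₀ (by positivity)] at hg
  calc _ ≤ ‖L a⁻¹ * (L g - 1)‖ * ‖L a‖ := norm_mul_le _ _
    _ ≤ ‖L a⁻¹‖ * ‖L g - 1‖ * ‖L a‖ := by gcongr; exact norm_mul_le _ _
    _ ≤ ‖L g - 1‖ * (‖L a⁻¹‖ * ‖L a‖ + 1) := by nlinarith [norm_nonneg (L g - 1)]
    _ < ε := hg

theorem claimA {n : ℕ} {G : Type*} [Group G] {L : G →* (V n →L[ℝ] V n)} {b : G → V n}
    (A : Aff L b) (hE : ¬ Elem L) (W : Submodule ℝ (V n)) (hW : ∀ g, ∀ w ∈ W, L g w ∈ W)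
    (hv : ∃ v ∈ W, v ∈ tl n)
    (hirr : ∀ S ≤ W, (∀ g, ∀ w ∈ S, L g w ∈ S) → S = ⊥ ∨ S = W) :
    ∃ ε > 0, ∀ g, ‖L g - 1‖ < ε → ∀ w ∈ W, L g w = w := by
  have F := A.fwd
  let S : Submodule ℝ (V n) :=
    { carrier := {w | w ∈ W ∧ ∃ ε > 0, ∀ g, ‖L g - 1‖ < ε → L g w = w}
      add_mem' := by
        rintro x y ⟨hx, ε, hε, h⟩ ⟨hy, δ, hδ, h'⟩
        exact ⟨W.add_mem hx hy, min ε δ, lt_min hε hδ, fun g hg => by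
          rw [map_add, h g (lt_of_lt_of_le hg (min_le_left _ _)),
            h' g (lt_of_lt_of_le hg (min_le_right _ _))]⟩
      zero_mem' := ⟨W.zero_mem, 1, one_pos, fun g _ => map_zero _⟩
      smul_mem' := by
        rintro c x ⟨hx, ε, hε, h⟩
        exact ⟨W.smul_mem _ hx, ε, hε, fun g hg => by rw [map_smul, h g hg]⟩ }
  have memS : ∀ w, w ∈ S ↔ w ∈ W ∧ ∃ ε > 0, ∀ g, ‖L g - 1‖ < ε → L g w = w := fun w => Iff.rfl
  have Sinv : ∀ g, ∀ w ∈ S, L g w ∈ S := by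
    intro a w hw
    obtain ⟨hw, ε, hε, h⟩ := (memS w).1 hw
    obtain ⟨δ, hδ, hd⟩ := conj_small L a hε
    refine (memS _).2 ⟨hW a w hw, δ, hδ, fun g hg => ?_⟩
    have := congrArg (L a) (h _ (hd g hg))
    rwa [mul_app, mul_app, mul_inv_app] at this
  rcases hirr S (fun w hw => hw.1) Sinv with hS | hS
  · exfalso
    apply hE
    obtain ⟨v, hvW, hvc, hv0, hveig⟩ := lemNF F {g | ‖L g - 1‖ < 1 / 16} W (fun s _ => hW s) hv (by
      intro S hS
      obtain ⟨k, hk⟩ := zass_small L b A.coc (fun R => (A.fin2 R).image _) (S : Set G)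
        S.finite_toSet hS
      refine ⟨k, fun j hj g hg w _ => ?_⟩
      rw [(hk j hj g hg).1]; rfl)
    refine ⟨v, hv0, hvc, ?_⟩
    have hnf : ∀ ε > 0, ¬ ∀ g, ‖L g - 1‖ < ε → L g v = v := by
      intro ε hε h
      have : v ∈ S := (memS v).2 ⟨hvW, ε, hε, h⟩
      rw [hS] at this
      exact hv0 (by simpa using this)
    have hnull : B n v v = 0 := by
      by_contra hne
      have hvt := tl_of_cone hvc (lt_of_le_of_ne hvc.1 hne)
      refine hnf (1/16) (by norm_num) (fun g hg => ?_)
      obtain ⟨μ, hμ⟩ := hveig g hg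
      exact F.eig_one g hvt hμ
    -- eigenvectors for small elements
    have hgv : ∀ a : G, ∃ δ > 0, ∀ g, ‖L g - 1‖ < δ → ∃ μ : ℝ, L g (L a v) = μ • L a v := by
      intro a
      obtain ⟨δ, hδ, hd⟩ := conj_small L a (ε := 1/16) (by norm_num)
      refine ⟨δ, hδ, fun g hg => ?_⟩
      obtain ⟨μ, hμ⟩ := hveig _ (hd g hg)
      refine ⟨μ, ?_⟩
      have := congrArg (L a) hμ
      rwa [mul_app, mul_app, mul_inv_app, map_smul] at this
    -- parallel
    have hpar : ∀ a c : G, a⁻¹ * c ∉ stab L v hv0 → B n (L a v) (L c v) ≠ 0 := by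
      intro a c hac h
      apply hac
      have h1 : B n v (L (a⁻¹ * c) v) = 0 := by
        rw [mul_app, ← F.hB a, mul_inv_app, h]
      have h2 := F5 hvc.1 (F.hC (a⁻¹ * c) v hvc).1 h1
      have hT : T n v ≠ 0 := (T_pos hvc hv0).ne'
      refine ⟨T n (L (a⁻¹ * c) v) / T n v, ?_⟩
      rw [div_eq_inv_mul, mul_smul, h2, smul_smul, inv_mul_cancel₀ hT, one_smul]
    classical
    refine index_ne_zero_of_fin (α := Bool) _ (fun g => decide (g ∈ stab L v hv0)) ?_
    intro a c hac
    by_contra hn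
    have hac' : (a ∈ stab L v hv0) ↔ (c ∈ stab L v hv0) := by simpa using hac
    by_cases ha : a ∈ stab L v hv0
    · exact hn (mul_mem (inv_mem ha) (hac'.1 ha))
    · have hc : c ∉ stab L v hv0 := fun h => ha (hac'.2 h)
      obtain ⟨δ1, hδ1, h1⟩ := hgv a
      obtain ⟨δ2, hδ2, h2⟩ := hgv c
      have b1 := hpar 1 a (by simpa using ha)
      have b2 := hpar 1 c (by simpa using hc)
      have b3 := hpar a c hn
      rw [one_app] at b1 b2
      refine hnf (min (1/16) (min δ1 δ2)) (by positivity) (fun g hg => ?_)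
      obtain ⟨μ, hμ⟩ := hveig g (lt_of_lt_of_le hg (min_le_left _ _))
      obtain ⟨μ1, hμ1⟩ := h1 g (lt_of_lt_of_le hg ((min_le_right _ _).trans (min_le_left _ _)))
      obtain ⟨μ2, hμ2⟩ := h2 g (lt_of_lt_of_le hg ((min_le_right _ _).trans (min_le_right _ _)))
      have hp := F.eig_pos g hvc hv0 hμ
      have hmul : ∀ x y (s t : ℝ), L g x = s • x → L g y = t • y → B n x y ≠ 0 → s * t = 1 := by
        intro x y s t hx hy hxy
        have := F.hB g x y
        rw [hx, hy, map_smul, map_smul, LinearMap.smul_apply, smul_eq_mul, smul_eq_mul] at this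
        have h3 : (s * t - 1) * B n x y = 0 := by linarith
        rcases mul_eq_zero.1 h3 with h4 | h4
        · linarith
        · exact absurd h4 hxy
      have m1 := hmul _ _ _ _ hμ hμ1 b1
      have m2 := hmul _ _ _ _ hμ hμ2 b2
      have m3 := hmul _ _ _ _ hμ1 hμ2 b3
      have : μ * μ = 1 := by
        calc μ * μ = (μ * μ) * (μ1 * μ2) := by rw [m3, mul_one]
          _ = (μ * μ1) * (μ * μ2) := by ring
          _ = 1 := by rw [m1, m2, one_mul]
      have : μ = 1 := by nlinarith
      rw [hμ, this, one_smul]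
  · have hall : ∀ w : W, ∃ ε > 0, ∀ g, ‖L g - 1‖ < ε → L g w = w := fun w =>
      ((memS w).1 (by rw [hS]; exact w.2)).2
    obtain ⟨bs⟩ : Nonempty (Module.Basis (Fin (Module.finrank ℝ W)) ℝ W) := ⟨Module.finBasis ℝ W⟩
    have hall2 : ∀ i, ∃ ε > 0, ∀ g, ‖L g - 1‖ < ε → L g (bs i : V n) = bs i := fun i => hall (bs i)
    choose e he0 he using hall2
    obtain ⟨ε, hε, hle⟩ : ∃ ε > 0, ∀ i, ε ≤ e i := by
      rcases isEmpty_or_nonempty (Fin (Module.finrank ℝ W)) with h | h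
      · exact ⟨1, one_pos, fun i => h.elim i⟩
      · obtain ⟨i, hi⟩ := Finite.exists_min e
        exact ⟨e i, he0 i, hi⟩
    refine ⟨ε, hε, fun g hg w hw => ?_⟩
    have h1 := congrArg Subtype.val (bs.sum_repr ⟨w, hw⟩)
    rw [Submodule.coe_sum] at h1
    change _ = w at h1
    rw [← h1, map_sum]
    refine Finset.sum_congr rfl (fun i _ => ?_)
    rw [Submodule.coe_smul, map_smul, he i g (lt_of_lt_of_le hg (hle i))]

end GK


namespace GK
open scoped commutatorElement

lemma addsub_cover {n : ℕ} (A : AddSubgroup (V n)) :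
    ∃ C, ∀ t ∈ Submodule.span ℝ (A : Set (V n)), ∃ a ∈ A, ‖t - a‖ ≤ C := by
  obtain ⟨s, hs, hspan⟩ := (Submodule.fg_span_iff_fg_span_finset_subset (R := ℝ)
    (A : Set (V n))).1 (IsNoetherian.noetherian _)
  refine ⟨∑ x ∈ s, ‖x‖, fun t ht => ?_⟩
  rw [hspan] at ht
  obtain ⟨f, _, rfl⟩ := Submodule.mem_span_finset.1 ht
  refine ⟨∑ x ∈ s, ⌊f x⌋ • x, A.sum_mem (fun x hx => A.zsmul_mem (hs hx) _), ?_⟩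
  rw [← Finset.sum_sub_distrib]
  refine (norm_sum_le _ _).trans (Finset.sum_le_sum (fun x _ => ?_))
  rw [← Int.cast_smul_eq_zsmul ℝ, ← sub_smul, norm_smul, Int.self_sub_floor]
  rw [Real.norm_of_nonneg (Int.fract_nonneg _)]
  nlinarith [(Int.fract_lt_one (f x)).le, norm_nonneg x]

lemma pow_small {G E : Type*} [Group G] [NormedAddCommGroup E] [InnerProductSpace ℝ E]
    [FiniteDimensional ℝ E] (σ : G →* (E →L[ℝ] E)) (hσ : ∀ g x, ‖σ g x‖ = ‖x‖) (g : G) {ε : ℝ}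
    (hε : 0 < ε) : ∃ N : ℕ, 1 ≤ N ∧ ‖σ (g ^ N) - 1‖ < ε := by
  have hle : ∀ g, ‖σ g‖ ≤ 1 := fun g =>
    ContinuousLinearMap.opNorm_le_bound _ zero_le_one (fun x => by rw [hσ, one_mul])
  have : ProperSpace (E →L[ℝ] E) := FiniteDimensional.proper_real _
  obtain ⟨α, hα, c, hc⟩ := exists_finite_cover (E := E →L[ℝ] E) 1 ε hε
  obtain ⟨i, k, hik, heq⟩ := Finite.exists_ne_map_eq_of_infinite (fun i : ℕ => c (σ (g ^ i)))
  wlog hlt : i < k generalizing i k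
  · exact this k i hik.symm heq.symm (lt_of_le_of_ne (not_lt.1 hlt) hik.symm)
  refine ⟨k - i, by omega, ?_⟩
  have h1 := hc _ _ (hle (g ^ k)) (hle (g ^ i)) heq.symm
  have h2 : σ (g ^ (k - i)) - 1 = (σ (g ^ k) - σ (g ^ i)) * σ ((g ^ i)⁻¹) := by
    rw [sub_mul, ← map_mul, ← map_mul, mul_inv_cancel, map_one, pow_sub g hlt.le]
  rw [h2]
  calc _ ≤ ‖σ (g ^ k) - σ (g ^ i)‖ * ‖σ ((g ^ i)⁻¹)‖ := norm_mul_le _ _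
    _ ≤ ‖σ (g ^ k) - σ (g ^ i)‖ * 1 := by gcongr; exact hle _
    _ < ε := by rwa [mul_one]

/-- Projection onto a Lorentz subspace. -/
def PDat.pw {n : ℕ} {P : Submodule ℝ (V n)} (D : PDat P) : V n →L[ℝ] V n :=
  ContinuousLinearMap.id ℝ (V n) - D.j.comp D.p

lemma PDat.pw_apply {n : ℕ} {P : Submodule ℝ (V n)} (D : PDat P) (x : V n) :
    D.pw x = x - D.j (D.p x) := rfl

lemma PDat.pw_mem {n : ℕ} {W : Submodule ℝ (V n)} (D : PDat (orth W)) (hv : ∃ v ∈ W, v ∈ tl n)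
    (x : V n) : D.pw x ∈ W := by
  obtain ⟨v, hv, hvt⟩ := hv
  exact orth_orth ⟨v, hv, hvt.1⟩ (D.perp x)

lemma PDat.p_W {n : ℕ} {W : Submodule ℝ (V n)} (D : PDat (orth W)) {x : V n} (hx : x ∈ W) :
    D.p x = 0 := D.p_zero (fun y hy => by rw [B_comm]; exact hy x hx)

lemma PDat.pw_id {n : ℕ} {W : Submodule ℝ (V n)} (D : PDat (orth W)) {x : V n} (hx : x ∈ W) :
    D.pw x = x := by
  rw [D.pw_apply, D.p_W hx, map_zero, sub_zero]

lemma PDat.pw_orth {n : ℕ} {P : Submodule ℝ (V n)} (D : PDat P) {x : V n} :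
    D.pw x = 0 ↔ x ∈ P := by
  rw [D.pw_apply, sub_eq_zero]
  constructor
  · intro h; rw [h]; exact D.jmem _
  · intro h; exact (D.jp x h).symm

lemma PDat.pw_L {n : ℕ} {P : Submodule ℝ (V n)} (D : PDat P) {G : Type*} [Group G]
    (L : G →* (V n →L[ℝ] V n)) (hB : ∀ g x y, B n (L g x) (L g y) = B n x y)
    (hinv : ∀ g, ∀ x ∈ P, L g x ∈ P) (g : G) (x) :
    D.pw (L g x) = L g (D.pw x) := by
  rw [D.pw_apply, D.pw_apply, D.p_L L hB hinv, D.j_rep, map_sub]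

theorem caseP5 {n : ℕ} {G : Type*} [Group G] {L : G →* (V n →L[ℝ] V n)} {b : G → V n}
    (A : Aff L b) (W : Submodule ℝ (V n)) (hW : ∀ g, ∀ w ∈ W, L g w ∈ W)
    (hv : ∃ v ∈ W, v ∈ tl n)
    (hirr : ∀ S ≤ W, (∀ g, ∀ w ∈ S, L g w ∈ S) → S = ⊥ ∨ S = W) (D : PDat (orth W))
    (hK : ∃ κ, (∀ w ∈ W, L κ w = w) ∧ D.pw (b κ) ≠ 0) : Elem L := by
  have F := A.fwd
  have hPinv := orth_inv L F.hB hW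
  set σ := D.rep L hPinv with hσdef
  have hσ : ∀ g x, ‖σ g x‖ = ‖x‖ := D.rep_norm L F.hB hPinv
  set c : G → V n := fun g => D.pw (b g) with hcdef
  have cW : ∀ g, c g ∈ W := fun g => D.pw_mem hv _
  have ccoc : ∀ g h, c (g * h) = L g (c h) + c g := fun g h => by
    simp only [hcdef]
    rw [A.coc, map_add, D.pw_L L F.hB hPinv]
  have b1 : b 1 = 0 := by
    have := A.coc 1 1
    rw [one_app] at this
    simpa using this
  have c1 : c 1 = 0 := by simp only [hcdef]; rw [b1, map_zero]
  -- the kernel on W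
  let K : Subgroup G :=
    { carrier := {g | ∀ w ∈ W, L g w = w}
      one_mem' := fun w _ => one_app L w
      mul_mem' := by
        intro a b ha hb w hw
        rw [mul_app, hb w hw, ha w hw]
      inv_mem' := by
        intro a ha w hw
        conv_lhs => rw [← ha w hw]
        rw [inv_mul_app] }
  have memK : ∀ g, g ∈ K ↔ ∀ w ∈ W, L g w = w := fun g => Iff.rfl
  have Knorm : ∀ g, ∀ κ ∈ K, g * κ * g⁻¹ ∈ K := by
    intro g κ hκ w hw
    rw [mul_app, mul_app, hκ _ (hW _ _ hw), mul_inv_app]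
  have cK : ∀ κ ∈ K, ∀ g, c (κ * g) = c g + c κ := fun κ hκ g => by
    rw [ccoc, hκ _ (cW g)]
  have ccj : ∀ κ ∈ K, ∀ g, c (g * κ * g⁻¹) = L g (c κ) := by
    intro κ hκ g
    have h1 := ccoc g g⁻¹
    rw [mul_inv_cancel, c1] at h1
    rw [mul_assoc, ccoc, cK κ hκ, map_add, add_right_comm, ← h1, zero_add]
  have cinv : ∀ κ ∈ K, c κ⁻¹ = - c κ := by
    intro κ hκ
    have := cK κ hκ κ⁻¹
    rw [mul_inv_cancel, c1] at this
    exact eq_neg_of_add_eq_zero_left this.symm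
  have cpow : ∀ κ ∈ K, ∀ N : ℕ, c (κ ^ N) = (N : ℝ) • c κ := by
    intro κ hκ N
    induction N with
    | zero => simp [c1]
    | succ N ih => rw [pow_succ', cK κ hκ, ih, Nat.cast_succ, add_smul, one_smul]
  have LK : ∀ κ ∈ K, ∀ x, L κ x - x = D.j ((σ κ - 1) (D.p x)) := by
    intro κ hκ x
    have h1 : x = D.pw x + D.j (D.p x) := by rw [D.pw_apply]; abel
    have h2 : L κ x = D.pw x + D.j (σ κ (D.p x)) := by
      conv_lhs => rw [h1]
      rw [map_add, hκ _ (D.pw_mem hv x), D.j_rep]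
    change L κ x - x = D.j (σ κ (D.p x) - D.p x)
    rw [h2, map_sub, D.pw_apply]; abel
  have LKone : ∀ κ ∈ K, σ κ = 1 → L κ = 1 := by
    intro κ hκ h
    ext1 x
    have := LK κ hκ x
    rw [h, sub_self] at this
    simpa [sub_eq_zero] using this
  have LKn : ∀ κ ∈ K, ‖L κ - 1‖ ≤ ‖D.j‖ * ‖D.p‖ * ‖σ κ - 1‖ := by
    intro κ hκ
    refine ContinuousLinearMap.opNorm_le_bound _ (by positivity) (fun x => ?_)
    change ‖L κ x - x‖ ≤ _
    rw [LK κ hκ]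
    calc _ ≤ ‖D.j‖ * ‖(σ κ - 1) (D.p x)‖ := D.j.le_opNorm _
      _ ≤ ‖D.j‖ * (‖σ κ - 1‖ * (‖D.p‖ * ‖x‖)) := by
        gcongr
        exact ((σ κ - 1).le_opNorm _).trans (by gcongr; exact D.p.le_opNorm _)
      _ = _ := by ring
  -- small elements
  obtain ⟨ε, hε, hε2, hεC⟩ : ∃ ε > 0, ε ≤ 1 / 2 ∧ ‖D.j‖ * ‖D.p‖ * ε < 1 / 16 := by
    refine ⟨min (1/2) (1 / (32 * (‖D.j‖ * ‖D.p‖ + 1))), by positivity, min_le_left _ _, ?_⟩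
    calc ‖D.j‖ * ‖D.p‖ * min (1/2) (1 / (32 * (‖D.j‖ * ‖D.p‖ + 1)))
        ≤ (‖D.j‖ * ‖D.p‖ + 1) * (1 / (32 * (‖D.j‖ * ‖D.p‖ + 1))) := by
          gcongr
          · linarith
          · exact min_le_right _ _
      _ = 1 / 32 := by field_simp
      _ < _ := by norm_num
  have Xcomm : ∀ a ∈ K, ∀ d ∈ K, ‖σ a - 1‖ < ε → ‖σ d - 1‖ < ε → σ ⁅a, d⁆ = 1 := by
    intro a ha d hd ha1 hd1
    refine comm_of_iter σ hσ a d (by linarith) (by linarith) ?_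
    obtain ⟨k, hk⟩ := zass_small L b A.coc (fun R => (A.fin2 R).image _) {a, d}
      (Set.toFinite _) (by
        intro s hs
        have hsK : s ∈ K ∧ ‖σ s - 1‖ < ε := by
          rcases hs with rfl | hs
          · exact ⟨ha, ha1⟩
          · rw [Set.mem_singleton_iff.1 hs]; exact ⟨hd, hd1⟩
        calc _ ≤ ‖D.j‖ * ‖D.p‖ * ‖σ s - 1‖ := LKn s hsK.1
          _ ≤ ‖D.j‖ * ‖D.p‖ * ε := by gcongr; exact hsK.2.le
          _ < _ := hεC)
    refine ⟨k, fun j hj g hg => ?_⟩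
    ext1 x
    rw [hσdef, D.rep_apply, (hk j hj g hg).1]
    exact D.pj x
  -- translations
  let Λ : Subgroup G := L.ker
  have memΛ : ∀ g, g ∈ Λ ↔ L g = 1 := fun g => MonoidHom.mem_ker
  have bΛ : ∀ l ∈ Λ, ∀ g, b (l * g) = b g + b l := fun l hl g => by
    rw [A.coc, (memΛ l).1 hl]; rfl
  let AΛ : AddSubgroup (V n) :=
    { carrier := b '' Λ
      zero_mem' := ⟨1, one_mem _, b1⟩
      add_mem' := by
        rintro _ _ ⟨l, hl, rfl⟩ ⟨m, hm, rfl⟩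
        exact ⟨m * l, mul_mem hm hl, bΛ m hm l⟩
      neg_mem' := by
        rintro _ ⟨l, hl, rfl⟩
        refine ⟨l⁻¹, inv_mem hl, ?_⟩
        have := bΛ l hl l⁻¹
        rw [mul_inv_cancel, b1] at this
        exact eq_neg_of_add_eq_zero_left this.symm }
  set T0 : Submodule ℝ (V n) := Submodule.span ℝ (AΛ : Set (V n)) with hT0
  have T0inv : ∀ g, ∀ t ∈ T0, L g t ∈ T0 := by
    intro g t ht
    have hle : T0 ≤ T0.comap (L g : V n →ₗ[ℝ] V n) := by
      rw [hT0, Submodule.span_le]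
      rintro _ ⟨l, hl, rfl⟩
      refine Submodule.subset_span ⟨g * l * g⁻¹, ?_, ?_⟩
      · change L (g * l * g⁻¹) = 1
        rw [map_mul, map_mul, (memΛ l).1 hl, mul_one, ← map_mul, mul_inv_cancel, map_one]
      · have h1 := A.coc g g⁻¹
        rw [mul_inv_cancel, b1] at h1
        change b (g * l * g⁻¹) = L g (b l)
        rw [mul_assoc, A.coc, bΛ l hl, map_add, add_right_comm, ← h1, zero_add]
    exact hle ht
  -- span of c
  have hspanc : ∀ M : V n →ₗ[ℝ] V n, (∀ κ ∈ K, ‖σ κ - 1‖ < ε → M (c κ) = c κ) →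
      ∀ w ∈ W, M w = w := by
    intro M hM
    have h1 : ∀ κ ∈ K, M (c κ) = c κ := by
      intro κ hκ
      obtain ⟨N, hN, hs⟩ := pow_small σ hσ κ hε
      have h2 := hM _ (K.pow_mem hκ N) hs
      rw [cpow κ hκ, map_smul] at h2
      have hN0 : (N : ℝ) ≠ 0 := by positivity
      exact smul_right_injective _ hN0 h2
    let C : Submodule ℝ (V n) := Submodule.span ℝ (c '' (K : Set G))
    have hCW : C ≤ W := Submodule.span_le.2 (by rintro _ ⟨κ, _, rfl⟩; exact cW κ)
    have hCinv : ∀ g, ∀ w ∈ C, L g w ∈ C := by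
      intro g w hw
      have hle : C ≤ C.comap (L g : V n →ₗ[ℝ] V n) := by
        rw [Submodule.span_le]
        rintro _ ⟨κ, hκ, rfl⟩
        exact Submodule.subset_span ⟨g * κ * g⁻¹, Knorm g κ hκ, ccj κ hκ g⟩
      exact hle hw
    have hC : C = W := by
      rcases hirr C hCW hCinv with h | h
      · exfalso
        obtain ⟨κ, hκ, hne⟩ := hK
        have : c κ ∈ C := Submodule.subset_span ⟨κ, hκ, rfl⟩
        rw [h] at this
        exact hne (by simpa using this)
      · exact h
    intro w hw
    rw [← hC] at hw
    have hle : C ≤ LinearMap.ker (M - LinearMap.id) := by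
      rw [Submodule.span_le]
      rintro _ ⟨κ, hκ, rfl⟩
      simp [h1 κ hκ]
    have := hle hw
    simpa [sub_eq_zero] using this
  have hle : T0.map (D.pw : V n →ₗ[ℝ] V n) ≤ W := by
    rintro _ ⟨t, _, rfl⟩; exact D.pw_mem hv t
  rcases hirr _ hle (by
      rintro g _ ⟨t, ht, rfl⟩
      exact ⟨L g t, T0inv g t ht, D.pw_L L F.hB hPinv g t⟩) with hπT | hπT
  · -- small elements act trivially on W
    obtain ⟨v, hvW, hvt⟩ := hv
    refine ⟨v, tl_ne hvt, tl_cone hvt, ?_⟩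
    refine index_of_small σ hσ 1 one_pos _ (fun q hq => ⟨1, ?_⟩)
    rw [one_smul]
    refine hspanc (L q : V n →ₗ[ℝ] V n) (fun κ hκ hκε => ?_) v hvW
    have h1 : σ ⁅κ, q * κ * q⁻¹⁆ = 1 := Xcomm κ hκ _ (Knorm q κ hκ) hκε
      (lt_of_le_of_lt (iso_conj_norm σ hσ q κ) hκε)
    have h2 := frob σ hσ κ q hq h1
    have h3 : ⁅q, κ⁆ ∈ K := mul_mem (Knorm q κ hκ) (inv_mem hκ)
    have h4 : ⁅q, κ⁆ ∈ Λ := (memΛ _).2 (LKone _ h3 h2)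
    have h5 : c ⁅q, κ⁆ = 0 := by
      have : c ⁅q, κ⁆ ∈ T0.map (D.pw : V n →ₗ[ℝ] V n) :=
        ⟨b ⁅q, κ⁆, Submodule.subset_span ⟨_, h4, rfl⟩, rfl⟩
      rw [hπT] at this
      simpa using this
    rw [commutatorElement_def, cK _ (Knorm q κ hκ), cinv κ hκ, ccj κ hκ, neg_add_eq_zero] at h5
    exact h5.symm
  · -- main case
    set Y : Submodule ℝ (V n) := orth W ⊓ orth (T0 ⊓ orth W) with hY
    have hv' : ∃ v ∈ W, B n v v < 0 := by
      obtain ⟨v, hvW, hvt⟩ := hv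
      exact ⟨v, hvW, hvt.1⟩
    have hQpos : ∀ x ∈ T0 ⊓ orth W, x ≠ 0 → 0 < B n x x := fun x hx => orth_pos hv' x hx.2
    obtain ⟨DQ⟩ := exists_PDat (T0 ⊓ orth W) hQpos
    obtain ⟨DY⟩ := exists_PDat Y (fun x hx => orth_pos hv' x hx.1)
    have hQinv : ∀ g, ∀ x ∈ T0 ⊓ orth W, L g x ∈ T0 ⊓ orth W := fun g x hx =>
      ⟨T0inv g x hx.1, hPinv g x hx.2⟩
    have hYinv : ∀ g, ∀ x ∈ Y, L g x ∈ Y := fun g x hx =>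
      ⟨hPinv g x hx.1, orth_inv L F.hB hQinv g x hx.2⟩
    have hdisj : ∀ x ∈ Y, x ∈ T0 → x = 0 := by
      intro x hx hxT
      by_contra h0
      have h1 := hQpos x ⟨hxT, hx.1⟩ h0
      rw [hx.2 x ⟨hxT, hx.1⟩] at h1
      exact lt_irrefl _ h1
    have hcompl : IsCompl Y T0 := by
      refine IsCompl.of_eq ?_ ?_
      · rw [Submodule.eq_bot_iff]
        intro x hx
        exact hdisj x hx.1 hx.2
      · rw [Submodule.eq_top_iff']
        intro x
        have h1 : D.pw x ∈ T0.map (D.pw : V n →ₗ[ℝ] V n) := by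
          rw [hπT]; exact D.pw_mem hv x
        obtain ⟨t, ht, htx⟩ := h1
        change D.pw t = D.pw x at htx
        have h2 : x - t ∈ orth W := by
          rw [← D.pw_orth, map_sub, htx, sub_self]
        have h3 : (x - t) - DQ.j (DQ.p (x - t)) ∈ Y := by
          refine ⟨(orth W).sub_mem h2 (DQ.jmem _).2, ?_⟩
          exact DQ.perp (x - t)
        rw [Submodule.mem_sup]
        refine ⟨_, h3, t + DQ.j (DQ.p (x - t)), T0.add_mem ht (DQ.jmem _).1, by abel⟩
    let q0 : V n →ₗ[ℝ] V n := Y.projection T0 hcompl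
    have q0Y : ∀ x, q0 x ∈ Y := fun x => Submodule.projection_apply_mem _ _
    have q0T : ∀ x, x - q0 x ∈ T0 := fun x => Submodule.sub_projection_mem _ _
    have q0L : ∀ g x, q0 (L g x) = L g (q0 x) := by
      intro g x
      rw [← sub_eq_zero]
      refine hdisj _ (Y.sub_mem (q0Y _) (hYinv g _ (q0Y x))) ?_
      have h1 := T0.sub_mem (T0inv g _ (q0T x)) (q0T (L g x))
      rw [map_sub] at h1
      convert h1 using 1
      abel
    have q0z : ∀ t ∈ T0, q0 t = 0 := by
      intro t ht
      refine hdisj _ (q0Y t) ?_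
      have := T0.sub_mem ht (q0T t)
      rwa [sub_sub_cancel] at this
    set σ' := DY.rep L hYinv with hσ'def
    have hσ' : ∀ g x, ‖σ' g x‖ = ‖x‖ := DY.rep_norm L F.hB hYinv
    set c' : G → EuclideanSpace ℝ (Fin DY.m) := fun g => DY.p (q0 (b g)) with hc'
    have cPcoc : ∀ g h, c' (g * h) = σ' g (c' h) + c' g := by
      intro g h
      simp only [hc']
      rw [A.coc, map_add, map_add, q0L, DY.p_L L F.hB hYinv]
    obtain ⟨C, hC⟩ := addsub_cover AΛ
    -- moving by translations
    have hmove : ∀ g, ∃ l ∈ Λ, ‖b (l * g)‖ ≤ ‖q0 (b g)‖ + C := by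
      intro g
      obtain ⟨_, ⟨l, hl, rfl⟩, hle⟩ := hC _ (q0T (b g))
      refine ⟨l⁻¹, inv_mem hl, ?_⟩
      have h1 := bΛ l hl (l⁻¹ * g)
      rw [mul_inv_cancel_left] at h1
      have h2 : b (l⁻¹ * g) = q0 (b g) + (b g - q0 (b g) - b l) := by rw [h1]; abel
      rw [h2]
      exact (norm_add_le _ _).trans (by gcongr)
    have Lmove : ∀ l ∈ Λ, ∀ g, L (l * g) = L g := fun l hl g => by
      rw [map_mul, (memΛ l).1 hl, one_mul]
    have c'move : ∀ l ∈ Λ, ∀ g, c' (l * g) = c' g := fun l hl g => by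
      simp only [hc']
      rw [bΛ l hl, map_add, q0z (b l) (Submodule.subset_span ⟨l, hl, rfl⟩), add_zero]
    have hq0c : ∀ g, q0 (b g) = DY.j (c' g) := fun g => (DY.jp _ (q0Y _)).symm
    have hfin' : ∀ R : ℝ, (affRep σ' c' cPcoc '' {g | ‖affRep σ' c' cPcoc g‖ ≤ R}).Finite := by
      intro R
      refine ((A.fin (‖DY.j‖ * R + C)).image (affRep σ' c' cPcoc)).subset ?_
      rintro _ ⟨g, hg, rfl⟩
      obtain ⟨l, hl, hle⟩ := hmove g
      refine ⟨l * g, ?_, ?_⟩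
      · refine hle.trans ?_
        rw [hq0c]
        gcongr
        refine (DY.j.le_opNorm _).trans ?_
        gcongr
        exact (affRep_norm σ' c' cPcoc g).trans hg
      · refine ContinuousLinearMap.ext (fun x => ?_)
        rw [affRep_apply, affRep_apply, c'move l hl]
        congr 2
        rw [hσ'def, DY.rep_apply, DY.rep_apply, Lmove l hl]
    -- the kernel J
    have hJ : ∀ g, σ' g = 1 → c' g = 0 → ∀ w ∈ W, L g w = w := by
      let J : Subgroup G := (affRep σ' c' cPcoc).ker
      have memJ : ∀ g, g ∈ J ↔ σ' g = 1 ∧ c' g = 0 := fun g =>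
        MonoidHom.mem_ker.trans (affRep_one σ' c' cPcoc g)
      have hLJ : (L '' (J : Set G)).Finite := by
        refine ((A.fin C).image L).subset ?_
        rintro _ ⟨g, hg, rfl⟩
        obtain ⟨l, hl, hle⟩ := hmove g
        refine ⟨l * g, ?_, Lmove l hl g⟩
        rw [hq0c, ((memJ g).1 hg).2, map_zero, norm_zero, zero_add] at hle
        exact hle
      obtain ⟨v, hvW, hvt⟩ := hv
      let S : Submodule ℝ (V n) :=
        { carrier := {w | w ∈ W ∧ ∀ g ∈ J, L g w = w}
          add_mem' := by
            rintro x y ⟨hx, h⟩ ⟨hy, h'⟩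
            exact ⟨W.add_mem hx hy, fun g hg => by rw [map_add, h g hg, h' g hg]⟩
          zero_mem' := ⟨W.zero_mem, fun g _ => map_zero _⟩
          smul_mem' := by
            rintro a x ⟨hx, h⟩
            exact ⟨W.smul_mem _ hx, fun g hg => by rw [map_smul, h g hg]⟩ }
      have memS : ∀ w, w ∈ S ↔ w ∈ W ∧ ∀ g ∈ J, L g w = w := fun w => Iff.rfl
      have hSinv : ∀ g, ∀ w ∈ S, L g w ∈ S := by
        intro a w hw
        obtain ⟨hw, h⟩ := (memS w).1 hw
        refine (memS _).2 ⟨hW a w hw, fun g hg => ?_⟩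
        have h1 : a⁻¹ * g * a ∈ J := by
          have := (inferInstance : J.Normal).conj_mem g hg a⁻¹
          simpa using this
        have := congrArg (L a) (h _ h1)
        rwa [mul_app, mul_app, mul_inv_app] at this
      have hSW : S = W := by
        rcases hirr S (fun w hw => hw.1) hSinv with h | h
        · exfalso
          classical
          let s : V n := ∑ M ∈ hLJ.toFinset, M v
          have hs1 : s ∈ S := by
            refine (memS _).2 ⟨W.sum_mem (fun M hM => ?_), fun g hg => ?_⟩
            · obtain ⟨g, _, rfl⟩ := hLJ.mem_toFinset.1 hM
              exact hW g v hvW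
            · change L g (∑ M ∈ hLJ.toFinset, M v) = ∑ M ∈ hLJ.toFinset, M v
              rw [map_sum]
              refine Finset.sum_bij' (fun M _ => L g * M) (fun M _ => L g⁻¹ * M) ?_ ?_ ?_ ?_ ?_
              · intro M hM
                obtain ⟨h, hh, rfl⟩ := hLJ.mem_toFinset.1 hM
                exact hLJ.mem_toFinset.2 ⟨g * h, mul_mem hg hh, map_mul _ _ _⟩
              · intro M hM
                obtain ⟨h, hh, rfl⟩ := hLJ.mem_toFinset.1 hM
                exact hLJ.mem_toFinset.2 ⟨g⁻¹ * h, mul_mem (inv_mem hg) hh, map_mul _ _ _⟩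
              · intro M _
                rw [← mul_assoc, ← map_mul, inv_mul_cancel, map_one, one_mul]
              · intro M _
                rw [← mul_assoc, ← map_mul, mul_inv_cancel, map_one, one_mul]
              · intro M _
                rfl
          have hs2 : s ≠ 0 := by
            intro hs0
            have h1 : T n s = ∑ M ∈ hLJ.toFinset, T n (M v) := map_sum _ _ _
            have h2 : 0 < ∑ M ∈ hLJ.toFinset, T n (M v) := by
              refine Finset.sum_pos (fun M hM => ?_) ⟨1, hLJ.mem_toFinset.2 ⟨1, one_mem _, map_one _⟩⟩
              obtain ⟨g, _, rfl⟩ := hLJ.mem_toFinset.1 hM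
              exact (F.tl g hvt).2
            rw [hs0, map_zero] at h1
            linarith
          rw [h] at hs1
          exact hs2 (by simpa using hs1)
        · exact h
      intro g h1 h2 w hw
      have : w ∈ S := by rw [hSW]; exact hw
      exact ((memS w).1 this).2 g ((memJ g).2 ⟨h1, h2⟩)
    obtain ⟨v, hvW, hvc, hv0, hveig⟩ := lemNF F {g | ‖σ' g - 1‖ < 1 / 16} W (fun s _ => hW s) hv (by
      intro S hS
      obtain ⟨k, hk⟩ := zass_small σ' c' cPcoc hfin' (S : Set G) S.finite_toSet hS
      exact ⟨k, fun j hj g hg w hw => hJ g (hk j hj g hg).1 (hk j hj g hg).2 w hw⟩)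
    exact ⟨v, hv0, hvc, index_of_small σ' hσ' (1/16) (by norm_num) _ hveig⟩

end GK


namespace GK
open scoped commutatorElement Topology

/-- The affine action attached to a linear action and a cocycle. -/
def act {n : ℕ} {G : Type*} [Group G] (L : G →* (V n →L[ℝ] V n)) (b : G → V n) (g : G) (x : V n) :
    V n := L g x + b g

/-- The cocycle condition. -/
def Coc {n : ℕ} {G : Type*} [Group G] (L : G →* (V n →L[ℝ] V n)) (b : G → V n) : Prop :=
  ∀ g h, b (g * h) = L g (b h) + b g

lemma Coc.one {n : ℕ} {G : Type*} [Group G] {L : G →* (V n →L[ℝ] V n)} {b : G → V n}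
    (hb : Coc L b) : b 1 = 0 := by
  have := hb 1 1
  rw [mul_one, one_app] at this
  simpa using this

lemma act_one {n : ℕ} {G : Type*} [Group G] {L : G →* (V n →L[ℝ] V n)} {b : G → V n}
    (hb : Coc L b) (x : V n) : act L b 1 x = x := by
  rw [act, hb.one, one_app, add_zero]

lemma act_mul {n : ℕ} {G : Type*} [Group G] {L : G →* (V n →L[ℝ] V n)} {b : G → V n}
    (hb : Coc L b) (g h : G) (x : V n) : act L b (g * h) x = act L b g (act L b h x) := by
  rw [act, act, act, hb, mul_app, map_add, add_assoc]

lemma act_inv_act {n : ℕ} {G : Type*} [Group G] {L : G →* (V n →L[ℝ] V n)} {b : G → V n}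
    (hb : Coc L b) (g : G) (x : V n) : act L b g⁻¹ (act L b g x) = x := by
  rw [← act_mul hb, inv_mul_cancel, act_one hb]

lemma act_act_inv {n : ℕ} {G : Type*} [Group G] {L : G →* (V n →L[ℝ] V n)} {b : G → V n}
    (hb : Coc L b) (g : G) (x : V n) : act L b g (act L b g⁻¹ x) = x := by
  rw [← act_mul hb, mul_inv_cancel, act_one hb]

lemma act_contDiff {n : ℕ} {G : Type*} [Group G] (L : G →* (V n →L[ℝ] V n)) (b : G → V n) (g : G) :
    ContDiff ℝ 1 (act L b g) := by
  unfold act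
  fun_prop

lemma act_cont {n : ℕ} {G : Type*} [Group G] (L : G →* (V n →L[ℝ] V n)) (b : G → V n) (g : G) :
    Continuous (act L b g) := (act_contDiff L b g).continuous

/-- Equivariant partitions of unity. -/
theorem part {n : ℕ} {G : Type*} [Group G] {L : G →* (V n →L[ℝ] V n)} {b : G → V n}
    (hb : Coc L b) {O : Set (V n)} (hO : IsOpen O) (hinv : ∀ g, ∀ x ∈ O, act L b g x ∈ O)
    (hprop : ∀ K ⊆ O, IsCompact K → {g | ∃ x ∈ K, act L b g x ∈ K}.Finite)
    {K : Set (V n)} (hKO : K ⊆ O) (hK : IsCompact K) :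
    ∃ φ : V n → ℝ, (∀ x, 0 ≤ φ x) ∧ HasCompactSupport φ ∧
      (∀ x ∈ O, ∃ U ∈ 𝓝 x, ∃ F : Finset G, ∀ y ∈ U, ∀ g, g ∉ F → φ (act L b g⁻¹ y) = 0) ∧
      (∀ x ∈ O, (∃ g, act L b g x ∈ K) → ∑ᶠ g, φ (act L b g⁻¹ x) = 1 ∧ ContDiffAt ℝ 1 φ x) := by
  obtain ⟨K', hK', hKK', hK'O⟩ := exists_compact_between hK hO hKO
  obtain ⟨ψ, hψs, hψd, hψr⟩ := (isOpen_interior (s := K')).exists_contDiff_support_eq (n := 1)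
  have ψ0 : ∀ x, 0 ≤ ψ x := fun x => (hψr (Set.mem_range_self x)).1
  have ψpos : ∀ x ∈ K, 0 < ψ x := fun x hx =>
    lt_of_le_of_ne (ψ0 x) (Ne.symm (by
      have : x ∈ Function.support ψ := by rw [hψs]; exact hKK' hx
      exact this))
  have ψz : ∀ x, x ∉ K' → ψ x = 0 := fun x hx => by
    by_contra h
    have : x ∈ Function.support ψ := h
    rw [hψs] at this
    exact hx (interior_subset this)
  have loc : ∀ x ∈ O, ∃ U ∈ 𝓝 x, ∃ F : Finset G, ∀ y ∈ U, ∀ g, g ∉ F → ψ (act L b g⁻¹ y) = 0 := by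
    intro x hx
    obtain ⟨U, hU, hxU, hUO⟩ := exists_compact_subset hO hx
    have hfin := hprop (U ∪ K') (Set.union_subset hUO hK'O) (hU.union hK')
    have hfin2 := hfin.inv
    refine ⟨U, mem_interior_iff_mem_nhds.1 hxU, hfin2.toFinset, fun y hy g hg => ?_⟩
    apply ψz
    intro h
    apply hg
    rw [Set.Finite.mem_toFinset]
    exact ⟨y, Or.inl hy, Or.inr h⟩
  let Ψ : V n → ℝ := fun x => ∑ᶠ g, ψ (act L b g⁻¹ x)
  have Ψinv : ∀ h x, Ψ (act L b h x) = Ψ x := by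
    intro h x
    refine finsum_eq_of_bijective (fun g => h⁻¹ * g) (Group.mulLeft_bijective _) (fun g => ?_)
    rw [mul_inv_rev, inv_inv, act_mul hb g⁻¹ h]
  have Ψsum : ∀ {x : V n} {F : Finset G}, (∀ g, g ∉ F → ψ (act L b g⁻¹ x) = 0) →
      Ψ x = ∑ g ∈ F, ψ (act L b g⁻¹ x) := by
    intro x F h
    refine finsum_eq_sum_of_support_subset _ (fun g hg => ?_)
    by_contra hgF
    exact hg (h g hgF)
  have Ψd : ∀ x ∈ O, ContDiffAt ℝ 1 Ψ x := by
    intro x hx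
    obtain ⟨U, hU, F, hF⟩ := loc x hx
    have : Ψ =ᶠ[𝓝 x] fun y => ∑ g ∈ F, ψ (act L b g⁻¹ y) := by
      filter_upwards [hU] with y hy
      exact Ψsum (hF y hy)
    refine ContDiffAt.congr_of_eventuallyEq ?_ this
    exact ContDiff.contDiffAt (ContDiff.sum fun g _ => hψd.comp (act_contDiff L b _))
  have Ψpos : ∀ x ∈ O, (∃ g, act L b g x ∈ K) → 0 < Ψ x := by
    rintro x hx ⟨g, hg⟩
    rw [← Ψinv g]
    obtain ⟨U, hU, F, hF⟩ := loc _ (hinv g x hx)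
    classical
    rw [Ψsum (F := insert 1 F) (fun h hh => hF _ (mem_of_mem_nhds hU) h
      (fun h' => hh (Finset.mem_insert_of_mem h')))]
    refine Finset.sum_pos' (fun i _ => ψ0 _) ⟨1, Finset.mem_insert_self _ _, ?_⟩
    rw [inv_one, act_one hb]
    exact ψpos _ hg
  refine ⟨fun x => ψ x / Ψ x, fun x => div_nonneg (ψ0 x) (finsum_nonneg fun g => ψ0 _),
    HasCompactSupport.intro hK' (fun x hx => by simp only [ψz x hx, zero_div]), ?_, ?_⟩
  · intro x hx
    obtain ⟨U, hU, F, hF⟩ := loc x hx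
    exact ⟨U, hU, F, fun y hy g hg => by simp only [hF y hy g hg, zero_div]⟩
  · intro x hx hxK
    refine ⟨?_, hψd.contDiffAt.div (Ψd x hx) (Ψpos x hx hxK).ne'⟩
    have : ∀ g, ψ (act L b g⁻¹ x) / Ψ (act L b g⁻¹ x) = ψ (act L b g⁻¹ x) * (Ψ x)⁻¹ := by
      intro g
      rw [Ψinv, div_eq_mul_inv]
    simp only [this]
    rw [← finsum_mul]
    exact mul_inv_cancel₀ (Ψpos x hx hxK).ne'

theorem EQ {n : ℕ} {G : Type*} [Group G] {L : G →* (V n →L[ℝ] V n)} {b c : G → V n}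
    (hb : Coc L b) (hc : Coc L c) {O : Set (V n)} (hO : IsOpen O)
    (hinv : ∀ g, ∀ x ∈ O, act L b g x ∈ O)
    (hprop : ∀ K ⊆ O, IsCompact K → {g | ∃ x ∈ K, act L b g x ∈ K}.Finite)
    {K : Set (V n)} (hKO : K ⊆ O) (hK : IsCompact K) (y0 : V n) :
    ∃ s : V n → V n, ∀ x ∈ O, (∃ g, act L b g x ∈ K) →
      ContDiffAt ℝ 1 s x ∧ (∀ g, s (act L b g x) = act L c g (s x)) ∧
      (∀ C : Set (V n), Convex ℝ C → (∀ g, act L c g y0 ∈ C) → s x ∈ C) := by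
  obtain ⟨φ, φ0, -, loc, φp⟩ := part hb hO hinv hprop hKO hK
  refine ⟨fun x => ∑ᶠ g, φ (act L b g⁻¹ x) • act L c g y0, fun x hx hxK => ⟨?_, ?_, ?_⟩⟩
  · obtain ⟨U, hU, F, hF⟩ := loc x hx
    have : (fun x => ∑ᶠ g, φ (act L b g⁻¹ x) • act L c g y0) =ᶠ[𝓝 x]
        fun y => ∑ g ∈ F, φ (act L b g⁻¹ y) • act L c g y0 := by
      filter_upwards [hU] with y hy
      refine finsum_eq_sum_of_support_subset _ (fun g hg => ?_)
      by_contra hgF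
      exact hg (by simp only [hF y hy g hgF, zero_smul])
    refine ContDiffAt.congr_of_eventuallyEq ?_ this
    refine ContDiffAt.sum fun g _ => ?_
    have h1 : ContDiffAt ℝ 1 φ (act L b g⁻¹ x) := by
      refine (φp _ (hinv _ _ hx) ?_).2
      obtain ⟨h, hh⟩ := hxK
      exact ⟨h * g, by rw [act_mul hb, act_act_inv hb]; exact hh⟩
    have h2 : ContDiffAt ℝ 1 (fun y => φ (act L b g⁻¹ y)) x :=
      h1.comp x (act_contDiff L b g⁻¹).contDiffAt
    exact h2.smul contDiffAt_const
  · intro h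
    obtain ⟨U, hU, F, hF⟩ := loc x hx
    have hF := hF x (mem_of_mem_nhds hU)
    have s1 : (∑ᶠ g, φ (act L b g⁻¹ x) • act L c g y0)
        = ∑ g ∈ F, φ (act L b g⁻¹ x) • act L c g y0 := by
      refine finsum_eq_sum_of_support_subset _ (fun g hg => ?_)
      by_contra hgF
      exact hg (by simp only [hF g hgF, zero_smul])
    have s0 : ∑ g ∈ F, φ (act L b g⁻¹ x) = 1 := by
      rw [← (φp x hx hxK).1]
      refine (finsum_eq_sum_of_support_subset _ (fun g hg => ?_)).symm
      by_contra hgF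
      exact hg (hF g hgF)
    have s2 : (∑ᶠ g, φ (act L b g⁻¹ (act L b h x)) • act L c g y0)
        = ∑ᶠ g, φ (act L b g⁻¹ x) • act L c h (act L c g y0) := by
      refine finsum_eq_of_bijective (fun g => h⁻¹ * g) (Group.mulLeft_bijective _) (fun g => ?_)
      rw [mul_inv_rev, inv_inv, act_mul hb g⁻¹ h, ← act_mul hc, mul_inv_cancel_left]
    have s3 : (∑ᶠ g, φ (act L b g⁻¹ x) • act L c h (act L c g y0))
        = ∑ g ∈ F, φ (act L b g⁻¹ x) • act L c h (act L c g y0) := by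
      refine finsum_eq_sum_of_support_subset _ (fun g hg => ?_)
      by_contra hgF
      exact hg (by simp only [hF g hgF, zero_smul])
    simp only [s2, s3, s1]
    rw [act, map_sum]
    have s4 : ∀ g, φ (act L b g⁻¹ x) • act L c h (act L c g y0)
        = φ (act L b g⁻¹ x) • L h (act L c g y0) + φ (act L b g⁻¹ x) • c h := fun g => by
      rw [← smul_add]; rfl
    simp only [s4]
    rw [Finset.sum_add_distrib, ← Finset.sum_smul, s0, one_smul]
    simp only [map_smul]
  · intro C hC hy
    exact hC.finsum_mem (fun _ => φ0 _) (φp x hx hxK).1 (fun g _ => hy g)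

end GK


namespace GK
open scoped commutatorElement Topology

lemma det_L {n : ℕ} (M : V n →L[ℝ] V n) (h : ∀ x y, B n (M x) (M y) = B n x y) : |M.det| = 1 := by
  let Q : LinearMap.BilinForm ℝ (V n) := B n
  have h1 : Q.comp M.toLinearMap M.toLinearMap = Q := by
    ext x y
    simp [Q, h]
  have hdet : (LinearMap.BilinForm.toMatrix' Q).det ≠ 0 := by
    have hnd : Q.Nondegenerate := by
      refine ⟨fun x hx => B_nondeg hx, fun x hx => B_nondeg fun y => ?_⟩
      rw [B_comm]; exact hx y
    exact (LinearMap.BilinForm.nondegenerate_toMatrix'_iff.2 hnd).det_ne_zero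
  have h2 := congrArg (fun q => (LinearMap.BilinForm.toMatrix' q).det) h1
  simp only [LinearMap.BilinForm.toMatrix'_comp, Matrix.det_mul, Matrix.det_transpose] at h2
  have h3 : (LinearMap.toMatrix' (M : V n →ₗ[ℝ] V n)).det = M.det := by
    rw [LinearMap.det_toMatrix']
  rw [h3] at h2
  have h4 : M.det * M.det = 1 := by
    have : (M.det * M.det - 1) * (LinearMap.BilinForm.toMatrix' Q).det = 0 := by linarith
    rcases mul_eq_zero.1 this with h | h
    · linarith
    · exact absurd h hdet
  rw [← abs_mul_abs_self] at h4
  nlinarith [abs_nonneg M.det]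

lemma lagr (n : ℕ) (t0 : ℝ) (h0 : 0 < t0) : ∃ (t l : Fin (n + 2) → ℝ), (∀ i, 0 < t i ∧ t i < t0) ∧
    ∑ i, l i = 1 ∧ ∀ X : V n →L[ℝ] V n, (1 + X).det = ∑ i, l i * (1 + t i • X).det := by
  let t : Fin (n + 2) → ℝ := fun i => t0 * ((i : ℕ) + 1) / (n + 3)
  have hinj : Function.Injective t := by
    intro i j hij
    simp only [t] at hij
    have hn : (n : ℝ) + 3 ≠ 0 := by positivity
    field_simp at hij
    have : ((i : ℕ) : ℝ) = (j : ℕ) := by linarith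
    exact Fin.ext (by exact_mod_cast this)
  refine ⟨t, fun i => (Lagrange.basis Finset.univ t i).eval 1, fun i => ⟨by positivity, ?_⟩, ?_, ?_⟩
  · simp only [t]
    rw [div_lt_iff₀ (by positivity)]
    have : ((i : ℕ) : ℝ) + 1 ≤ n + 2 := by
      have := i.2
      exact_mod_cast this
    nlinarith
  · rw [← Polynomial.eval_finsetSum, Lagrange.sum_basis hinj.injOn Finset.univ_nonempty,
      Polynomial.eval_one]
  · intro X
    let M := LinearMap.toMatrix' (X : V n →ₗ[ℝ] V n)
    let q : Polynomial ℝ := ((Polynomial.X : Polynomial ℝ) • M.map Polynomial.C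
      + (1 : Matrix (Fin (n+1)) (Fin (n+1)) ℝ).map Polynomial.C).det
    have hq : ∀ s : ℝ, q.eval s = (1 + s • X).det := by
      intro s
      have e1 : q.eval s = (s • M + 1).det := by
        have := RingHom.map_det (Polynomial.evalRingHom s) ((Polynomial.X : Polynomial ℝ) • M.map Polynomial.C
      + (1 : Matrix (Fin (n+1)) (Fin (n+1)) ℝ).map Polynomial.C)
        rw [Polynomial.coe_evalRingHom] at this
        rw [this]
        congr 1
        ext i j
        have e3 : Polynomial.eval s ((1 : Matrix (Fin (n+1)) (Fin (n+1)) (Polynomial ℝ)) i j)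
            = (1 : Matrix (Fin (n+1)) (Fin (n+1)) ℝ) i j := by
          rw [Matrix.one_apply, Matrix.one_apply]
          split_ifs <;> simp
        simp [RingHom.mapMatrix_apply, Matrix.add_apply, Matrix.smul_apply]
        rw [e3, mul_comm]
      rw [e1]
      have e2 : s • M + 1 = LinearMap.toMatrix' ((1 + s • X : V n →L[ℝ] V n) : V n →ₗ[ℝ] V n) := by
        rw [add_comm (s • M) 1]
        simp only [ContinuousLinearMap.toLinearMap_add, ContinuousLinearMap.toLinearMap_smul, map_add, map_smul]
        congr 1
        exact (LinearMap.toMatrix'_one).symm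
      rw [e2, LinearMap.det_toMatrix']
    have hdeg : q.degree < (Finset.univ : Finset (Fin (n+2))).card := by
      have := Polynomial.natDegree_det_X_add_C_le M (1 : Matrix (Fin (n+1)) (Fin (n+1)) ℝ)
      refine lt_of_le_of_lt Polynomial.degree_le_natDegree ?_
      simp only [Finset.card_fin]
      rw [Fintype.card_fin] at this
      exact_mod_cast Nat.lt_succ_of_le this
    have h1 := hq 1
    rw [one_smul] at h1
    rw [← h1]
    conv_lhs => rw [Lagrange.eq_interpolate (v := t) (s := Finset.univ) hinj.injOn hdeg]
    rw [Lagrange.interpolate_apply, Polynomial.eval_finsetSum]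
    refine Finset.sum_congr rfl fun i _ => ?_
    rw [Polynomial.eval_mul, Polynomial.eval_C, hq, mul_comm]

end GK


namespace GK
open scoped commutatorElement Topology

lemma det_near_one {n : ℕ} : ∃ δ > 0, ∀ X : V n →L[ℝ] V n, ‖X‖ < δ → 0 < (1 + X).det := by
  have h1 : Continuous (fun X : V n →L[ℝ] V n => (1 + X).det) :=
    ContinuousLinearMap.continuous_det.comp (continuous_const.add continuous_id)
  have h2 : 0 < (1 + (0 : V n →L[ℝ] V n)).det := by
    rw [add_zero]
    change 0 < LinearMap.det (1 : V n →ₗ[ℝ] V n)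
    rw [map_one]; exact one_pos
  obtain ⟨δ, hδ, h⟩ := Metric.eventually_nhds_iff.1
    (h1.continuousAt.eventually (lt_mem_nhds h2) : ∀ᶠ X in 𝓝 (0 : V n →L[ℝ] V n), 0 < (1 + X).det)
  exact ⟨δ, hδ, fun X hX => h (by rwa [dist_zero_right])⟩

lemma contr_solve {n : ℕ} {u : V n → V n} {t R : ℝ} (hR : 0 ≤ R) (ht : 0 < t) (hu : Continuous u)
    {Λ : ℝ} (hΛ : ∀ x y, ‖x‖ ≤ 2 * R + 2 → ‖y‖ ≤ 2 * R + 2 → ‖u x - u y‖ ≤ Λ * ‖x - y‖)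
    (h1 : t * Λ ≤ 1 / 4) (h2 : t * ‖u 0‖ ≤ 1 / 4) (y : V n) (hy : ‖y‖ ≤ R) :
    ∃ x, x + t • u x = y := by
  let f : V n → V n := fun x => y - t • u x
  have hub : ∀ x, ‖x‖ ≤ 2 * R + 2 → t * ‖u x‖ ≤ 1 / 4 + 1 / 4 * ‖x‖ := by
    intro x hx
    have h3 := hΛ x 0 hx (by rw [norm_zero]; linarith)
    rw [sub_zero] at h3
    have h4 : ‖u x‖ ≤ ‖u x - u 0‖ + ‖u 0‖ := by
      have := norm_add_le (u x - u 0) (u 0)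
      rwa [sub_add_cancel] at this
    nlinarith [norm_nonneg x, mul_le_mul_of_nonneg_left (h4.trans (add_le_add_left h3 _)) ht.le]
  have hmaps : Set.MapsTo f (Metric.closedBall 0 (2 * R + 2)) (Metric.closedBall 0 (2 * R + 2)) := by
    intro x hx
    rw [mem_closedBall_zero_iff] at hx ⊢
    have h3 := norm_sub_le y (t • u x)
    rw [norm_smul, Real.norm_of_nonneg ht.le] at h3
    have := hub x hx
    exact h3.trans (by linarith)
  have hcon : ContractingWith (1 / 4) (hmaps.restrict f _ _) := by
    refine ⟨?_, LipschitzWith.of_dist_le_mul fun x z => ?_⟩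
    · rw [← NNReal.coe_lt_coe]; norm_num
    · rw [Subtype.dist_eq, Subtype.dist_eq, dist_eq_norm, dist_eq_norm]
      change ‖(y - t • u x) - (y - t • u z)‖ ≤ _
      rw [sub_sub_sub_cancel_left, ← smul_sub, norm_smul, Real.norm_of_nonneg ht.le, norm_sub_rev]
      have h3 := hΛ x z (mem_closedBall_zero_iff.1 x.2) (mem_closedBall_zero_iff.1 z.2)
      have : ((1 / 4 : NNReal) : ℝ) = 1 / 4 := by norm_num
      rw [this]
      calc t * ‖u x - u z‖ ≤ t * (Λ * ‖(x : V n) - z‖) := by gcongr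
        _ = t * Λ * ‖(x : V n) - z‖ := by ring
        _ ≤ _ := by gcongr
  obtain ⟨x, _, hx, _⟩ := ContractingWith.exists_fixedPoint' Metric.isClosed_closedBall.isComplete
    hmaps hcon (x := 0) (by rw [mem_closedBall_zero_iff, norm_zero]; linarith) (edist_ne_top _ _)
  refine ⟨x, ?_⟩
  have : y - t • u x = x := hx
  exact (sub_eq_iff_eq_add.1 this).symm

lemma smallF {n : ℕ} {G : Type*} [Group G] {L : G →* (V n →L[ℝ] V n)} {b : G → V n}
    (A : Aff L b) (u : V n → V n) (hu : ContDiff ℝ 1 u)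
    (heq : ∀ g x, u (act L b g x) = L g (u x)) :
    ∃ t0 > (0 : ℝ), ∀ t : ℝ, 0 < t → t < t0 → Function.Bijective (fun x => x + t • u x) ∧
      ∀ x, 0 < (1 + t • fderiv ℝ u x).det := by
  have hb : Coc L b := A.coc
  obtain ⟨R', hR'⟩ := A.cocpt
  obtain ⟨R, hR0, hR⟩ : ∃ R : ℝ, 0 ≤ R ∧ ∀ x, ∃ g, ‖act L b g x‖ ≤ R :=
    ⟨max R' 0, le_max_right _ _, fun x => (hR' x).imp fun g hg => le_max_of_le_left hg⟩
  obtain ⟨M, hM⟩ := (isCompact_closedBall (0 : V n) R).exists_bound_of_continuousOn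
    hu.continuous.continuousOn
  have hS := A.proper (R + M)
  let R2 : ℝ := 2 * R + 2 + ∑ g ∈ hS.toFinset, (‖L g‖ * R + ‖b g‖)
  have hR2 : 2 * R + 2 ≤ R2 := by
    have : 0 ≤ ∑ g ∈ hS.toFinset, (‖L g‖ * R + ‖b g‖) := Finset.sum_nonneg fun g _ => by positivity
    linarith
  have hR2' : ∀ g ∈ hS.toFinset, ∀ x, ‖x‖ ≤ R → ‖act L b g x‖ ≤ R2 := by
    intro g hg x hx
    have h1 : ‖L g‖ * R + ‖b g‖ ≤ ∑ g ∈ hS.toFinset, (‖L g‖ * R + ‖b g‖) :=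
      Finset.single_le_sum (f := fun g => ‖L g‖ * R + ‖b g‖) (fun g _ => by positivity) hg
    have h2 : ‖act L b g x‖ ≤ ‖L g‖ * R + ‖b g‖ := by
      refine (norm_add_le _ _).trans (add_le_add_left ?_ _)
      exact ((L g).le_opNorm x).trans (by gcongr)
    linarith
  obtain ⟨Λ, hΛ⟩ := (isCompact_closedBall (0 : V n) R2).exists_bound_of_continuousOn
    (hu.continuous_fderiv one_ne_zero).continuousOn
  have hΛ0 : 0 ≤ Λ := (norm_nonneg _).trans (hΛ 0 (by
    rw [mem_closedBall_zero_iff, norm_zero]; linarith))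
  have hlip : ∀ x y, ‖x‖ ≤ R2 → ‖y‖ ≤ R2 → ‖u x - u y‖ ≤ Λ * ‖x - y‖ := by
    intro x y hx hy
    exact (convex_closedBall (0 : V n) R2).norm_image_sub_le_of_norm_fderiv_le
      (fun z _ => hu.differentiable one_ne_zero z) (fun z hz => hΛ z hz)
      (by rwa [mem_closedBall_zero_iff]) (by rwa [mem_closedBall_zero_iff])
  obtain ⟨δ, hδ, hdet⟩ := det_near_one (n := n)
  let Q : ℝ := Λ + ‖u 0‖ + 1
  have hQ : 0 < Q := by positivity
  refine ⟨min 1 (min 1 δ / (4 * Q)), by positivity, fun t ht htt => ?_⟩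
  have ht1 : t < 1 := lt_of_lt_of_le htt (min_le_left _ _)
  have htQ : t * (4 * Q) < min 1 δ := by
    have := lt_of_lt_of_le htt (min_le_right _ _)
    rwa [lt_div_iff₀ (by positivity)] at this
  have htQ1 : t * (4 * Q) < 1 := lt_of_lt_of_le htQ (min_le_left _ _)
  have htQ2 : t * (4 * Q) < δ := lt_of_lt_of_le htQ (min_le_right _ _)
  have htΛ : t * Λ ≤ t * Q := by
    refine mul_le_mul_of_nonneg_left ?_ ht.le
    simp only [Q]; linarith [norm_nonneg (u 0)]
  have htu : t * ‖u 0‖ ≤ t * Q := by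
    refine mul_le_mul_of_nonneg_left ?_ ht.le
    simp only [Q]; linarith
  have hFeq : ∀ g x, act L b g x + t • u (act L b g x) = act L b g (x + t • u x) := by
    intro g x
    rw [heq]
    simp only [act, map_add, map_smul]
    abel
  have hFn : ∀ x, ‖x‖ ≤ R → ‖x + t • u x‖ ≤ R + M := by
    intro x hx
    refine (norm_add_le _ _).trans (add_le_add hx ?_)
    rw [norm_smul, Real.norm_of_nonneg ht.le]
    have := hM x (by rwa [mem_closedBall_zero_iff])
    nlinarith [norm_nonneg (u x)]
  refine ⟨⟨?_, ?_⟩, ?_⟩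
  · have key : ∀ x y, ‖x‖ ≤ R → x + t • u x = y + t • u y → x = y := by
      intro x y hx hxy
      obtain ⟨h, hh⟩ := hR y
      have hy2 : ‖y‖ ≤ R2 := by
        have hmem : h⁻¹ ∈ hS.toFinset := by
          rw [Set.Finite.mem_toFinset]
          refine ⟨act L b h y + t • u (act L b h y), hFn _ hh, ?_⟩
          change ‖act L b h⁻¹ _‖ ≤ _
          rw [hFeq, act_inv_act hb, ← hxy]
          exact hFn x hx
        have := hR2' _ hmem _ hh
        rwa [act_inv_act hb] at this
      have hl := hlip x y (by linarith) hy2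
      have e : x - y = t • (u y - u x) := by
        rw [smul_sub, sub_eq_sub_iff_add_eq_add, hxy, add_comm]
      have e2 : ‖x - y‖ = t * ‖u x - u y‖ := by
        rw [e, norm_smul, Real.norm_of_nonneg ht.le, norm_sub_rev]
      have : ‖x - y‖ ≤ t * Λ * ‖x - y‖ := by
        nlinarith
      have : ‖x - y‖ = 0 := by nlinarith [norm_nonneg (x - y)]
      exact sub_eq_zero.1 (norm_eq_zero.1 this)
    intro x y hxy
    obtain ⟨g, hg⟩ := hR x
    have := key (act L b g x) (act L b g y) hg (by
      rw [hFeq, hFeq]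
      exact congrArg _ hxy)
    have := congrArg (act L b g⁻¹) this
    rwa [act_inv_act hb, act_inv_act hb] at this
  · intro y
    obtain ⟨g, hg⟩ := hR y
    obtain ⟨x, hx⟩ := contr_solve hR0 ht hu.continuous (Λ := Λ)
      (fun x y hx hy => hlip x y (hx.trans hR2) (hy.trans hR2)) (by linarith) (by linarith) _ hg
    refine ⟨act L b g⁻¹ x, ?_⟩
    change act L b g⁻¹ x + t • u (act L b g⁻¹ x) = y
    rw [hFeq, hx, act_inv_act hb]
  · intro x
    obtain ⟨g, hg⟩ := hR x
    have hd : ∀ y, fderiv ℝ u (act L b g y) * L g = L g * fderiv ℝ u y := by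
      intro y
      have h1 : HasFDerivAt (fun y => u (act L b g y)) ((fderiv ℝ u (act L b g y)).comp (L g)) y := by
        have h2 : HasFDerivAt (act L b g) (L g) y := (L g).hasFDerivAt.add_const _
        exact (hu.differentiable one_ne_zero _).hasFDerivAt.comp y h2
      have h3 : HasFDerivAt (fun y => L g (u y)) ((L g).comp (fderiv ℝ u y)) y :=
        (L g).hasFDerivAt.comp y (hu.differentiable one_ne_zero _).hasFDerivAt
      have h4 : (fun y => u (act L b g y)) = fun y => L g (u y) := funext fun y => heq g y
      rw [h4] at h1
      exact h1.unique h3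
    have hd2 : (1 + t • fderiv ℝ u (act L b g x)) * L g = L g * (1 + t • fderiv ℝ u x) := by
      rw [add_mul, mul_add, one_mul, mul_one, smul_mul_assoc, hd, mul_smul_comm]
    have hd3 : (1 + t • fderiv ℝ u (act L b g x)).det * (L g).det
        = (L g).det * (1 + t • fderiv ℝ u x).det := by
      have := congrArg (fun X : V n →L[ℝ] V n => LinearMap.det (X : V n →ₗ[ℝ] V n)) hd2
      simp only [ContinuousLinearMap.toLinearMap_mul, map_mul] at this
      exact this
    have hL : (L g).det ≠ 0 := by
      intro h
      have := det_L (L g) (A.fwd.hB g)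
      rw [h, abs_zero] at this
      exact zero_ne_one this
    have : (1 + t • fderiv ℝ u x).det = (1 + t • fderiv ℝ u (act L b g x)).det := by
      apply mul_left_cancel₀ hL
      rw [← hd3, mul_comm]
    rw [this]
    apply hdet
    rw [norm_smul, Real.norm_of_nonneg ht.le]
    have := hΛ (act L b g x) (by rw [mem_closedBall_zero_iff]; linarith)
    have : t * ‖fderiv ℝ u (act L b g x)‖ ≤ t * Λ := by gcongr
    have : 0 < t * Q := by positivity
    linarith

end GK


namespace GK
open scoped commutatorElement Topology ENNReal
open MeasureTheory

lemma Aff.countable {n : ℕ} {G : Type*} [Group G] {L : G →* (V n →L[ℝ] V n)} {b : G → V n}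
    (A : Aff L b) : Countable G := by
  rw [← Set.countable_univ_iff]
  have : (Set.univ : Set G) = ⋃ k : ℕ, {g | ‖b g‖ ≤ k} := by
    ext g
    simp only [Set.mem_univ, Set.mem_iUnion, true_iff]
    exact exists_nat_ge ‖b g‖
  rw [this]
  exact Set.countable_iUnion fun k => (A.fin k).countable

lemma cov {n : ℕ} (f : V n → V n) (f' : V n → V n →L[ℝ] V n) (hf : ∀ x, HasFDerivAt f (f' x) x)
    (hbij : Function.Bijective f) (g : V n → ℝ≥0∞) :
    ∫⁻ x, g x = ∫⁻ x, ENNReal.ofReal |(f' x).det| * g (f x) := by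
  have := lintegral_image_eq_lintegral_abs_det_fderiv_mul (volume : Measure (V n))
    (MeasurableSet.univ) (fun x _ => (hf x).hasFDerivWithinAt) (hbij.1.injOn) g
  rw [Set.image_univ, hbij.2.range_eq, Measure.restrict_univ] at this
  exact this

lemma intF {n : ℕ} {G : Type*} [Group G] {L : G →* (V n →L[ℝ] V n)} {b : G → V n}
    (A : Aff L b) (p : V n → ℝ≥0∞) (hp : Measurable p) (hsum : ∀ x, ∑' g, p (act L b g⁻¹ x) = 1)
    (F : V n → V n) (F' : V n → V n →L[ℝ] V n) (hF : ∀ x, HasFDerivAt F (F' x) x)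
    (hF' : Continuous F') (hbij : Function.Bijective F)
    (heq : ∀ g x, F (act L b g x) = act L b g (F x)) :
    ∫⁻ x, ENNReal.ofReal |(F' x).det| * p x = ∫⁻ x, p x := by
  have hb : Coc L b := A.coc
  have := A.countable
  let J : V n → ℝ≥0∞ := fun x => ENNReal.ofReal |(F' x).det|
  have hJ : Measurable J :=
    ((ContinuousLinearMap.continuous_det.comp hF').abs.measurable).ennreal_ofReal
  have hFm : Measurable F :=
    (continuous_iff_continuousAt.2 fun x => (hF x).continuousAt).measurable
  have ham : ∀ g, Measurable (act L b g) := fun g => (act_cont L b g).measurable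
  have hact : ∀ g x, HasFDerivAt (act L b g) (L g) x := fun g x => (L g).hasFDerivAt.add_const _
  have hJinv : ∀ g x, J (act L b g x) = J x := by
    intro g x
    have h1 : HasFDerivAt (fun y => F (act L b g y)) ((F' (act L b g x)).comp (L g)) x :=
      (hF _).comp x (hact g x)
    have h3 : HasFDerivAt (fun y => act L b g (F y)) ((L g).comp (F' x)) x :=
      (hact g _).comp x (hF x)
    have h4 : (fun y => F (act L b g y)) = fun y => act L b g (F y) := funext fun y => heq g y
    rw [h4] at h1
    have h5 : F' (act L b g x) * L g = L g * F' x := h1.unique h3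
    have h6 : (F' (act L b g x)).det * (L g).det = (L g).det * (F' x).det := by
      have := congrArg (fun X : V n →L[ℝ] V n => LinearMap.det (X : V n →ₗ[ℝ] V n)) h5
      simp only [ContinuousLinearMap.toLinearMap_mul, map_mul] at this
      exact this
    have h7 := congrArg abs h6
    rw [abs_mul, abs_mul, det_L (L g) (A.fwd.hB g), mul_one, one_mul] at h7
    simp only [J, h7]
  have habij : ∀ g, Function.Bijective (act L b g) := fun g =>
    Function.bijective_iff_has_inverse.2 ⟨act L b g⁻¹, act_inv_act hb g, act_act_inv hb g⟩
  calc ∫⁻ x, J x * p x = ∫⁻ x, ∑' g, J x * p x * p (act L b g⁻¹ (F x)) := by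
        refine lintegral_congr fun x => ?_
        rw [ENNReal.tsum_mul_left, hsum, mul_one]
    _ = ∑' g, ∫⁻ x, J x * p x * p (act L b g⁻¹ (F x)) := by
        refine lintegral_tsum fun g => ?_
        exact ((hJ.mul hp).mul (hp.comp ((ham _).comp hFm))).aemeasurable
    _ = ∑' g, ∫⁻ x, J x * p (F x) * p (act L b g x) := by
        refine tsum_congr fun g => ?_
        rw [cov (act L b g) (fun _ => L g) (hact g) (habij g)]
        refine lintegral_congr fun x => ?_
        rw [det_L (L g) (A.fwd.hB g), ENNReal.ofReal_one, one_mul, hJinv, heq, act_inv_act hb]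
        ring
    _ = ∑' g, ∫⁻ x, J x * p (F x) * p (act L b g⁻¹ x) :=
        ((Equiv.inv G).tsum_eq (fun g => ∫⁻ x, J x * p (F x) * p (act L b g x))).symm
    _ = ∫⁻ x, ∑' g, J x * p (F x) * p (act L b g⁻¹ x) := by
        refine (lintegral_tsum fun g => ?_).symm
        exact ((hJ.mul (hp.comp hFm)).mul (hp.comp (ham _))).aemeasurable
    _ = ∫⁻ x, J x * p (F x) := by
        refine lintegral_congr fun x => ?_
        rw [ENNReal.tsum_mul_left, hsum, mul_one]
    _ = ∫⁻ x, p x := (cov F F' hF hbij p).symm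

theorem toolA {n : ℕ} {G : Type*} [Group G] {L : G →* (V n →L[ℝ] V n)} {b : G → V n}
    (A : Aff L b) (r : V n → V n) (hr : ContDiff ℝ 1 r)
    (heq : ∀ g x, r (act L b g x) = act L b g (r x)) (hdet : ∀ x, (fderiv ℝ r x).det = 0) :
    False := by
  have hb : Coc L b := A.coc
  obtain ⟨R, hR⟩ := A.cocpt
  have hprop : ∀ K ⊆ (Set.univ : Set (V n)), IsCompact K →
      {g | ∃ x ∈ K, act L b g x ∈ K}.Finite := by
    intro K _ hK
    obtain ⟨C, hC⟩ := hK.isBounded.exists_norm_le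
    exact (A.proper C).subset fun g ⟨x, hx, hgx⟩ => ⟨x, hC x hx, hC _ hgx⟩
  obtain ⟨φ, φ0, φc, φl, φp⟩ := part hb isOpen_univ (fun _ _ _ => Set.mem_univ _) hprop
    (Set.subset_univ _) (isCompact_closedBall (0 : V n) R)
  have hK : ∀ x, ∃ g, act L b g x ∈ Metric.closedBall (0 : V n) R := fun x =>
    (hR x).imp fun g hg => by rw [mem_closedBall_zero_iff]; exact hg
  have φcont : Continuous φ := continuous_iff_continuousAt.2 fun x =>
    (φp x (Set.mem_univ _) (hK x)).2.continuousAt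
  let p : V n → ℝ≥0∞ := fun x => ENNReal.ofReal (φ x)
  have hsum : ∀ x, ∑' g, p (act L b g⁻¹ x) = 1 := by
    intro x
    obtain ⟨U, hU, S, hS⟩ := φl x (Set.mem_univ _)
    have hS := hS x (mem_of_mem_nhds hU)
    rw [tsum_eq_sum (s := S) (fun g hg => by simp only [p, hS g hg, ENNReal.ofReal_zero])]
    rw [← ENNReal.ofReal_sum_of_nonneg (fun _ _ => φ0 _)]
    rw [← finsum_eq_sum_of_support_subset, (φp x (Set.mem_univ _) (hK x)).1, ENNReal.ofReal_one]
    intro g hg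
    by_contra hgS
    exact hg (hS g hgS)
  let u : V n → V n := fun x => r x - x
  have hu : ContDiff ℝ 1 u := hr.sub contDiff_id
  have hueq : ∀ g x, u (act L b g x) = L g (u x) := by
    intro g x
    simp only [u, heq]
    simp only [act, map_sub]
    abel
  obtain ⟨t0, ht0, hsm⟩ := smallF A u hu hueq
  obtain ⟨t, l, ht, hl, hX⟩ := lagr n t0 ht0
  have hdu : Continuous (fderiv ℝ u) := hu.continuous_fderiv one_ne_zero
  have hdF : ∀ s : ℝ, Continuous fun x => (1 + s • fderiv ℝ u x).det := fun s =>
    ContinuousLinearMap.continuous_det.comp (continuous_const.add (hdu.const_smul s))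
  have key : ∀ i, ∫ x, (1 + t i • fderiv ℝ u x).det * φ x = ∫ x, φ x := by
    intro i
    obtain ⟨hbij, hpos⟩ := hsm (t i) (ht i).1 (ht i).2
    have h1 := intF A p φcont.measurable.ennreal_ofReal hsum (fun x => x + t i • u x)
      (fun x => 1 + t i • fderiv ℝ u x) (fun x => by
        exact (hasFDerivAt_id x).add
          ((hu.differentiable one_ne_zero x).hasFDerivAt.const_smul (t i)))
      (continuous_const.add (hdu.const_smul (t i))) hbij (fun g x => by
        simp only [hueq]
        simp only [act, map_add, map_smul]
        abel)
    rw [integral_eq_lintegral_of_nonneg_ae, integral_eq_lintegral_of_nonneg_ae, ← h1]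
    · congr 1
      refine lintegral_congr fun x => ?_
      rw [ENNReal.ofReal_mul (hpos x).le, abs_of_pos (hpos x)]
    · exact Filter.Eventually.of_forall φ0
    · exact φcont.aestronglyMeasurable
    · exact Filter.Eventually.of_forall fun x => mul_nonneg (hpos x).le (φ0 x)
    · exact ((hdF _).mul φcont).aestronglyMeasurable
  have hIntg : ∀ i, Integrable fun x => l i * ((1 + t i • fderiv ℝ u x).det * φ x) := fun i =>
    (((hdF _).mul φcont).integrable_of_hasCompactSupport φc.mul_left).const_mul _
  have hzero : ∫ x, φ x = 0 := by
    have h1 : ∀ x, ∑ i, l i * ((1 + t i • fderiv ℝ u x).det * φ x) = 0 := by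
      intro x
      have h2 := hX (fderiv ℝ u x)
      have h3 : 1 + fderiv ℝ u x = fderiv ℝ r x := by
        have : fderiv ℝ u x = fderiv ℝ r x - 1 := by
          have := ((hr.differentiable one_ne_zero x).hasFDerivAt.sub (hasFDerivAt_id x)).fderiv
          exact this
        rw [this]; abel
      rw [h3, hdet] at h2
      have : ∑ i, l i * ((1 + t i • fderiv ℝ u x).det * φ x)
          = (∑ i, l i * (1 + t i • fderiv ℝ u x).det) * φ x := by
        rw [Finset.sum_mul]
        exact Finset.sum_congr rfl fun i _ => by ring
      rw [this, ← h2, zero_mul]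
    have h4 := integral_finsetSum (μ := (volume : Measure (V n))) Finset.univ (fun i _ => hIntg i)
    simp only [h1, integral_const_mul, key, integral_zero] at h4
    rw [← Finset.sum_mul, hl, one_mul] at h4
    exact h4.symm
  have hφ0 : ∃ x, φ x ≠ 0 := by
    by_contra hc
    push Not at hc
    have := (φp 0 (Set.mem_univ _) (hK 0)).1
    simp [hc] at this
  obtain ⟨x, hx⟩ := hφ0
  have := φcont.integral_pos_of_hasCompactSupport_nonneg_nonzero (μ := volume) φc φ0 hx
  linarith

end GK


namespace GK
open scoped commutatorElement Topology

lemma exists_W {n : ℕ} {G : Type*} [Group G] {L : G →* (V n →L[ℝ] V n)} (F : Fwd L)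
    (hE : ¬ Elem L) : ∃ W : Submodule ℝ (V n), (∀ g, ∀ w ∈ W, L g w ∈ W) ∧ (∃ v ∈ W, v ∈ tl n) ∧
      ∀ S ≤ W, (∀ g, ∀ w ∈ S, L g w ∈ S) → S = ⊥ ∨ S = W := by
  classical
  let Pr : Submodule ℝ (V n) → Prop := fun W => (∀ g, ∀ w ∈ W, L g w ∈ W) ∧ (∃ v ∈ W, v ∈ tl n)
  have hex : ∃ d, ∃ W, Pr W ∧ Module.finrank ℝ W = d :=
    ⟨_, ⊤, ⟨fun _ _ _ => Submodule.mem_top, (exists_tl n).imp fun v hv => ⟨Submodule.mem_top, hv⟩⟩, rfl⟩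
  obtain ⟨W, hW, hd⟩ := Nat.find_spec hex
  have hmin : ∀ S, Pr S → S ≤ W → S = W := by
    intro S hS hle
    refine Submodule.eq_of_le_of_finrank_le hle ?_
    rw [hd]
    exact Nat.find_min' hex ⟨S, hS, rfl⟩
  refine ⟨W, hW.1, hW.2, fun S hS hinv => ?_⟩
  by_cases h1 : ∃ x ∈ S, B n x x < 0
  · right
    obtain ⟨x, hx, hxx⟩ := h1
    refine hmin S ⟨hinv, ?_⟩ hS
    rcases tl_of_B hxx with h | h
    · exact ⟨x, hx, h⟩
    · exact ⟨-x, S.neg_mem hx, h⟩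
  push Not at h1
  by_cases h2 : ∃ x ∈ S, x ≠ 0 ∧ B n x x = 0
  · exfalso
    apply hE
    have hpar : ∀ x ∈ S, B n x x = 0 → ∀ y ∈ S, B n x y = 0 := by
      intro x hx hxx y hy
      have h3 : ∀ t : ℝ, 0 ≤ B n y y + 2 * t * B n x y := by
        intro t
        have := h1 (y + t • x) (S.add_mem hy (S.smul_mem _ hx))
        simp only [map_add, map_smul, LinearMap.add_apply, LinearMap.smul_apply, smul_eq_mul, hxx,
          B_comm y x] at this
        linarith
      by_contra hne
      have h4 := h3 (-(B n y y + 1) / (2 * B n x y))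
      have : 2 * (-(B n y y + 1) / (2 * B n x y)) * B n x y = -(B n y y + 1) := by
        field_simp
      linarith
    obtain ⟨x, hx, hx0, hxx⟩ : ∃ x ∈ S, x ≠ 0 ∧ x ∈ cone n := by
      obtain ⟨x, hx, hx0, hxx⟩ := h2
      rcases le_total 0 (T n x) with h | h
      · exact ⟨x, hx, hx0, hxx.le, h⟩
      · exact ⟨-x, S.neg_mem hx, neg_ne_zero.2 hx0, by simp [hxx], by simpa using h⟩
    refine ⟨x, hx0, hxx, ?_⟩
    have hxx0 : B n x x = 0 := le_antisymm hxx.1 (h1 x hx)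
    have : stab L x hx0 = ⊤ := by
      rw [eq_top_iff]
      intro g _
      have h3 := F5 hxx.1 (F.hC g x hxx).1 (hpar x hx hxx0 _ (hinv g x hx))
      have hT : T n x ≠ 0 := (T_pos hxx hx0).ne'
      refine ⟨T n (L g x) / T n x, ?_⟩
      rw [div_eq_inv_mul, mul_smul, h3, smul_smul, inv_mul_cancel₀ hT, one_smul]
    rw [this, Subgroup.index_top]
    exact one_ne_zero
  push Not at h2
  have hpos : ∀ x ∈ S, x ≠ 0 → 0 < B n x x := fun x hx h0 =>
    lt_of_le_of_ne (h1 x hx) (Ne.symm (h2 x hx h0))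
  left
  obtain ⟨D⟩ := exists_PDat S hpos
  obtain ⟨v, hv, hvt⟩ := hW.2
  have hW' : Pr (W ⊓ orth S) := by
    refine ⟨fun g w hw => ⟨hW.1 g w hw.1, orth_inv L F.hB hinv g w hw.2⟩, ?_⟩
    have hw : v - D.j (D.p v) ∈ W ⊓ orth S := ⟨W.sub_mem hv (hS (D.jmem _)), D.perp v⟩
    have hneg : B n (v - D.j (D.p v)) (v - D.j (D.p v)) < 0 := by
      have e1 : B n (v - D.j (D.p v)) (v - D.j (D.p v)) = B n (v - D.j (D.p v)) v := by
        rw [map_sub (B n (v - D.j (D.p v))), D.perp v _ (D.jmem _), sub_zero]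
      have e2 : B n (D.j (D.p v)) v = ‖D.p v‖ ^ 2 := by
        rw [B_comm, D.inn, real_inner_self_eq_norm_sq]
      rw [e1, Bsl, e2]
      have := hvt.1
      nlinarith [sq_nonneg ‖D.p v‖]
    rcases tl_of_B hneg with h | h
    · exact ⟨_, hw, h⟩
    · exact ⟨_, Submodule.neg_mem _ hw, h⟩
  have h3 := hmin _ hW' inf_le_left
  rw [eq_bot_iff]
  intro x hx
  have h4 : x ∈ W ⊓ orth S := by rw [h3]; exact hS hx
  have h5 := h4.2 x hx
  by_contra h6
  exact absurd h5 (hpos x hx (by simpa using h6)).ne'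

/-- Elements moving a compact set of timelike vectors to itself are bounded. -/
lemma bound_L {n : ℕ} {G : Type*} [Group G] {L : G →* (V n →L[ℝ] V n)} (F : Fwd L)
    {K : Set (V n)} (hK : IsCompact K) (hKt : K ⊆ tl n) :
    ∃ C, ∀ g, (∃ w ∈ K, L g w ∈ K) → ‖L g‖ ≤ C := by
  have hS : IsCompact (cone n ∩ Metric.sphere 0 1) :=
    (isCompact_sphere (0 : V n) 1).inter_left (cone_closed n)
  obtain ⟨m, hm, hm'⟩ : ∃ m : ℝ, 0 < m ∧ ∀ w ∈ K, ∀ x ∈ cone n, m * ‖x‖ ≤ - B n w x := by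
    have hc : IsCompact (K ×ˢ (cone n ∩ Metric.sphere 0 1)) := hK.prod hS
    have hcont : Continuous fun q : V n × V n => - B n q.1 q.2 :=
      (B_cont' continuous_fst continuous_snd).neg
    have hp : ∀ q ∈ K ×ˢ (cone n ∩ Metric.sphere 0 1), 0 < - B n q.1 q.2 := by
      rintro ⟨w, x⟩ ⟨hw, hx, hx1⟩
      have : x ≠ 0 := by
        rintro rfl
        simp at hx1
      have := tl_B (hKt hw) hx this
      simpa using this
    obtain ⟨m, hm, hm'⟩ := hc.exists_forall_le' hcont.continuousOn hp
    refine ⟨m, hm, fun w hw x hx => ?_⟩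
    by_cases h0 : x = 0
    · simp [h0]
    have hn : 0 < ‖x‖ := norm_pos_iff.2 h0
    have h1 := hm' (w, ‖x‖⁻¹ • x) ⟨hw, cone_smul hx (by positivity), by
      rw [mem_sphere_zero_iff_norm, norm_smul, norm_inv, norm_norm, inv_mul_cancel₀ hn.ne']⟩
    simp only [map_smul, smul_eq_mul] at h1
    have h2 := mul_le_mul_of_nonneg_right h1 hn.le
    have h3 : -(‖x‖⁻¹ * B n w x) * ‖x‖ = - B n w x := by field_simp
    linarith
  obtain ⟨e, he⟩ := exists_tl n
  obtain ⟨δ, hδ, hball⟩ := Metric.isOpen_iff.1 (tl_open n) e he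
  obtain ⟨M, hM⟩ : ∃ M, ∀ q ∈ K ×ˢ Metric.closedBall (0 : V n) (‖e‖ + δ), ‖B n q.1 q.2‖ ≤ M :=
    (hK.prod (isCompact_closedBall _ _)).exists_bound_of_continuousOn
      (B_cont' continuous_fst continuous_snd).continuousOn
  have hM2 : ∀ g, (∃ w ∈ K, L g w ∈ K) → ∀ x ∈ cone n, ‖x‖ ≤ ‖e‖ + δ → ‖L g x‖ ≤ M / m := by
    rintro g ⟨w, hw, hgw⟩ x hx hxn
    rw [le_div_iff₀ hm]
    have h1 := hm' _ hgw _ (F.hC g x hx)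
    rw [F.hB] at h1
    have h2 := hM (w, x) ⟨hw, by rwa [mem_closedBall_zero_iff]⟩
    have h3 : - B n w x ≤ ‖B n w x‖ := by rw [Real.norm_eq_abs]; exact neg_le_abs _
    linarith
  refine ⟨2 / δ * (2 * (max M 0 / m)), fun g hg => ?_⟩
  refine ContinuousLinearMap.opNorm_le_bound _ (by positivity) fun y => ?_
  by_cases h0 : y = 0
  · simp [h0]
  have hn : 0 < ‖y‖ := norm_pos_iff.2 h0
  let z : V n := e + (δ / (2 * ‖y‖)) • y
  have hz1 : ‖(δ / (2 * ‖y‖)) • y‖ = δ / 2 := by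
    rw [norm_smul, Real.norm_of_nonneg (by positivity)]
    field_simp
  have hz : z ∈ tl n := by
    apply hball
    rw [mem_ball_iff_norm, add_sub_cancel_left, hz1]
    linarith
  have hzn : ‖z‖ ≤ ‖e‖ + δ := (norm_add_le _ _).trans (by rw [hz1]; linarith)
  have hy : y = (2 * ‖y‖ / δ) • (z - e) := by
    rw [add_sub_cancel_left, smul_smul]
    have : 2 * ‖y‖ / δ * (δ / (2 * ‖y‖)) = 1 := by field_simp
    rw [this, one_smul]
  have b1 := hM2 g hg z (tl_cone hz) hzn
  have b2 := hM2 g hg e (tl_cone he) (by linarith)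
  have b3 : M / m ≤ max M 0 / m := by gcongr; exact le_max_left _ _
  calc ‖L g y‖ = 2 * ‖y‖ / δ * ‖L g z - L g e‖ := by
        conv_lhs => rw [hy]
        rw [map_smul, map_sub, norm_smul, Real.norm_of_nonneg (by positivity)]
    _ ≤ 2 * ‖y‖ / δ * (2 * (max M 0 / m)) := by
        gcongr
        refine (norm_sub_le _ _).trans (by linarith)
    _ = _ := by ring

/-- Properness of the modified action. -/
lemma proper_beta {n : ℕ} {G : Type*} [Group G] {L : G →* (V n →L[ℝ] V n)} {b : G → V n}
    (A : Aff L b) {W : Submodule ℝ (V n)} (hW : ∀ g, ∀ w ∈ W, L g w ∈ W) (D : PDat (orth W))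
    {c : G → V n} (hcc : Coc L c) (hc : ∀ g, c g = b g - D.pw (b g)) (hpc : ∀ g, D.pw (c g) = 0)
    {ε : ℝ} (hε : 0 < ε) (hsm : ∀ g, ‖L g - 1‖ < ε → ∀ w ∈ W, L g w = w)
    (hK0 : ∀ κ, (∀ w ∈ W, L κ w = w) → D.pw (b κ) = 0) {K : Set (V n)} (hK : IsCompact K)
    (hKO : ∀ x ∈ K, D.pw x ∈ tl n) : {g | ∃ x ∈ K, act L c g x ∈ K}.Finite := by
  have F := A.fwd
  have hPinv := orth_inv L F.hB hW
  set Sg := {g | ∃ x ∈ K, act L c g x ∈ K} with hSg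
  obtain ⟨C', hC'⟩ := bound_L F (hK.image D.pw.continuous) (by
    rintro _ ⟨x, hx, rfl⟩
    exact hKO x hx)
  obtain ⟨C, hC0, hC⟩ : ∃ C : ℝ, 0 < C ∧ ∀ g ∈ Sg, ‖L g‖ ≤ C := by
    refine ⟨max C' 1, by positivity, ?_⟩
    rintro g ⟨x, hx, hgx⟩
    refine le_max_of_le_left (hC' g ⟨D.pw x, ⟨x, hx, rfl⟩, ⟨_, hgx, ?_⟩⟩)
    rw [act, map_add, hpc, add_zero, D.pw_L L F.hB hPinv]
  have hinv : ∀ g ∈ Sg, g⁻¹ ∈ Sg := by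
    rintro g ⟨x, hx, hgx⟩
    exact ⟨_, hgx, by rw [act_inv_act hcc]; exact hx⟩
  obtain ⟨k, hk⟩ := hK.isBounded.exists_norm_le
  have hc2 : ∀ g ∈ Sg, ‖c g‖ ≤ k + C * k := by
    intro g hg
    have hLg := hC g hg
    obtain ⟨x, hx, hgx⟩ := hg
    have e : c g = act L c g x - L g x := by rw [act]; abel
    rw [e]
    refine (norm_sub_le _ _).trans (add_le_add (hk _ hgx) ?_)
    refine ((L g).le_opNorm x).trans ?_
    have := hk x hx
    gcongr
  obtain ⟨α, hα, col, hcol⟩ := exists_finite_cover (E := V n →L[ℝ] V n) C (ε / C) (by positivity)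
  refine Set.Finite.of_finite_fibers (fun g => col (L g)) (Set.toFinite _) ?_
  rintro _ ⟨g0, hg0, rfl⟩
  have hfin := (A.fin (C * (k + C * k) + (k + C * k))).image (fun κ => g0 * κ)
  refine hfin.subset ?_
  rintro h ⟨hh, hcolh⟩
  refine ⟨g0⁻¹ * h, ?_, mul_inv_cancel_left _ _⟩
  have hcolh : col (L h) = col (L g0) := hcolh
  have h1 : ‖L (g0⁻¹ * h) - 1‖ < ε := by
    have e : L (g0⁻¹ * h) - 1 = L g0⁻¹ * (L h - L g0) := by
      rw [mul_sub, ← map_mul, ← map_mul, inv_mul_cancel, map_one]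
    rw [e]
    have h2 := hcol _ _ (hC h hh) (hC g0 hg0) hcolh
    rw [lt_div_iff₀ hC0] at h2
    calc _ ≤ ‖L g0⁻¹‖ * ‖L h - L g0‖ := norm_mul_le _ _
      _ ≤ C * ‖L h - L g0‖ := by gcongr; exact hC _ (hinv g0 hg0)
      _ < ε := by linarith
  have h2 := hK0 _ (hsm _ h1)
  have h3 := hc (g0⁻¹ * h)
  rw [h2, sub_zero] at h3
  change ‖b (g0⁻¹ * h)‖ ≤ _
  rw [← h3, hcc]
  refine (norm_add_le _ _).trans (add_le_add ?_ (hc2 _ (hinv g0 hg0)))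
  refine ((L g0⁻¹).le_opNorm _).trans ?_
  have i1 := hC _ (hinv g0 hg0)
  have i2 := hc2 h hh
  gcongr

end GK


namespace GK
open scoped commutatorElement Topology

lemma B_contDiff (n : ℕ) : ContDiff ℝ 1 fun x : V n => B n x x := by
  change ContDiff ℝ 1 fun x : V n => lorentzForm n x x
  unfold lorentzForm
  fun_prop

lemma q_const {n : ℕ} (pw : V n →L[ℝ] V n) (f : V n → V n) (x : V n)
    (hf : ContDiffAt ℝ 1 f x) (h : ∀ y, B n (pw (f y)) (pw (f y)) = -1) :
    (fderiv ℝ f x).det = 0 := by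
  by_contra hd
  let q : V n → ℝ := fun y => B n (pw y) (pw y)
  have hq : ContDiff ℝ 1 q := (B_contDiff n).comp pw.contDiff
  have hqd : HasFDerivAt q (fderiv ℝ q (f x)) (f x) :=
    (hq.differentiable one_ne_zero (f x)).hasFDerivAt
  have hfd : HasFDerivAt f (fderiv ℝ f x) x := (hf.differentiableAt one_ne_zero).hasFDerivAt
  have h1 : (fderiv ℝ q (f x)).comp (fderiv ℝ f x) = 0 := by
    have h2 : HasFDerivAt (fun y => q (f y)) ((fderiv ℝ q (f x)).comp (fderiv ℝ f x)) x :=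
      hqd.comp x hfd
    have h3 : (fun y => q (f y)) = fun _ => (-1 : ℝ) := funext h
    rw [h3] at h2
    exact h2.unique (hasFDerivAt_const _ _)
  have hsurj : Function.Surjective (fderiv ℝ f x) := by
    have := (LinearMap.equivOfDetNeZero (fderiv ℝ f x : V n →ₗ[ℝ] V n) hd).surjective
    exact this
  obtain ⟨z, hz⟩ := hsurj (f x)
  have h4 : fderiv ℝ q (f x) (f x) = 0 := by
    have := DFunLike.congr_fun h1 z
    rw [ContinuousLinearMap.comp_apply, hz] at this
    exact this
  have h5 : HasDerivAt (fun t : ℝ => q (t • f x)) (fderiv ℝ q (f x) (f x)) 1 := by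
    have h6 : HasDerivAt (fun t : ℝ => t • f x) (f x) 1 := by
      simpa using (hasDerivAt_id (1:ℝ)).smul_const (f x)
    have hqd' : HasFDerivAt q (fderiv ℝ q (f x)) ((1:ℝ) • f x) := by rw [one_smul]; exact hqd
    exact hqd'.comp_hasDerivAt (1:ℝ) h6
  have h7 : (fun t : ℝ => q (t • f x)) = fun t => -(t^2) := by
    funext t
    change B n (pw (t • f x)) (pw (t • f x)) = _
    rw [map_smul, Bml, map_smul, smul_eq_mul, h]
    ring
  rw [h7, h4] at h5
  have h8 : HasDerivAt (fun t : ℝ => -(t^2)) (-(2:ℝ)) 1 := by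
    have h9 := (hasDerivAt_pow 2 (1:ℝ)).neg
    norm_num at h9
    exact h9
  have := h5.unique h8
  norm_num at this

theorem NE {n : ℕ} {G : Type*} [Group G] {L : G →* (V n →L[ℝ] V n)} {b : G → V n}
    (A : Aff L b) : Elem L := by
  by_contra hE
  obtain ⟨W, hW, hv, hirr⟩ := exists_W A.fwd hE
  obtain ⟨ε, hε, hsm⟩ := claimA A hE W hW hv hirr
  obtain ⟨D⟩ := exists_PDat (orth W) (orth_pos (hv.imp fun v h => ⟨h.1, h.2.1⟩))
  have hK0 : ∀ κ, (∀ w ∈ W, L κ w = w) → D.pw (b κ) = 0 := by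
    intro κ hκ
    by_contra h
    exact hE (caseP5 A W hW hv hirr D ⟨κ, hκ, h⟩)
  have hb : Coc L b := A.coc
  have hpL := D.pw_L L A.fwd.hB (orth_inv L A.fwd.hB hW)
  have hpp : ∀ x, D.pw (D.pw x) = D.pw x := fun x => D.pw_id (D.pw_mem hv x)
  let c : G → V n := fun g => b g - D.pw (b g)
  have hc : Coc L c := by
    intro g h
    simp only [c, hb g h, map_add, map_sub, hpL]
    abel
  have hpc : ∀ g, D.pw (c g) = 0 := by
    intro g; simp only [c, map_sub, hpp, sub_self]
  have hpact : ∀ g x, D.pw (act L c g x) = L g (D.pw x) := by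
    intro g x; simp only [act, map_add, hpc, add_zero, hpL]
  let O : Set (V n) := {x | D.pw x ∈ tl n}
  have hO : IsOpen O := (tl_open n).preimage D.pw.continuous
  have hOc : Convex ℝ O := (tl_convex n).linear_preimage D.pw.toLinearMap
  have hOinv : ∀ g, ∀ x ∈ O, act L c g x ∈ O := by
    intro g x hx
    change D.pw _ ∈ tl n
    rw [hpact]; exact A.fwd.tl g hx
  obtain ⟨R, hR⟩ := A.cocpt
  have hprop : ∀ K ⊆ (Set.univ : Set (V n)), IsCompact K →
      {g | ∃ x ∈ K, act L b g x ∈ K}.Finite := by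
    intro K _ hK
    obtain ⟨C, hC⟩ := hK.isBounded.exists_norm_le
    exact (A.proper C).subset fun g ⟨x, hx, hgx⟩ => ⟨x, hC x hx, hC _ hgx⟩
  have hK : ∀ x, ∃ g, act L b g x ∈ Metric.closedBall (0 : V n) R := fun x =>
    (hR x).imp fun g hg => by rw [mem_closedBall_zero_iff]; exact hg
  obtain ⟨v, hvW, hvt⟩ := id hv
  obtain ⟨f0, hf0⟩ := EQ hb hc isOpen_univ (fun _ _ _ => Set.mem_univ _) hprop
    (Set.subset_univ _) (isCompact_closedBall (0 : V n) R) v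
  have f0c : ∀ x, ContDiffAt ℝ 1 f0 x := fun x => (hf0 x (Set.mem_univ _) (hK x)).1
  have f0e : ∀ g x, f0 (act L b g x) = act L c g (f0 x) := fun g x =>
    (hf0 x (Set.mem_univ _) (hK x)).2.1 g
  have hvO : v ∈ O := by
    change D.pw v ∈ tl n
    rw [D.pw_id hvW]; exact hvt
  have f0O : ∀ x, f0 x ∈ O := fun x =>
    (hf0 x (Set.mem_univ _) (hK x)).2.2 O hOc (fun g => hOinv g v hvO)
  let q : V n → ℝ := fun y => -(B n (D.pw y) (D.pw y))
  have hq : ContDiff ℝ 1 q := ((B_contDiff n).comp D.pw.contDiff).neg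
  have hq0 : ∀ y ∈ O, 0 < q y := fun y hy => neg_pos.2 hy.1
  let N : V n → V n := fun y => (y - D.pw y) + (Real.sqrt (q y))⁻¹ • D.pw y
  have hNc : ∀ y ∈ O, ContDiffAt ℝ 1 N y := by
    intro y hy
    have h1 : ContDiffAt ℝ 1 (fun y => (Real.sqrt (q y))⁻¹) y :=
      ((hq.contDiffAt).sqrt (hq0 y hy).ne').inv (Real.sqrt_pos.2 (hq0 y hy)).ne'
    have h2 : ContDiffAt ℝ 1 (fun y => D.pw y) y := D.pw.contDiff.contDiffAt
    have h3 : ContDiffAt ℝ 1 (fun y => (Real.sqrt (q y))⁻¹ • D.pw y) y := h1.smul h2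
    exact (contDiffAt_id.sub h2).add h3
  have hpN : ∀ y, D.pw (N y) = (Real.sqrt (q y))⁻¹ • D.pw y := by
    intro y
    simp only [N, map_add, map_sub, map_smul, hpp, sub_self, zero_add]
  have hNO : ∀ y ∈ O, N y ∈ O := by
    intro y hy
    change D.pw (N y) ∈ tl n
    rw [hpN]
    exact tl_smul hy (inv_pos.2 (Real.sqrt_pos.2 (hq0 y hy)))
  have hN1 : ∀ y ∈ O, B n (D.pw (N y)) (D.pw (N y)) = -1 := by
    intro y hy
    rw [hpN, Bml, map_smul, smul_eq_mul]
    have h1 : B n (D.pw y) (D.pw y) = -(Real.sqrt (q y) * Real.sqrt (q y)) := by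
      rw [Real.mul_self_sqrt (hq0 y hy).le]; simp only [q, neg_neg]
    rw [h1]
    have := (Real.sqrt_pos.2 (hq0 y hy)).ne'
    field_simp
  have hNe : ∀ g y, N (act L c g y) = act L c g (N y) := by
    intro g y
    have : q (act L c g y) = q y := by simp only [q, hpact, A.fwd.hB]
    simp only [N, this, hpact]
    simp only [act, map_add, map_sub, map_smul]
    abel
  let f : V n → V n := fun x => N (f0 x)
  have fc : ∀ x, ContDiffAt ℝ 1 f x := fun x => (hNc _ (f0O x)).comp x (f0c x)
  have fe : ∀ g x, f (act L b g x) = act L c g (f x) := fun g x => by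
    simp only [f, f0e, hNe]
  have fO : ∀ x, f x ∈ O := fun x => hNO _ (f0O x)
  have fcont : Continuous f := continuous_iff_continuousAt.2 fun x => (fc x).continuousAt
  have hpropc : ∀ K ⊆ O, IsCompact K → {g | ∃ x ∈ K, act L c g x ∈ K}.Finite := fun K hKO hKc =>
    proper_beta A hW D hc (fun _ => rfl) hpc hε hsm hK0 hKc hKO
  obtain ⟨s, hs⟩ := EQ hc hb hO hOinv hpropc (K := f '' Metric.closedBall (0 : V n) R)
    (by rintro _ ⟨x, _, rfl⟩; exact fO x) ((isCompact_closedBall _ _).image fcont) 0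
  have hs' := fun x => hs (f x) (fO x) (by
    obtain ⟨g, hg⟩ := hK x
    exact ⟨g, _, hg, fe g x⟩)
  have hrd : ∀ x, ContDiffAt ℝ 1 (fun x => s (f x)) x := fun x => (hs' x).1.comp x (fc x)
  refine toolA A (fun x => s (f x)) (contDiff_iff_contDiffAt.2 hrd) ?_ ?_
  · intro g x
    simp only [fe]
    exact (hs' x).2.1 g
  · intro x
    have h1 : fderiv ℝ (fun x => s (f x)) x = (fderiv ℝ s (f x)).comp (fderiv ℝ f x) :=
      fderiv_comp x ((hs' x).1.differentiableAt one_ne_zero) ((fc x).differentiableAt one_ne_zero)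
    have h2 := q_const D.pw f x (fc x) (fun y => hN1 _ (f0O y))
    rw [h1]
    have h3 : ((fderiv ℝ s (f x)).comp (fderiv ℝ f x)).det =
      (fderiv ℝ s (f x)).det * (fderiv ℝ f x).det := LinearMap.det_comp _ _
    rw [h3, h2, mul_zero]

end GK


namespace GK
open scoped commutatorElement Topology

/-- Endomorphisms of `E` extended by zero to `E × ℝ`. -/
def iot {E : Type*} [NormedAddCommGroup E] [NormedSpace ℝ E] (X : E →L[ℝ] E) :
    E × ℝ →L[ℝ] E × ℝ :=
  (ContinuousLinearMap.inl ℝ E ℝ).comp (X.comp (ContinuousLinearMap.fst ℝ E ℝ))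

/-- The projection of `E × ℝ` onto the second factor. -/
def pr2 (E : Type*) [NormedAddCommGroup E] [NormedSpace ℝ E] : E × ℝ →L[ℝ] E × ℝ :=
  (ContinuousLinearMap.inr ℝ E ℝ).comp (ContinuousLinearMap.snd ℝ E ℝ)

lemma iot_apply {E : Type*} [NormedAddCommGroup E] [NormedSpace ℝ E] (X : E →L[ℝ] E) (x : E × ℝ) :
    iot X x = (X x.1, 0) := rfl

lemma pr2_apply {E : Type*} [NormedAddCommGroup E] [NormedSpace ℝ E] (x : E × ℝ) :
    pr2 E x = (0, x.2) := rfl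

lemma iot_norm {E : Type*} [NormedAddCommGroup E] [NormedSpace ℝ E] (X : E →L[ℝ] E) :
    ‖iot X‖ ≤ ‖X‖ := by
  refine ContinuousLinearMap.opNorm_le_bound _ (norm_nonneg _) fun x => ?_
  rw [iot_apply, Prod.norm_mk, norm_zero, max_eq_left (norm_nonneg _)]
  exact (X.le_opNorm _).trans (mul_le_mul_of_nonneg_left (norm_fst_le x) (norm_nonneg _))

lemma mkE {n : ℕ} {G : Type*} [Group G] [Group.FG G] {L : G →* (V n →L[ℝ] V n)} {b : G → V n}
    (A : Aff L b) (Q : Fin 3 → (V n →L[ℝ] V n)) (h1 : ∑ i, Q i = 1) (h2 : ∀ i, Q i * Q i = Q i)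
    (h3 : ∀ i j, i ≠ j → Q i * Q j = 0) (hup : ∀ g, ∀ i j : Fin 3, j < i → Q i * L g * Q j = 0)
    {E : Type*} [NormedAddCommGroup E] [InnerProductSpace ℝ E] [FiniteDimensional ℝ E]
    (σ : G →* (E →L[ℝ] E)) (hσ : ∀ g x, ‖σ g x‖ = ‖x‖) (lam : G →* ℝ) (C : ℝ)
    (hC : ∀ g, lam g = 1 → ‖∑ i, Q i * L g * Q i - 1‖ ≤ C * ‖σ g - 1‖) :
    IsVirtuallyPolycyclic G := by
  let ρ := affRep L b A.coc
  let P : Fin 4 → (V n × ℝ →L[ℝ] V n × ℝ) := Fin.snoc (α := fun _ => V n × ℝ →L[ℝ] V n × ℝ) (fun i => iot (Q i)) (pr2 (V n))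
  have Pc : ∀ i : Fin 3, P i.castSucc = iot (Q i) := fun i => Fin.snoc_castSucc (α := fun _ => V n × ℝ →L[ℝ] V n × ℝ) _ _ i
  have Pl : P (Fin.last 3) = pr2 (V n) := Fin.snoc_last (α := fun _ => V n × ℝ →L[ℝ] V n × ℝ) _ _
  have im : ∀ X Y : V n →L[ℝ] V n, iot X * iot Y = iot (X * Y) := fun X Y => rfl
  have ip : ∀ X : V n →L[ℝ] V n, iot X * pr2 (V n) = 0 := by
    intro X; refine ContinuousLinearMap.ext fun x => ?_
    simp only [ContinuousLinearMap.mul_apply, iot_apply, pr2_apply, map_zero]; rfl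
  have pi : ∀ X : V n →L[ℝ] V n, pr2 (V n) * iot X = 0 := by
    intro X; refine ContinuousLinearMap.ext fun x => ?_
    simp only [ContinuousLinearMap.mul_apply, iot_apply, pr2_apply]; rfl
  have i0 : iot (0 : V n →L[ℝ] V n) = 0 := by
    refine ContinuousLinearMap.ext fun x => ?_; rfl
  have i1 : iot (1 : V n →L[ℝ] V n) + pr2 (V n) = 1 := by
    refine ContinuousLinearMap.ext fun x => ?_
    rw [ContinuousLinearMap.add_apply, iot_apply, pr2_apply]
    ext1 <;> simp
  have isum : ∀ X : Fin 3 → (V n →L[ℝ] V n), ∑ i, iot (X i) = iot (∑ i, X i) := by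
    intro X
    simp only [Fin.sum_univ_three]
    refine ContinuousLinearMap.ext fun x => ?_
    simp only [ContinuousLinearMap.add_apply, iot_apply, Prod.mk_add_mk, add_zero]
  have ir : ∀ g, ∀ X Y : V n →L[ℝ] V n, iot X * ρ g * iot Y = iot (X * L g * Y) := by
    intro g X Y; refine ContinuousLinearMap.ext fun x => ?_
    simp only [ContinuousLinearMap.mul_apply, iot_apply, ρ, affRep_apply, zero_smul, add_zero]
  have pr : ∀ g, ∀ Y : V n →L[ℝ] V n, pr2 (V n) * ρ g * iot Y = 0 := by
    intro g Y; refine ContinuousLinearMap.ext fun x => ?_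
    simp only [ContinuousLinearMap.mul_apply, iot_apply, ρ, affRep_apply, pr2_apply]; rfl
  have prp : ∀ g, pr2 (V n) * ρ g * pr2 (V n) = pr2 (V n) := by
    intro g; refine ContinuousLinearMap.ext fun x => ?_
    simp only [ContinuousLinearMap.mul_apply, ρ, affRep_apply, pr2_apply]
  refine thmE ρ ?_ A.fin2 P ?_ ?_ ?_ ?_ σ hσ lam (|C|) ?_
  · rw [injective_iff_map_eq_one]
    intro g hg
    refine A.faith g ?_ ?_
    · refine ContinuousLinearMap.ext fun x => ?_
      have := congrArg Prod.fst (DFunLike.congr_fun hg (x, (0:ℝ)))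
      simp only [ρ, affRep_apply, zero_smul, add_zero] at this
      exact this
    · have := congrArg Prod.fst (DFunLike.congr_fun hg (0, (1:ℝ)))
      simp only [ρ, affRep_apply, one_smul, map_zero, zero_add] at this
      exact this
  · rw [Fin.sum_univ_castSucc]
    simp only [Pc, Pl]
    rw [isum, h1, i1]
  · rw [Fin.forall_fin_succ']
    refine ⟨fun i => ?_, ?_⟩
    · rw [Pc, im, h2]
    · rw [Pl]; rfl
  · rw [Fin.forall_fin_succ']
    refine ⟨fun i => ?_, ?_⟩
    · rw [Fin.forall_fin_succ']
      refine ⟨fun j hij => ?_, fun _ => ?_⟩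
      · rw [Pc, Pc, im, h3 i j (fun h => hij (by rw [h])), i0]
      · rw [Pc, Pl, ip]
    · rw [Fin.forall_fin_succ']
      refine ⟨fun j hij => ?_, fun h => absurd rfl h⟩
      rw [Pc, Pl, pi]
  · intro g
    change ∀ i j : Fin 4, (j : ℕ) < i + 0 → P i * ρ g * P j = 0
    rw [Fin.forall_fin_succ']
    refine ⟨fun i => ?_, ?_⟩
    · rw [Fin.forall_fin_succ']
      refine ⟨fun j hij => ?_, fun hij => ?_⟩
      · rw [Pc, Pc, ir, hup g i j (by simpa using hij), i0]
      · exfalso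
        simp only [Fin.val_last, Fin.val_castSucc] at hij
        omega
    · rw [Fin.forall_fin_succ']
      refine ⟨fun j hij => ?_, fun h => ?_⟩
      · rw [Pc, Pl, pr]
      · simp at h
  · intro g hg
    rw [Fin.sum_univ_castSucc]
    simp only [Pc, Pl, ir, prp]
    rw [isum, ← i1, add_sub_add_right_eq_sub]
    have : iot (∑ i, Q i * L g * Q i) - iot 1 = iot (∑ i, Q i * L g * Q i - 1) := by
      refine ContinuousLinearMap.ext fun x => ?_
      simp only [ContinuousLinearMap.sub_apply, iot_apply, Prod.mk_sub_mk, sub_zero]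
    rw [this]
    refine (iot_norm _).trans ((hC g hg).trans ?_)
    exact mul_le_mul_of_nonneg_right (le_abs_self C) (norm_nonneg _)

lemma stab_tl {n : ℕ} {G : Type*} [Group G] [Group.FG G] {L : G →* (V n →L[ℝ] V n)} {b : G → V n}
    (A : Aff L b) {v : V n} (hv : v ∈ tl n) (hst : ∀ g, ∃ μ : ℝ, L g v = μ • v) :
    IsVirtuallyPolycyclic G := by
  have hfix : ∀ g, L g v = v := by
    intro g
    obtain ⟨μ, hμ⟩ := hst g
    have h1 := A.fwd.hB g v v
    rw [hμ, Bml, map_smul, smul_eq_mul] at h1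
    have h2 : μ ^ 2 = 1 := by
      have h3 : (μ ^ 2 - 1) * B n v v = 0 := by linarith
      rcases mul_eq_zero.1 h3 with h | h
      · linarith
      · exact absurd h hv.1.ne
    have h4 := (A.fwd.tl g hv).2
    rw [hμ, map_smul, smul_eq_mul] at h4
    have h5 : 0 < μ := pos_of_mul_pos_left h4 hv.2.le
    have h6 : μ = 1 := by nlinarith
    rw [hμ, h6, one_smul]
  let W : Submodule ℝ (V n) := Submodule.span ℝ {v}
  have hvW : v ∈ W := Submodule.mem_span_singleton_self v
  have hWf : ∀ g, ∀ w ∈ W, L g w = w := by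
    intro g w hw
    obtain ⟨a, rfl⟩ := Submodule.mem_span_singleton.1 hw
    rw [map_smul, hfix]
  have hinv := orth_inv L A.fwd.hB (W := W) (fun g w hw => by rw [hWf g w hw]; exact hw)
  obtain ⟨D⟩ := exists_PDat (orth W) (orth_pos ⟨v, hvW, hv.1⟩)
  refine mkE A ![1, 0, 0] (by simp [Fin.sum_univ_three]) ?_ ?_ ?_ (D.rep L hinv)
    (D.rep_norm L A.fwd.hB hinv) 1 (‖D.j‖ * ‖D.p‖) ?_
  · intro i; fin_cases i <;> simp
  · intro i j hij; fin_cases i <;> fin_cases j <;> simp at hij ⊢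
  · intro g i j hij; fin_cases i <;> fin_cases j <;> simp at hij ⊢
  · intro g _
    have : ∑ i, (![1, 0, 0] : Fin 3 → (V n →L[ℝ] V n)) i * L g * (![1, 0, 0] : Fin 3 → (V n →L[ℝ] V n)) i - 1
        = D.j.comp ((D.rep L hinv g - 1).comp D.p) := by
      simp only [Fin.sum_univ_three]
      refine ContinuousLinearMap.ext fun x => ?_
      have h1 := D.pw_apply x
      have h2 := hWf g _ (D.pw_mem ⟨v, hvW, hv⟩ x)
      rw [h1, map_sub] at h2
      simp only [Matrix.cons_val_zero, one_mul, mul_one, Matrix.cons_val_one, mul_zero, zero_mul,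
        add_zero, Matrix.cons_val, ContinuousLinearMap.sub_apply, ContinuousLinearMap.comp_apply,
        map_sub, D.j_rep, ContinuousLinearMap.one_apply]
      rw [sub_eq_sub_iff_sub_eq_sub]
      exact h2
    rw [this]
    calc _ ≤ ‖D.j‖ * ‖(D.rep L hinv g - 1).comp D.p‖ := ContinuousLinearMap.opNorm_comp_le _ _
      _ ≤ ‖D.j‖ * (‖D.rep L hinv g - 1‖ * ‖D.p‖) :=
        mul_le_mul_of_nonneg_left (ContinuousLinearMap.opNorm_comp_le _ _) (norm_nonneg _)
      _ = _ := by ring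

end GK


namespace GK
open scoped commutatorElement Topology

lemma stab_null {n : ℕ} {G : Type*} [Group G] [Group.FG G] {L : G →* (V n →L[ℝ] V n)} {b : G → V n}
    (A : Aff L b) {e : V n} (he0 : e ≠ 0) (hee : B n e e = 0) (hst : ∀ g, ∃ μ : ℝ, L g e = μ • e) :
    IsVirtuallyPolycyclic G := by
  obtain ⟨u, hu⟩ := exists_tl n
  have hue : B n u e ≠ 0 := fun h => by
    have := F4 hu.1 h he0
    linarith
  obtain ⟨f, hf⟩ : ∃ f : V n, f = u - (B n u u / (2 * B n u e)) • e := ⟨_, rfl⟩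
  have hff : B n f f = 0 := by
    rw [hf]
    simp only [map_sub, map_smul, LinearMap.sub_apply, LinearMap.smul_apply, smul_eq_mul, hee,
      B_comm e u]
    field_simp
    ring
  obtain ⟨β, hβ⟩ : ∃ β : ℝ, β = B n e f := ⟨_, rfl⟩
  have hβ0 : β ≠ 0 := by
    rw [hβ, hf]
    simp only [map_sub, map_smul, smul_eq_mul, hee, B_comm e u, mul_zero, sub_zero]
    exact hue
  have hfe : B n f e = β := by rw [B_comm, hβ]
  replace hβ : B n e f = β := hβ.symm
  let W : Submodule ℝ (V n) := Submodule.span ℝ {e, f}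
  have heW : e ∈ W := Submodule.subset_span (by simp)
  have hfW : f ∈ W := Submodule.subset_span (by simp)
  have huW : u ∈ W := by
    have : u = f + (B n u u / (2 * B n u e)) • e := by rw [hf]; abel
    rw [this]
    exact W.add_mem hfW (W.smul_mem _ heW)
  obtain ⟨D⟩ := exists_PDat (orth W) (orth_pos ⟨u, huW, hu.1⟩)
  have hBej : ∀ y, B n e (D.j y) = 0 := fun y => by rw [B_comm]; exact D.jmem y e heW
  have hBfj : ∀ y, B n f (D.j y) = 0 := fun y => by rw [B_comm]; exact D.jmem y f hfW
  have hpe : D.p e = 0 := D.p_zero fun y hy => by rw [B_comm]; exact hy e heW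
  have hpf : D.p f = 0 := D.p_zero fun y hy => by rw [B_comm]; exact hy f hfW
  have hdec : ∀ x, x = (B n f x * β⁻¹) • e + D.j (D.p x) + (B n e x * β⁻¹) • f := by
    intro x
    have h1 := D.pw_mem ⟨u, huW, hu⟩ x
    obtain ⟨a, c, hac⟩ := Submodule.mem_span_pair.1 h1
    rw [D.pw_apply] at hac
    have hx : x = a • e + c • f + D.j (D.p x) := by rw [hac]; abel
    have h2 : B n f x = a * β := by
      rw [hx]
      simp only [map_add, map_smul, smul_eq_mul, hfe, hff, hBfj]
      ring
    have h3 : B n e x = c * β := by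
      rw [hx]
      simp only [map_add, map_smul, smul_eq_mul, hβ, hee, hBej]
      ring
    rw [h2, h3, mul_inv_cancel_right₀ hβ0, mul_inv_cancel_right₀ hβ0]
    nth_rewrite 1 [hx]
    abel
  choose μ hμ using hst
  have hμ1 : ∀ g, B n f (L g e) * β⁻¹ = μ g := by
    intro g
    rw [hμ, map_smul, smul_eq_mul, hfe, mul_inv_cancel_right₀ hβ0]
  have hμ0 : ∀ g, μ g ≠ 0 := by
    intro g h
    have h1 := hμ g
    rw [h, zero_smul] at h1
    have h2 : L g⁻¹ (L g e) = e := by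
      rw [← ContinuousLinearMap.comp_apply]
      change (L g⁻¹ * L g) e = e
      rw [← map_mul, inv_mul_cancel, map_one]
      rfl
    rw [h1, map_zero] at h2
    exact he0 h2.symm
  let lam : G →* ℝ :=
    { toFun := μ
      map_one' := by
        rw [← hμ1, map_one]
        change B n f e * β⁻¹ = 1
        rw [hfe, mul_inv_cancel₀ hβ0]
      map_mul' := fun g h => by
        rw [← hμ1, map_mul]
        change B n f (L g (L h e)) * β⁻¹ = _
        rw [hμ h, map_smul, map_smul, smul_eq_mul, mul_assoc, hμ1, mul_comm] }
  have hBe : ∀ g x, B n e (L g x) = μ g⁻¹ * B n e x := by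
    intro g x
    rw [← A.fwd.hB g⁻¹ e (L g x)]
    have h2 : L g⁻¹ (L g x) = x := by
      change (L g⁻¹ * L g) x = x
      rw [← map_mul, inv_mul_cancel, map_one]
      rfl
    rw [h2, hμ, Bml]
  have hBfLe : ∀ g, μ g = 1 → B n e (L g f) = β := by
    intro g hg
    have := A.fwd.hB g e f
    rw [hμ, hg, one_smul, hβ] at this
    exact this
  have hpLe : ∀ g, D.p (L g e) = 0 := fun g => by rw [hμ, map_smul, hpe, smul_zero]
  have hLj : ∀ g y, L g (D.j y) = (B n f (L g (D.j y)) * β⁻¹) • e + D.j (D.p (L g (D.j y))) := by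
    intro g y
    have := hdec (L g (D.j y))
    rw [hBe g, hBej, mul_zero, zero_mul, zero_smul, add_zero] at this
    exact this
  let σ : G →* (EuclideanSpace ℝ (Fin D.m) →L[ℝ] EuclideanSpace ℝ (Fin D.m)) :=
    { toFun := fun g => D.p.comp ((L g).comp D.j)
      map_one' := by
        refine ContinuousLinearMap.ext fun x => ?_
        rw [map_one]
        exact D.pj x
      map_mul' := fun g h => by
        refine ContinuousLinearMap.ext fun x => ?_
        rw [map_mul]
        change D.p (L g (L h (D.j x))) = D.p (L g (D.j (D.p (L h (D.j x)))))
        nth_rewrite 1 [hLj h x]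
        rw [map_add, map_add, map_smul, map_smul, hpLe, smul_zero, zero_add] }
  have hσa : ∀ g x, σ g x = D.p (L g (D.j x)) := fun _ _ => rfl
  have hσ : ∀ g x, ‖σ g x‖ = ‖x‖ := by
    intro g x
    have h1 := A.fwd.hB g (D.j x) (D.j x)
    rw [D.Bj] at h1
    have h2 : B n (L g (D.j x)) (L g (D.j x)) = ‖σ g x‖ ^ 2 := by
      rw [← D.Bj, hσa]
      generalize ha : B n f (L g (D.j x)) * β⁻¹ = a
      have h3 := hLj g x
      rw [ha] at h3
      generalize D.p (L g (D.j x)) = y at h3 ⊢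
      rw [h3]
      simp only [map_add, map_smul, LinearMap.add_apply, LinearMap.smul_apply, smul_eq_mul, hee,
        hBej, B_comm (D.j y) e]
      ring
    rw [h2] at h1
    exact (sq_eq_sq₀ (norm_nonneg _) (norm_nonneg _)).1 h1
  let Q0 : V n →L[ℝ] V n := (LinearMap.toContinuousLinearMap (B n f)).smulRight (β⁻¹ • e)
  let Q1 : V n →L[ℝ] V n := D.j.comp D.p
  let Q2 : V n →L[ℝ] V n := (LinearMap.toContinuousLinearMap (B n e)).smulRight (β⁻¹ • f)
  have q0 : ∀ x, Q0 x = (B n f x * β⁻¹) • e := fun x => by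
    rw [mul_smul]; rfl
  have q1 : ∀ x, Q1 x = D.j (D.p x) := fun _ => rfl
  have q2 : ∀ x, Q2 x = (B n e x * β⁻¹) • f := fun x => by
    rw [mul_smul]; rfl
  have hβi : β * β⁻¹ = 1 := mul_inv_cancel₀ hβ0
  have z : ∀ X : V n →L[ℝ] V n, (∀ x, X x = 0) → X = 0 := fun X h => ContinuousLinearMap.ext h
  refine mkE A ![Q0, Q1, Q2] ?_ ?_ ?_ ?_ σ hσ lam (‖D.j‖ * ‖D.p‖) ?_
  · rw [Fin.sum_univ_three]
    refine ContinuousLinearMap.ext fun x => ?_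
    change Q0 x + Q1 x + Q2 x = x
    rw [q0, q1, q2]
    exact (hdec x).symm
  · intro i
    refine ContinuousLinearMap.ext fun x => ?_
    fin_cases i
    · change Q0 (Q0 x) = Q0 x
      simp only [q0, map_smul, smul_eq_mul, hfe, mul_assoc, hβi, mul_one]
    · change Q1 (Q1 x) = Q1 x
      simp only [q1, D.pj]
    · change Q2 (Q2 x) = Q2 x
      simp only [q2, map_smul, smul_eq_mul, hβ, mul_assoc, hβi, mul_one]
  · intro i j hij
    refine ContinuousLinearMap.ext fun x => ?_
    fin_cases i <;> fin_cases j
    · exact absurd rfl hij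
    · change Q0 (Q1 x) = 0
      rw [q0, q1, hBfj, zero_mul, zero_smul]
    · change Q0 (Q2 x) = 0
      rw [q0, q2, map_smul, hff, smul_zero, zero_mul, zero_smul]
    · change Q1 (Q0 x) = 0
      rw [q1, q0, map_smul, hpe, smul_zero, map_zero]
    · exact absurd rfl hij
    · change Q1 (Q2 x) = 0
      rw [q1, q2, map_smul, hpf, smul_zero, map_zero]
    · change Q2 (Q0 x) = 0
      rw [q2, q0, map_smul, hee, smul_zero, zero_mul, zero_smul]
    · change Q2 (Q1 x) = 0
      rw [q2, q1, hBej, zero_mul, zero_smul]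
    · exact absurd rfl hij
  · intro g i j hij
    refine ContinuousLinearMap.ext fun x => ?_
    fin_cases i <;> fin_cases j
    · exact absurd hij (by decide)
    · exact absurd hij (by decide)
    · exact absurd hij (by decide)
    · change Q1 (L g (Q0 x)) = 0
      rw [q1, q0, map_smul, map_smul, hpLe, smul_zero, map_zero]
    · exact absurd hij (by decide)
    · exact absurd hij (by decide)
    · change Q2 (L g (Q0 x)) = 0
      rw [q2, q0, hBe, map_smul, hee, smul_zero, mul_zero, zero_mul, zero_smul]
    · change Q2 (L g (Q1 x)) = 0
      rw [q2, q1, hBe, hBej, mul_zero, zero_mul, zero_smul]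
    · exact absurd hij (by decide)
  · intro g hg
    replace hg : μ g = 1 := hg
    have : ∑ i, (![Q0, Q1, Q2] : Fin 3 → (V n →L[ℝ] V n)) i * L g *
        (![Q0, Q1, Q2] : Fin 3 → (V n →L[ℝ] V n)) i - 1
        = D.j.comp ((σ g - 1).comp D.p) := by
      rw [Fin.sum_univ_three]
      refine ContinuousLinearMap.ext fun x => ?_
      change Q0 (L g (Q0 x)) + Q1 (L g (Q1 x)) + Q2 (L g (Q2 x)) - x = D.j (σ g (D.p x) - D.p x)
      nth_rewrite 4 [hdec x]
      rw [q0 x, q1 x, q2 x, map_smul, map_smul, map_smul, map_smul, q0, q1, q2, hμ1, hg, one_smul,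
        hBfLe g hg, hβi, one_smul, map_sub, hσa]
      abel
    rw [this]
    calc _ ≤ ‖D.j‖ * ‖(σ g - 1).comp D.p‖ := ContinuousLinearMap.opNorm_comp_le _ _
      _ ≤ ‖D.j‖ * (‖σ g - 1‖ * ‖D.p‖) :=
        mul_le_mul_of_nonneg_left (ContinuousLinearMap.opNorm_comp_le _ _) (norm_nonneg _)
      _ = _ := by ring

end GK


namespace GK
open scoped commutatorElement Topology

lemma vp_up {G : Type*} [Group G] (H : Subgroup G) (hH : H.index ≠ 0)
    (h : IsVirtuallyPolycyclic H) : IsVirtuallyPolycyclic G := by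
  obtain ⟨K, hK, hs, hf⟩ := h
  let φ : K ≃* K.map H.subtype := K.equivMapOfInjective H.subtype H.subtype_injective
  refine ⟨K.map H.subtype, ?_, ?_, fun S => ?_⟩
  · rw [Subgroup.index_map_subtype]
    exact mul_ne_zero hK hH
  · have : Group.IsSolvable K := hs
    exact Group.isSolvable_of_surjective (f := φ.toMonoidHom) φ.surjective
  · have h1 : ((S.comap φ.toMonoidHom).map φ.toMonoidHom).FG := by
      obtain ⟨T, hT, hTf⟩ := (Subgroup.fg_iff _).1 (hf (S.comap φ.toMonoidHom))
      refine (Subgroup.fg_iff _).2 ⟨φ.toMonoidHom '' T, ?_, hTf.image _⟩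
      rw [← MonoidHom.map_closure, hT]
    rw [Subgroup.map_comap_eq_self_of_surjective φ.surjective] at h1
    exact h1

lemma cocpt_restrict {n : ℕ} {G : Type*} [Group G] {L : G →* (V n →L[ℝ] V n)} {b : G → V n}
    (hb : Coc L b) (hc : ∃ R, ∀ x, ∃ g, ‖L g x + b g‖ ≤ R) (H : Subgroup G) (hH : H.index ≠ 0) :
    ∃ R, ∀ x, ∃ g : H, ‖L g x + b g‖ ≤ R := by
  classical
  obtain ⟨R, hR⟩ := hc
  have : H.FiniteIndex := ⟨hH⟩
  have : Finite (G ⧸ H) := Subgroup.finite_quotient_of_finiteIndex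
  let F : G ⧸ H → ℝ := fun q => ‖L q.out⁻¹‖ * R + ‖b q.out⁻¹‖
  obtain ⟨C, hC⟩ := (Set.finite_range F).bddAbove
  refine ⟨C, fun x => ?_⟩
  obtain ⟨g, hg⟩ := hR x
  have hm : (QuotientGroup.mk g : G ⧸ H).out⁻¹ * g ∈ H := by
    rw [← QuotientGroup.eq, QuotientGroup.out_eq']
  refine ⟨⟨_, hm⟩, ?_⟩
  change ‖act L b ((QuotientGroup.mk g : G ⧸ H).out⁻¹ * g) x‖ ≤ C
  rw [act_mul hb]
  refine le_trans ?_ (hC ⟨QuotientGroup.mk g, rfl⟩)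
  refine (norm_add_le _ _).trans (add_le_add ?_ le_rfl)
  exact ((L _).le_opNorm _).trans (mul_le_mul_of_nonneg_left hg (norm_nonneg _))

lemma Aff.restrict {n : ℕ} {G : Type*} [Group G] {L : G →* (V n →L[ℝ] V n)} {b : G → V n}
    (A : Aff L b) (H : Subgroup G) (hH : H.index ≠ 0) :
    Aff (L.comp H.subtype) (fun g : H => b g) where
  fwd := ⟨fun g => A.fwd.hB g, fun g => A.fwd.hC g⟩
  coc := fun g h => A.coc g h
  faith := fun g h1 h2 => Subtype.ext (A.faith g h1 h2)
  proper := fun R => by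
    have := (A.proper R).preimage (f := fun g : H => (g : G)) Subtype.val_injective.injOn
    exact this
  cocpt := cocpt_restrict A.coc A.cocpt H hH

lemma Aff.fg {n : ℕ} {G : Type*} [Group G] {L : G →* (V n →L[ℝ] V n)} {b : G → V n}
    (A : Aff L b) : Group.FG G := by
  have hb : Coc L b := A.coc
  obtain ⟨R, hR⟩ := A.cocpt
  obtain ⟨D, hD⟩ : ∃ D, D = Metric.ball (0 : V n) (|R| + 1) := ⟨_, rfl⟩
  have hDo : IsOpen D := by rw [hD]; exact Metric.isOpen_ball
  have h0D : (0 : V n) ∈ D := by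
    rw [hD]; exact Metric.mem_ball_self (by positivity)
  have hcov : ∀ x, ∃ g, act L b g x ∈ D := fun x => (hR x).imp fun g hg => by
    rw [hD, mem_ball_zero_iff]
    have := le_abs_self R
    have h2 : ‖act L b g x‖ ≤ R := hg
    linarith
  let S : Set G := {g | ∃ x ∈ D, act L b g x ∈ D}
  have hS : S.Finite := by
    refine (A.proper (|R| + 1)).subset ?_
    rintro g ⟨x, hx, hgx⟩
    rw [hD, mem_ball_zero_iff] at hx hgx
    exact ⟨x, hx.le, hgx.le⟩
  let N : Subgroup G := Subgroup.closure S
  have key : ∀ g h x, act L b g x ∈ D → act L b h x ∈ D → g * h⁻¹ ∈ N := by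
    intro g h x hg hh
    refine Subgroup.subset_closure ⟨_, hh, ?_⟩
    rw [act_mul hb, act_inv_act hb]
    exact hg
  let U : Set (V n) := {x | ∃ g ∈ N, act L b g x ∈ D}
  have hU : IsOpen U := by
    have : U = ⋃ g ∈ N, (act L b g) ⁻¹' D := by
      ext x; simp [U]
    rw [this]
    exact isOpen_biUnion fun g _ => hDo.preimage (act_cont L b g)
  have hUc : Uᶜ = ⋃ g ∈ {g | g ∉ N}, (act L b g) ⁻¹' D := by
    ext x
    simp only [Set.mem_compl_iff, Set.mem_iUnion, Set.mem_preimage, exists_prop, Set.mem_ofPred_eq, U]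
    constructor
    · intro h
      obtain ⟨g, hg⟩ := hcov x
      exact ⟨g, fun hN => h ⟨g, hN, hg⟩, hg⟩
    · rintro ⟨g, hg, hgx⟩ ⟨h, hh, hhx⟩
      have := N.mul_mem (key g h x hgx hhx) hh
      rw [inv_mul_cancel_right] at this
      exact hg this
  have hclosed : IsClosed U := by
    rw [← isOpen_compl_iff, hUc]
    exact isOpen_biUnion fun g _ => hDo.preimage (act_cont L b g)
  have huniv : U = Set.univ := by
    rcases isClopen_iff.1 ⟨hclosed, hU⟩ with h | h
    · exfalso
      have : (0 : V n) ∈ U := ⟨1, N.one_mem, by rw [act_one hb]; exact h0D⟩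
      rw [h] at this
      exact this
    · exact h
  refine ⟨(Subgroup.fg_iff _).2 ⟨S, ?_, hS⟩⟩
  rw [eq_top_iff]
  intro g _
  have hg : act L b g 0 ∈ U := by rw [huniv]; exact Set.mem_univ _
  obtain ⟨h, hh, hx⟩ := hg
  rw [← act_mul hb] at hx
  have h1 := key (h * g) 1 0 hx (by rw [act_one hb]; exact h0D)
  rw [inv_one, mul_one] at h1
  exact (N.mul_mem_cancel_left hh).1 h1

theorem Aff.vp {n : ℕ} {G : Type*} [Group G] {L : G →* (V n →L[ℝ] V n)} {b : G → V n}
    (A : Aff L b) : IsVirtuallyPolycyclic G := by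
  obtain ⟨v, hv, hvc, hi⟩ := NE A
  have A' := A.restrict _ hi
  have := A'.fg
  refine vp_up _ hi ?_
  by_cases h : B n v v = 0
  · exact stab_null A' hv h fun g => g.2
  · exact stab_tl A' (tl_of_cone hvc (lt_of_le_of_ne hvc.1 h)) fun g => g.2

lemma fwd_crit {n : ℕ} {M : V n →L[ℝ] V n} (hM : ∀ x y, B n (M x) (M y) = B n x y) {u : V n}
    (hu : u ∈ tl n) (h : B n u (M u) < 0) {x : V n} (hx : x ∈ cone n) : M x ∈ cone n := by
  have h1 : M u ∈ tl n := by
    rcases tl_of_B (x := M u) (by rw [hM]; exact hu.1) with h2 | h2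
    · exact h2
    · have := tl_B hu (tl_cone h2) (tl_ne h2)
      rw [map_neg] at this
      linarith
  by_cases hx0 : x = 0
  · rw [hx0, map_zero]; exact zero_cone n
  refine ⟨by rw [hM]; exact hx.1, ?_⟩
  by_contra hT
  push Not at hT
  have h3 : -(M x) ∈ cone n := by
    refine ⟨?_, ?_⟩
    · rw [map_neg, map_neg, LinearMap.neg_apply, neg_neg, hM]; exact hx.1
    · rw [map_neg]; linarith
  have h4 := cone_B (tl_cone h1) h3
  rw [map_neg, hM] at h4
  have := tl_B hu hx hx0
  linarith

theorem vp_of_lorentz {n : ℕ} {G : Type*} [Group G] {L : G →* (V n →L[ℝ] V n)} {b : G → V n}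
    (hB : ∀ g x y, B n (L g x) (L g y) = B n x y)
    (coc : Coc L b) (faith : ∀ g, L g = 1 → b g = 0 → g = 1)
    (proper : ∀ R, {g | ∃ x, ‖x‖ ≤ R ∧ ‖L g x + b g‖ ≤ R}.Finite)
    (cocpt : ∃ R, ∀ x, ∃ g, ‖L g x + b g‖ ≤ R) : IsVirtuallyPolycyclic G := by
  classical
  obtain ⟨u, hu⟩ := exists_tl n
  have cr : ∀ g, (∀ x ∈ cone n, L g x ∈ cone n) ↔ B n u (L g u) < 0 := by
    intro g
    constructor
    · intro h
      refine tl_B hu (h u (tl_cone hu)) fun h0 => ?_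
      have := inv_mul_app L g u
      rw [h0, map_zero] at this
      exact tl_ne hu this.symm
    · exact fun h x hx => fwd_crit (hB g) hu h hx
  let H : Subgroup G :=
    { carrier := {g | ∀ x ∈ cone n, L g x ∈ cone n}
      mul_mem' := fun {a b} ha hb x hx => by
        rw [mul_app]; exact ha _ (hb _ hx)
      one_mem' := fun x hx => by rw [one_app]; exact hx
      inv_mem' := fun {g} hg => by
        have h1 := (cr g).1 hg
        refine (cr g⁻¹).2 ?_
        rw [← hB g, mul_inv_app, B_comm]
        exact h1 }
  have hH : H.index ≠ 0 := by
    refine index_ne_zero_of_fin H (fun g => decide (L g u ∈ tl n)) ?_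
    intro g h hgh
    have hgh' : L g u ∈ tl n ↔ L h u ∈ tl n := by simpa using hgh
    refine (cr (g⁻¹ * h)).2 ?_
    rw [← hB g, mul_app, mul_inv_app]
    have t : ∀ k, L k u ∈ tl n ∨ -(L k u) ∈ tl n := fun k =>
      tl_of_B (by rw [hB]; exact hu.1)
    by_cases hg : L g u ∈ tl n
    · exact tl_B hg (tl_cone (hgh'.1 hg)) (tl_ne (hgh'.1 hg))
    · have h1 := (t g).resolve_left hg
      have h2 := (t h).resolve_left fun h => hg (hgh'.2 h)
      have h3 := tl_B h1 (tl_cone h2) (tl_ne h2)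
      rw [map_neg, map_neg, LinearMap.neg_apply, neg_neg] at h3
      exact h3
  refine vp_up H hH (Aff.vp (L := L.comp H.subtype) (b := fun g : H => b g) ?_)
  exact
    { fwd := ⟨fun g => hB g, fun g => g.2⟩
      coc := fun g h => coc g h
      faith := fun g h1 h2 => Subtype.ext (faith g h1 h2)
      proper := fun R => by
        have := (proper R).preimage (f := fun g : H => (g : G)) Subtype.val_injective.injOn
        exact this
      cocpt := cocpt_restrict coc cocpt H hH }

theorem final (n : ℕ)
    (Γ : Subgroup ((Fin (n + 1) → ℝ) ≃ᵃ[ℝ] (Fin (n + 1) → ℝ)))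
    (hlorentz : ∀ γ ∈ Γ, ∀ x y : Fin (n + 1) → ℝ,
      lorentzForm n (γ.linear x) (γ.linear y) = lorentzForm n x y)
    (hproper : ∀ K L : Set (Fin (n + 1) → ℝ), IsCompact K → IsCompact L →
      {γ : (Fin (n + 1) → ℝ) ≃ᵃ[ℝ] (Fin (n + 1) → ℝ) |
        γ ∈ Γ ∧ ∃ x ∈ K, γ x ∈ L}.Finite)
    (hcompact : CompactSpace (Quotient (affineOrbitSetoid n Γ))) :
    IsVirtuallyPolycyclic Γ := by
  let L : Γ →* (V n →L[ℝ] V n) :=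
    { toFun := fun γ => LinearMap.toContinuousLinearMap (γ.1.linear : V n →ₗ[ℝ] V n)
      map_one' := rfl
      map_mul' := fun _ _ => rfl }
  let b : Γ → V n := fun γ => γ.1 0
  have hLa : ∀ γ x, L γ x = γ.1.linear x := fun _ _ => rfl
  have hact : ∀ (γ : Γ) (x : V n), L γ x + b γ = γ.1 x := by
    intro γ x
    have := γ.1.map_vadd 0 x
    simp only [vadd_eq_add, add_zero] at this
    rw [this]
    rfl
  have coc : Coc L b := by
    intro g h
    rw [hact]
    rfl
  have hpr : ∀ R, {g : Γ | ∃ x, ‖x‖ ≤ R ∧ ‖L g x + b g‖ ≤ R}.Finite := by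
    intro R
    have h1 := hproper (Metric.closedBall 0 R) (Metric.closedBall 0 R) (isCompact_closedBall _ _)
      (isCompact_closedBall _ _)
    refine (h1.preimage (f := fun g : Γ => g.1) Subtype.val_injective.injOn).subset ?_
    rintro g ⟨x, hx, hgx⟩
    rw [hact] at hgx
    exact ⟨g.2, x, mem_closedBall_zero_iff.2 hx, mem_closedBall_zero_iff.2 hgx⟩
  refine vp_of_lorentz (L := L) (b := b) (fun g x y => hlorentz g g.2 x y) coc ?_ hpr ?_
  · intro g h1 h2
    refine Subtype.ext (AffineEquiv.ext fun x => ?_)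
    rw [← hact, h1, h2, add_zero]
    rfl
  · let mk : V n → Quotient (affineOrbitSetoid n Γ) := Quotient.mk _
    obtain ⟨k, hk⟩ := isCompact_univ.elim_directed_cover
      (fun k : ℕ => mk '' Metric.ball (0 : V n) k) (fun k => by
        have hq : Topology.IsQuotientMap mk := isQuotientMap_quot_mk
        rw [← hq.isOpen_preimage]
        have : mk ⁻¹' (mk '' Metric.ball (0 : V n) k) = ⋃ g : Γ, (act L b g) ⁻¹' Metric.ball (0 : V n) k := by
          ext x
          simp only [Set.mem_preimage, Set.mem_image, Set.mem_iUnion]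
          constructor
          · rintro ⟨y, hy, hyx⟩
            obtain ⟨γ, hγ, h⟩ := (Quotient.exact hyx.symm : (affineOrbitSetoid n Γ).r x y)
            refine ⟨⟨γ, hγ⟩, ?_⟩
            change L ⟨γ, hγ⟩ x + b ⟨γ, hγ⟩ ∈ _
            rw [hact, h]
            exact hy
          · rintro ⟨g, hg⟩
            refine ⟨_, hg, (Quotient.sound ?_).symm⟩
            exact ⟨g.1, g.2, (hact g x).symm⟩
        rw [this]
        exact isOpen_iUnion fun g => Metric.isOpen_ball.preimage (act_cont L b g))
      (by
        intro q _
        obtain ⟨x, rfl⟩ := Quotient.exists_rep q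
        obtain ⟨k, hk⟩ := exists_nat_gt ‖x‖
        exact Set.mem_iUnion.2 ⟨k, x, mem_ball_zero_iff.2 hk, rfl⟩)
      (Monotone.directed_le fun i j hij => Set.image_mono
        (Metric.ball_subset_ball (Nat.cast_le.2 hij)))
    refine ⟨k, fun x => ?_⟩
    obtain ⟨y, hy, hyx⟩ := hk (Set.mem_univ (mk x))
    obtain ⟨γ, hγ, h⟩ := (Quotient.exact hyx.symm : (affineOrbitSetoid n Γ).r x y)
    refine ⟨⟨γ, hγ⟩, ?_⟩
    rw [hact, h]
    exact (mem_ball_zero_iff.1 hy).le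

end GK

/-- Goldman–Kamishima: the Auslander conjecture for flat Lorentz manifolds.
If a subgroup `Γ` of the affine group of `ℝ^{n+1}` whose linear parts preserve
the Lorentzian form acts properly discontinuously on `ℝ^{n+1}` with compact
quotient, then `Γ` is virtually polycyclic. -/
theorem goldman_kamishima_auslander_lorentz
    (n : ℕ) (hn : 1 ≤ n)
    (Γ : Subgroup ((Fin (n + 1) → ℝ) ≃ᵃ[ℝ] (Fin (n + 1) → ℝ)))
    (hlorentz : ∀ γ ∈ Γ, ∀ x y : Fin (n + 1) → ℝ,
      lorentzForm n (γ.linear x) (γ.linear y) = lorentzForm n x y)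
    (hproper : ∀ K L : Set (Fin (n + 1) → ℝ), IsCompact K → IsCompact L →
      {γ : (Fin (n + 1) → ℝ) ≃ᵃ[ℝ] (Fin (n + 1) → ℝ) |
        γ ∈ Γ ∧ ∃ x ∈ K, γ x ∈ L}.Finite)
    (hcompact : CompactSpace (Quotient (affineOrbitSetoid n Γ))) :
    IsVirtuallyPolycyclic Γ := by
  exact GK.final n Γ hlorentz hproper hcompact
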